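/- arXiv:math/0512375 — 2 statements merged into one kernel-verified Lean document; each statement's English description precedes it below -/
import Mathlib

section
/- Every PAC field of characteristic 0 is C1. That is, if k is a field of characteristic 0 such that every geometrically integral k-variety has a k-point, then every homogeneous polynomial f ∈ k[x_0, …, x_n] of degree d with 1 ≤ d ≤ n has a zero (a_0, …, a_n) ∈ k^{n+1} with (a_0, …, a_n) ≠ (0, …, 0). -/
open MvPolynomial in
lemma exists_indep_mod_irreducible {K : Type} [Field K] {s : ℕ} (p : MvPolynomial (Fin s) K)
    (hp : Irreducible p) : ∃ j : Fin s,
    ∀ q : MvPolynomial {i : Fin s // i ≠ j} K, p ∣ rename Subtype.val q → q = 0 := by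
  classical
  have hv : ∃ j, degreeOf j p ≠ 0 := by
    by_contra! h
    have h0 : p.vars = ∅ := by
      ext i
      simp only [mem_vars_iff_degreeOf_ne_zero, h i, ne_eq, not_true_eq_false, Finset.notMem_empty]
    obtain ⟨a, rfl⟩ : ∃ a, p = C a := ⟨_, vars_eq_empty_iff_eq_C.1 h0⟩
    by_cases ha : a = 0
    · subst ha; simp at hp
    · exact hp.not_isUnit ((IsUnit.mk0 a ha).map C)
  obtain ⟨j, hj⟩ := hv
  refine ⟨j, fun q ⟨r, hr⟩ => ?_⟩
  by_contra hq
  have hinj : Function.Injective (rename (R := K) (Subtype.val : {i : Fin s // i ≠ j} → Fin s)) :=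
    rename_injective _ Subtype.val_injective
  have hne : rename (Subtype.val : {i : Fin s // i ≠ j} → Fin s) q ≠ 0 := by
    intro h; exact hq (hinj (by simpa using h))
  have hr0 : r ≠ 0 := by rintro rfl; exact hne (by simpa using hr)
  have h1 := degreeOf_mul_eq (n := j) hp.ne_zero hr0
  rw [← hr] at h1
  have h2 : degreeOf j (rename (Subtype.val : {i : Fin s // i ≠ j} → Fin s) q) = 0 := by
    by_contra h
    have h3 := mem_vars_iff_degreeOf_ne_zero.2 h
    have h4 := vars_rename _ _ h3
    simp at h4
  omega

/-- The dimension of the zero locus of one equation drops by at most one. -/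
lemma dimension_drop {K : Type} [Field K] {B : Type} [CommRing B] [IsDomain B] [Algebra K B]
    {I : Type} [Fintype I] (b : I → B)
    (hb : Function.Surjective (MvPolynomial.aeval b : MvPolynomial I K →ₐ[K] B))
    {J : Type} [Fintype J] (y : J → B) (hy : AlgebraicIndependent K y)
    (c : B) (hc0 : c ≠ 0) (hcu : ¬ IsUnit c) :
    ∃ (L : Type) (_ : Field L) (_ : Algebra K L) (φ : B →ₐ[K] L), φ c = 0 ∧
      ∃ S : Finset I, AlgebraicIndependent K (fun i : S => φ (b i)) ∧
        Fintype.card J ≤ S.card + 1 := by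
  classical
  have hft : Algebra.FiniteType K B := Algebra.FiniteType.of_surjective _ hb
  obtain ⟨s, g, ginj, gint⟩ := exists_integral_inj_algHom_of_fg K B
  let A := MvPolynomial (Fin s) K
  let : Algebra A B := g.toRingHom.toAlgebra
  have : IsScalarTower K A B := IsScalarTower.of_algebraMap_eq (fun x => (g.commutes x).symm)
  have hginj : Function.Injective (algebraMap A B) := ginj
  have : FaithfulSMul A B := (faithfulSMul_iff_algebraMap_injective A B).2 hginj
  have : Algebra.IsIntegral A B := ⟨gint⟩
  have hJs : Fintype.card J ≤ s := by
    have h1 := hy.cardinalMk_le_trdeg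
    have h2 : IsTranscendenceBasis K (MvPolynomial.X : Fin s → A) :=
      (MvPolynomial.algebraicIndependent_X _ _).isTranscendenceBasis_iff_isAlgebraic.2 (by
        rw [MvPolynomial.adjoin_range_X]
        exact ⟨fun x => isAlgebraic_algebraMap (⟨x, trivial⟩ : (⊤ : Subalgebra K A))⟩)
    have h3 := (h2.algebraMap_comp (A := B)).cardinalMk_eq_trdeg
    rw [← h3] at h1
    simpa using h1
  -- a minimal prime over c
  have : IsNoetherianRing B := Algebra.FiniteType.isNoetherianRing K B
  have hspan : Ideal.span {c} ≠ ⊤ := by rwa [Ne, Ideal.span_singleton_eq_top]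
  obtain ⟨m, hm, hcm⟩ := Ideal.exists_le_maximal _ hspan
  have := hm.isPrime
  obtain ⟨Q, hQmin, hQm⟩ := Ideal.exists_minimalPrimes_le hcm
  have hQht := Ideal.height_le_one_of_isPrincipal_of_mem_minimalPrimes _ Q hQmin
  have hQp : Q.IsPrime := hQmin.1.1
  have hcQ : c ∈ Q := hQmin.1.2 (Ideal.mem_span_singleton_self c)
  have hQ0 : Q ≠ ⊥ := by rintro rfl; exact hc0 hcQ
  have hunder : Q.under A ≠ ⊥ := Ideal.comap_ne_bot_of_integral_mem hc0 hcQ (Algebra.IsIntegral.isIntegral c)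
  obtain ⟨p, hpQ, hpprime⟩ := Ideal.IsPrime.exists_mem_prime_of_ne_bot (inferInstance : (Q.under A).IsPrime) hunder
  have hpI : (Ideal.span {p} : Ideal A).IsPrime := (Ideal.span_singleton_prime hpprime.ne_zero).2 hpprime
  obtain ⟨P, hPQ, hPp, hPo⟩ := Ideal.exists_ideal_le_liesOver_of_le (p := Ideal.span {p}) (q := Q.under A) Q
    ((Ideal.span_singleton_le_iff_mem _).2 hpQ)
  have hP0 : P ≠ ⊥ := by
    rintro rfl
    have := hPo.over
    have hp0 : p ∈ (⊥ : Ideal B).under A := this ▸ Ideal.mem_span_singleton_self p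
    have : algebraMap A B p = 0 := hp0
    exact hpprime.ne_zero (hginj (by simpa using this))
  have hPQe : P = Q := by
    by_contra hne
    have hlt : P < Q := lt_of_le_of_ne hPQ hne
    have h1 := Ideal.height_strict_mono_of_isPrime hlt
    have h2 : P.height = 0 := by
      have := h1.trans_le hQht
      exact Order.lt_one_iff.1 this
    exact hP0 (Ideal.height_eq_zero_iff_eq_bot.1 h2)
  subst hPQe
  obtain ⟨j, hj⟩ := exists_indep_mod_irreducible p hpprime.irreducible
  let q := B ⧸ P
  have hz : AlgebraicIndependent K (fun i : {i : Fin s // i ≠ j} => (Ideal.Quotient.mk P (algebraMap A B (MvPolynomial.X i.1)) : B ⧸ P)) := by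
    rw [algebraicIndependent_iff]
    intro r hr
    apply hj
    rw [← Ideal.mem_span_singleton, hPo.over, Ideal.under_def, Ideal.mem_comap, ← Ideal.Quotient.eq_zero_iff_mem, ← hr]
    have : ((Ideal.Quotient.mkₐ K P).comp (IsScalarTower.toAlgHom K A B)).comp (MvPolynomial.rename Subtype.val) = MvPolynomial.aeval (fun i : {i : Fin s // i ≠ j} => (Ideal.Quotient.mk P (algebraMap A B (MvPolynomial.X i.1)) : B ⧸ P)) := by
      apply MvPolynomial.algHom_ext
      intro i
      rw [MvPolynomial.aeval_X]
      exact congrArg (fun z => Ideal.Quotient.mk P (algebraMap A B z)) (MvPolynomial.rename_X _ _)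
    rw [← this]; rfl
  have hcard1 := hz.cardinalMk_le_trdeg
  -- choose transcendence basis among the generators
  let bb : I → B ⧸ P := fun i => Ideal.Quotient.mk P (b i)
  have hadj : Algebra.adjoin K (Set.range bb) = ⊤ := by
    rw [Algebra.adjoin_range_eq_range_aeval, AlgHom.range_eq_top]
    have : (MvPolynomial.aeval bb : MvPolynomial I K →ₐ[K] B ⧸ P) = (Ideal.Quotient.mkₐ K P).comp (MvPolynomial.aeval b) := by
      ext i; simp [bb]
    rw [this]
    exact (Ideal.Quotient.mkₐ_surjective K P).comp hb
  have : Algebra.IsAlgebraic (Algebra.adjoin K (Set.range bb)) (B ⧸ P) := by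
    refine ⟨fun x => ?_⟩
    exact isAlgebraic_algebraMap (⟨x, by rw [hadj]; trivial⟩ : Algebra.adjoin K (Set.range bb))
  obtain ⟨t, hts, htb⟩ := exists_isTranscendenceBasis_subset (R := K) (Set.range bb)
  have hcard2 := htb.cardinalMk_eq_trdeg
  choose u hu using fun x : t => hts x.2
  have huinj : Function.Injective u := fun x x' h => Subtype.ext (by rw [← hu x, ← hu x', h])
  have : Finite t := Finite.of_injective u huinj
  have := Fintype.ofFinite t
  refine ⟨FractionRing (B ⧸ P), inferInstance, inferInstance,
    (IsScalarTower.toAlgHom K (B ⧸ P) (FractionRing (B ⧸ P))).comp (Ideal.Quotient.mkₐ K P), ?_, 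
    Finset.univ.image u, ?_, ?_⟩
  · simp [Ideal.Quotient.eq_zero_iff_mem.2 hcQ]
  · have hS : ∀ i : (Finset.univ.image u : Finset I), ∃ x : t, u x = i := fun i => by
      obtain ⟨x, -, hx⟩ := Finset.mem_image.1 i.2
      exact ⟨x, hx⟩
    choose v hv using hS
    have hvinj : Function.Injective v := fun i i' h => Subtype.ext (by rw [← hv i, ← hv i', h])
    have h1 := (htb.1.comp v hvinj).map' (f := IsScalarTower.toAlgHom K (B ⧸ P) (FractionRing (B ⧸ P)))
      (FaithfulSMul.algebraMap_injective _ _)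
    have h2 : (⇑(IsScalarTower.toAlgHom K (B ⧸ P) (FractionRing (B ⧸ P))) ∘ Subtype.val ∘ v) =
        fun i => ((IsScalarTower.toAlgHom K (B ⧸ P) (FractionRing (B ⧸ P))).comp
          (Ideal.Quotient.mkₐ K P)) (b i.1) := by
      funext i
      simp only [Function.comp_apply, AlgHom.comp_apply]
      congr 1
      rw [← hu (v i), hv i]
      rfl
    rw [h2] at h1
    exact h1
  · rw [Finset.card_image_of_injective _ huinj, Finset.card_univ]
    rw [← hcard2] at hcard1
    have h5 : Cardinal.mk t = Fintype.card t := Cardinal.mk_fintype _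
    rw [h5, Cardinal.mk_fintype] at hcard1
    have h6 : Fintype.card {i : Fin s // i ≠ j} ≤ Fintype.card t := by exact_mod_cast hcard1
    rw [Fintype.card_subtype_compl, Fintype.card_fin, Fintype.card_subtype_eq] at h6
    omega


lemma exists_algClosed_indep (L1 : Type) [Field L1] (T : Type) :
    ∃ (W : Type) (_ : Field W) (_ : IsAlgClosed W) (_ : Algebra L1 W) (y : T → W),
      AlgebraicIndependent L1 y := by
  have hinjW : Function.Injective (algebraMap (MvPolynomial T L1)
      (AlgebraicClosure (FractionRing (MvPolynomial T L1)))) := by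
    rw [IsScalarTower.algebraMap_eq (MvPolynomial T L1) (FractionRing (MvPolynomial T L1)) _]
    exact (algebraMap (FractionRing (MvPolynomial T L1)) _).injective.comp
      (FaithfulSMul.algebraMap_injective _ _)
  exact ⟨AlgebraicClosure (FractionRing (MvPolynomial T L1)), inferInstance, inferInstance,
    inferInstance, _, (MvPolynomial.algebraicIndependent_X T L1).map'
      (f := IsScalarTower.toAlgHom L1 (MvPolynomial T L1) _) hinjW⟩

lemma exists_embedding {K : Type} [Field K] {L2 : Type} [Field L2] [Algebra K L2]
    {W : Type} [Field W] [IsAlgClosed W] [Algebra K W] {T : Type} (x : T → L2)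
    (hx : IsTranscendenceBasis K x) (y : T → W) (hy : AlgebraicIndependent K y) :
    ∃ e : L2 →ₐ[K] W, ∀ t, e (x t) = y t := by
  let _ : Algebra (MvPolynomial T K) L2 :=
    (MvPolynomial.aeval x : MvPolynomial T K →ₐ[K] L2).toRingHom.toAlgebra
  let _ : Algebra (MvPolynomial T K) W :=
    (MvPolynomial.aeval y : MvPolynomial T K →ₐ[K] W).toRingHom.toAlgebra
  have : FaithfulSMul (MvPolynomial T K) L2 := (faithfulSMul_iff_algebraMap_injective _ _).2 hx.1
  have : FaithfulSMul (MvPolynomial T K) W := (faithfulSMul_iff_algebraMap_injective _ _).2 hy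
  have : Algebra.IsAlgebraic (MvPolynomial T K) L2 := by
    have h := hx.isAlgebraic
    refine Algebra.IsAlgebraic.of_ringHom_of_comp_eq
      (hx.1.aevalEquiv : MvPolynomial T K ≃ₐ[K] _) (RingHom.id L2)
      hx.1.aevalEquiv.surjective Function.injective_id ?_
    refine RingHom.ext fun p => ?_
    exact hx.1.algebraMap_aevalEquiv p
  let e : L2 →ₐ[MvPolynomial T K] W := IsAlgClosed.lift
  have he : ∀ a : K, e (algebraMap K L2 a) = algebraMap K W a := by
    intro a
    have := e.commutes (MvPolynomial.C a)
    have e1 : algebraMap (MvPolynomial T K) L2 (MvPolynomial.C a) = algebraMap K L2 a :=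
      (MvPolynomial.aeval x : MvPolynomial T K →ₐ[K] L2).commutes a
    have e2 : algebraMap (MvPolynomial T K) W (MvPolynomial.C a) = algebraMap K W a :=
      (MvPolynomial.aeval y : MvPolynomial T K →ₐ[K] W).commutes a
    rw [← e1, this, e2]
  refine ⟨{ e.toRingHom with commutes' := he }, fun t => ?_⟩
  have := e.commutes (MvPolynomial.X t)
  have e1 : algebraMap (MvPolynomial T K) L2 (MvPolynomial.X t) = x t :=
    MvPolynomial.aeval_X x t
  have e2 : algebraMap (MvPolynomial T K) W (MvPolynomial.X t) = y t :=
    MvPolynomial.aeval_X y t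
  rw [e1, e2] at this
  exact this

/-- Two field extensions can be amalgamated keeping algebraically independent families
jointly algebraically independent. -/
lemma exists_amalgam {K : Type} [Field K] {L1 L2 : Type} [Field L1] [Algebra K L1]
    [Field L2] [Algebra K L2] {J1 J2 : Type} (x1 : J1 → L1) (x2 : J2 → L2)
    (h1 : AlgebraicIndependent K x1) (h2 : AlgebraicIndependent K x2) :
    ∃ (W : Type) (_ : Field W) (_ : Algebra K W) (i1 : L1 →ₐ[K] W) (i2 : L2 →ₐ[K] W),
      AlgebraicIndependent K (Sum.elim (i1 ∘ x1) (i2 ∘ x2)) := by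
  obtain ⟨T, hT, hTb⟩ := exists_isTranscendenceBasis_superset
    (AlgebraicIndependent.coe_range h2)
  obtain ⟨W, _, _, _, y, hy⟩ := exists_algClosed_indep L1 T
  let _ : Algebra K W := ((algebraMap L1 W).comp (algebraMap K L1)).toAlgebra
  have : IsScalarTower K L1 W := IsScalarTower.of_algebraMap_eq (fun x => rfl)
  have hyK : AlgebraicIndependent K y := by
    have := h1.sumElim_comp hy
    exact this.comp Sum.inl Sum.inl_injective
  obtain ⟨e, he⟩ := exists_embedding _ hTb y hyK
  refine ⟨W, inferInstance, inferInstance, IsScalarTower.toAlgHom K L1 W, e, ?_⟩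
  let j : J2 → T := fun a => ⟨x2 a, hT ⟨a, rfl⟩⟩
  have hj : Function.Injective j := fun a b hab =>
    AlgebraicIndependent.injective h2 (congrArg Subtype.val hab)
  have h3 := ((h1.sumElim_comp hy).comp (Sum.map j id) (hj.sumMap Function.injective_id)).comp
    Sum.swap Sum.swap_leftInverse.injective
  have h4 : (Sum.elim y (algebraMap L1 W ∘ x1) ∘ Sum.map j id) ∘ Sum.swap =
      Sum.elim ((IsScalarTower.toAlgHom K L1 W) ∘ x1) (e ∘ x2) := by
    funext a
    rcases a with a | a
    · rfl
    · exact (he (j a)).symm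
  rw [h4] at h3
  exact h3


open Polynomial in
/-- A generic arc truncated at level `M`, of codimension at most `e`. -/
structure JetArc (K : Type) [Field K] (m M e : ℕ) where
  L : Type
  fieldL : Field L
  algL : Algebra K L
  g : Fin m → L[X]
  S : Finset (Fin m × Fin M)
  card_le : M * m ≤ S.card + e
  indep : AlgebraicIndependent K (fun p : S => (g p.1.1).coeff p.1.2)

attribute [instance] JetArc.fieldL JetArc.algL

/-- `h` vanishes to order at least `s` along the arc. -/
def JetArc.Van {K : Type} [Field K] {m M e : ℕ} (a : JetArc K m M e)
    (h : MvPolynomial (Fin m) K) (s : ℕ) : Prop :=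
  (Polynomial.X : Polynomial a.L) ^ s ∣ MvPolynomial.aeval a.g h

lemma aeval_homog_smul {K A : Type} [Field K] [CommRing A] [Algebra K A] {m D : ℕ}
    (h : MvPolynomial (Fin m) K) (hh : h.IsHomogeneous D) (r : A) (g : Fin m → A) :
    MvPolynomial.aeval (fun j => r * g j) h = r ^ D * MvPolynomial.aeval g h := by
  rw [MvPolynomial.aeval_def, MvPolynomial.aeval_def, MvPolynomial.eval₂_eq, MvPolynomial.eval₂_eq,
    Finset.mul_sum]
  refine Finset.sum_congr rfl fun d hd => ?_
  have hD : ∑ i ∈ d.support, d i = D := by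
    have := hh (MvPolynomial.mem_support_iff.1 hd)
    rw [Finsupp.weight_apply] at this
    simpa [Finsupp.sum] using this
  simp only [mul_pow, Finset.prod_mul_distrib, Finset.prod_pow_eq_pow_sum]
  rw [hD]
  ring

lemma dvd_aeval_sub {K A : Type} [Field K] [CommRing A] [Algebra K A] {m : ℕ}
    (h : MvPolynomial (Fin m) K) (P : A) (g g' : Fin m → A) (hg : ∀ j, P ∣ g j - g' j) :
    P ∣ MvPolynomial.aeval g h - MvPolynomial.aeval g' h := by
  rw [← Ideal.mem_span_singleton, ← Ideal.Quotient.eq]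
  have key : ∀ u : Fin m → A, Ideal.Quotient.mk (Ideal.span {P}) (MvPolynomial.aeval u h) =
      MvPolynomial.aeval (fun j => Ideal.Quotient.mk (Ideal.span {P}) (u j)) h := by
    intro u
    have := (MvPolynomial.comp_aeval_apply (f := u) (Ideal.Quotient.mkₐ K (Ideal.span {P})) h)
    exact this
  rw [key, key]
  congr 2
  funext j
  rw [Ideal.Quotient.eq, Ideal.mem_span_singleton]
  exact hg j

open Polynomial in
lemma crt_two {E : Type} [Field E] (c : E) (hc : c ≠ 0) (M1 M2 : ℕ) (G1 G2 : E[X]) :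
    ∃ γ : E[X], (∀ i, M1 + M2 ≤ i → γ.coeff i = 0) ∧ (X - C c) ^ M1 ∣ γ - G1 ∧
      X ^ M2 ∣ γ - G2 := by
  have hcop : IsCoprime ((X - C c) ^ M1) ((X : E[X]) ^ M2) := by
    apply IsCoprime.pow
    have := Polynomial.isCoprime_X_sub_C_of_isUnit_sub (a := c) (b := (0:E)) (by simpa using hc)
    simpa using this
  obtain ⟨u, v, huv⟩ := hcop
  have hmon : ((X - C c) ^ M1 * X ^ M2 : E[X]).Monic :=
    ((monic_X_sub_C c).pow M1).mul (monic_X_pow M2)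
  set P : E[X] := (X - C c) ^ M1 * X ^ M2 with hP
  set w : E[X] := G1 * (v * X ^ M2) + G2 * (u * (X - C c) ^ M1) with hw
  have hmod : P ∣ w %ₘ P - w := by
    rw [modByMonic_eq_sub_mul_div]
    exact ⟨-(w /ₘ P), by ring⟩
  have h1 : (X - C c) ^ M1 ∣ w - G1 := by
    refine ⟨u * (G2 - G1), ?_⟩
    rw [hw]
    linear_combination G1 * huv
  have h2 : X ^ M2 ∣ w - G2 := by
    refine ⟨v * (G1 - G2), ?_⟩
    rw [hw]
    linear_combination G2 * huv
  refine ⟨w %ₘ P, fun i hi => ?_, ?_, ?_⟩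
  · apply coeff_eq_zero_of_degree_lt
    refine (degree_modByMonic_lt w hmon).trans_le ?_
    have : P.degree = ((M1 + M2 : ℕ) : WithBot ℕ) := by
      rw [hP, degree_mul, degree_pow, degree_pow, degree_X_sub_C, degree_X]
      simp
    rw [this]
    exact_mod_cast hi
  · have := dvd_add ((Dvd.intro _ rfl : (X - C c) ^ M1 ∣ P).trans hmod) h1
    simpa using this
  · have := dvd_add ((Dvd.intro_left _ rfl : X ^ M2 ∣ P).trans hmod) h2
    simpa using this

/-- Amalgamation together with a new independent element. -/
lemma exists_amalgam_param {K : Type} [Field K] {L1 L2 : Type} [Field L1] [Algebra K L1]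
    [Field L2] [Algebra K L2] {J1 J2 : Type} (x1 : J1 → L1) (x2 : J2 → L2)
    (h1 : AlgebraicIndependent K x1) (h2 : AlgebraicIndependent K x2) :
    ∃ (E : Type) (_ : Field E) (_ : Algebra K E) (f1 : L1 →ₐ[K] E) (f2 : L2 →ₐ[K] E) (c : E),
      AlgebraicIndependent K (Sum.elim (fun _ : Unit => c) (Sum.elim (f1 ∘ x1) (f2 ∘ x2))) := by
  obtain ⟨W, _, _, i1, i2, hW⟩ := exists_amalgam x1 x2 h1 h2
  obtain ⟨E, _, _, _, y, hy⟩ := exists_algClosed_indep W Unit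
  let _ : Algebra K E := ((algebraMap W E).comp (algebraMap K W)).toAlgebra
  have : IsScalarTower K W E := IsScalarTower.of_algebraMap_eq (fun x => rfl)
  refine ⟨E, inferInstance, inferInstance, (IsScalarTower.toAlgHom K W E).comp i1,
    (IsScalarTower.toAlgHom K W E).comp i2, y (), ?_⟩
  have h3 := hW.sumElim_comp hy
  convert h3 using 2
  funext a
  rcases a with a | a <;> rfl


open Polynomial in
/-- Generators of the degeneration algebra. -/
noncomputable def degGen {E : Type} [Field E] {m M : ℕ} (c : E) (γ : Fin m → E[X]) :
    Option (Fin m × Fin M) → E[X]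
  | none => C c
  | some p => C ((γ p.1).coeff p.2) * X

open Polynomial in
lemma degGen_nonunit {K E : Type} [Field K] [Field E] [Algebra K E] {m M : ℕ} (c : E)
    (hc : AlgebraicIndependent K (fun _ : Unit => c)) (γ : Fin m → E[X])
    (w : MvPolynomial (Option (Fin m × Fin M)) K) 
    (h1 : C c * MvPolynomial.aeval (degGen c γ) w = 1) : False := by
  have h2 := congrArg ((Polynomial.aeval (0 : E) : E[X] →ₐ[E] E).restrictScalars K) h1
  rw [map_mul, map_one, MvPolynomial.comp_aeval_apply] at h2
  have h3 : MvPolynomial.aeval (fun i => ((Polynomial.aeval (0 : E) : E[X] →ₐ[E] E).restrictScalars K)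
      (degGen (M := M) c γ i)) w = MvPolynomial.aeval (fun _ : Unit => c)
        (MvPolynomial.aeval (fun i : Option (Fin m × Fin M) => (i.elim (MvPolynomial.X ()) (fun _ => 0) :
          MvPolynomial Unit K)) w) := by
    rw [MvPolynomial.comp_aeval_apply]
    congr 2
    funext i
    rcases i with _ | p <;> simp [degGen]
  rw [h3] at h2
  set w' := (MvPolynomial.aeval (fun i : Option (Fin m × Fin M) => (i.elim (MvPolynomial.X ()) (fun _ => 0) :
          MvPolynomial Unit K)) w) with hw'
  have h4 : MvPolynomial.aeval (fun _ : Unit => c) (MvPolynomial.X () * w' - 1) = 0 := by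
    rw [map_sub, map_mul, MvPolynomial.aeval_X, map_one, sub_eq_zero, ← h2]
    simp
  have h5 := (algebraicIndependent_iff.1 hc) _ h4
  have h6 := congrArg (MvPolynomial.eval (fun _ => (0:K))) h5
  simp at h6

open Polynomial in
lemma map_aeval_poly {K A A' : Type} [Field K] [CommRing A] [Algebra K A] [CommRing A']
    [Algebra K A'] (φ : A →ₐ[K] A') {m : ℕ} (g : Fin m → A[X]) (h : MvPolynomial (Fin m) K) :
    (MvPolynomial.aeval g h).map (φ : A →+* A') =
      MvPolynomial.aeval (fun j => (g j).map (φ : A →+* A')) h :=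
  MvPolynomial.comp_aeval_apply (f := g) (Polynomial.mapAlgHom φ) h

open Polynomial in
lemma collide_core {K E : Type} [Field K] [Field E] [Algebra K E] {m M e : ℕ} (c : E)
    (γ : Fin m → E[X]) (hγ : ∀ j i, M ≤ i → (γ j).coeff i = 0)
    {J : Type} [Fintype J] (z : J → E)
    (hz : AlgebraicIndependent K (Sum.elim (fun _ : Unit => c) z))
    (hmem : ∀ j, C (z j) * X ∈
      (MvPolynomial.aeval (degGen (M := M) c γ) : MvPolynomial _ K →ₐ[K] E[X]).range)
    (hcard : M * m ≤ Fintype.card J + e) :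
    ∃ a : JetArc K m M e, ∀ (h : MvPolynomial (Fin m) K) (D s1 s2 : ℕ), h.IsHomogeneous D →
      (X - C c) ^ s1 * X ^ s2 ∣ MvPolynomial.aeval γ h → a.Van h (s1 + s2) := by
  classical
  have hc : AlgebraicIndependent K (fun _ : Unit => c) := hz.comp Sum.inl Sum.inl_injective
  have hc0 : c ≠ 0 := AlgebraicIndependent.ne_zero hc ()
  let I := Option (Fin m × Fin M)
  let ψ : MvPolynomial I K →ₐ[K] E[X] := MvPolynomial.aeval (degGen (M := M) c γ)
  let B := ψ.range
  let b : I → B := fun i => ⟨degGen c γ i, MvPolynomial.X i,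
    MvPolynomial.aeval_X (degGen (M := M) c γ) i⟩
  have hb : (MvPolynomial.aeval b : MvPolynomial I K →ₐ[K] B) = ψ.rangeRestrict := by
    apply MvPolynomial.algHom_ext
    intro i
    rw [MvPolynomial.aeval_X]
    apply Subtype.ext
    exact (MvPolynomial.aeval_X (degGen (M := M) c γ) i).symm
  have hbs : Function.Surjective (MvPolynomial.aeval b : MvPolynomial I K →ₐ[K] B) := by
    rw [hb]; exact ψ.rangeRestrict_surjective
  let y : Unit ⊕ J → B := Sum.elim (fun _ => b none) (fun j => ⟨C (z j) * X, hmem j⟩)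
  have hy : AlgebraicIndependent K y := by
    refine AlgebraicIndependent.of_comp (((Polynomial.aeval (1 : E) : E[X] →ₐ[E] E).restrictScalars K).comp B.val) ?_
    convert hz using 1
    funext i
    rcases i with i | i <;> simp [y, b, degGen]
  have hbn0 : b none ≠ 0 := by
    intro h
    have : (C c : E[X]) = 0 := congrArg Subtype.val h
    exact hc0 (by simpa using this)
  have hbnu : ¬ IsUnit (b none) := by
    intro h
    obtain ⟨w, hw⟩ := h.exists_right_inv
    obtain ⟨w, p, rfl⟩ := w
    exact degGen_nonunit c hc γ p (congrArg Subtype.val hw)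
  obtain ⟨L, _, _, φ, hφ, S, hS, hScard⟩ := dimension_drop b hbs y hy (b none) hbn0 hbnu
  have hnS : none ∉ S := by
    intro hn
    exact hS.ne_zero ⟨none, hn⟩ hφ
  let Γ : Fin m → B[X] := fun j => ∑ i : Fin M, monomial (i : ℕ) (b (some (j, i)))
  have hΓ : ∀ j (i : Fin M), (Γ j).coeff i = b (some (j, i)) := by
    intro j i
    simp only [Γ, finsetSum_coeff, coeff_monomial]
    rw [Finset.sum_eq_single i]
    · simp
    · intro i' _ hne
      rw [if_neg]
      exact fun h => hne (Fin.ext h)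
    · simp
  have hΓ' : ∀ j, (Γ j).map (B.val : B →+* E[X]) = C X * (γ j).map C := by
    intro j
    ext1 i
    rw [coeff_map, coeff_C_mul, coeff_map]
    by_cases hi : i < M
    · have := hΓ j ⟨i, hi⟩
      simp only at this
      rw [this]
      exact mul_comm _ _
    · rw [hγ j i (not_lt.1 hi)]
      have : (Γ j).coeff i = 0 := by
        simp only [Γ, finsetSum_coeff, coeff_monomial]
        apply Finset.sum_eq_zero
        intro i' _
        rw [if_neg]
        have := i'.2
        omega
      rw [this]; simp
  refine ⟨{ L := L, fieldL := inferInstance, algL := inferInstance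
            g := fun j => (Γ j).map (φ : B →+* L)
            S := S.eraseNone
            card_le := ?_
            indep := ?_ }, ?_⟩
  · rw [Finset.card_eraseNone_of_not_mem hnS]
    simp at hScard
    omega
  · have h1 := hS.comp (fun p : S.eraseNone => (⟨some p.1, Finset.mem_eraseNone.1 p.2⟩ : S))
      (by intro p q hp; exact Subtype.ext (Option.some_injective _ (congrArg Subtype.val hp)))
    convert h1 using 1
    funext p
    simp only [coeff_map, Function.comp_apply]
    rw [hΓ]
    rfl
  · intro h D s1 s2 hh hdvd
    have hd1 : (X - C (b none)) ^ s1 * X ^ s2 ∣ MvPolynomial.aeval Γ h := by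
      rw [← Polynomial.map_dvd_map (B.val : B →+* E[X]) Subtype.val_injective
        (((monic_X_sub_C _).pow s1).mul (monic_X_pow s2))]
      have e1 : (MvPolynomial.aeval Γ h).map (B.val : B →+* E[X]) =
          MvPolynomial.aeval (fun j => C X * (γ j).map C) h := by
        rw [map_aeval_poly B.val Γ h]
        congr 2
        funext j
        exact hΓ' j
      rw [e1, aeval_homog_smul h hh]
      apply Dvd.dvd.mul_left
      have e2 : MvPolynomial.aeval (fun j => (γ j).map C) h = (MvPolynomial.aeval γ h).map C :=
        (map_aeval_poly (IsScalarTower.toAlgHom K E E[X]) γ h).symm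
      rw [e2]
      have := Polynomial.map_dvd (C : E →+* E[X]) hdvd
      simpa [b, degGen] using this
    have hd2 := Polynomial.map_dvd (φ : B →+* L) hd1
    have e3 : (MvPolynomial.aeval Γ h).map (φ : B →+* L) = MvPolynomial.aeval (fun j => (Γ j).map (φ : B →+* L)) h :=
      map_aeval_poly φ Γ h
    rw [e3] at hd2
    simp only [Polynomial.map_mul, Polynomial.map_pow, Polynomial.map_sub, map_X, map_C] at hd2
    have hφ' : (φ : B →+* L) (b none) = 0 := hφ
    rw [hφ', C_0, sub_zero, ← pow_add] at hd2
    exact hd2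


open Polynomial in
lemma mem_range_of_coeff {K E : Type} [Field K] [Field E] [Algebra K E] {m M : ℕ} (c : E)
    (γ : Fin m → E[X]) (hγ : ∀ j i, M ≤ i → (γ j).coeff i = 0) (j : Fin m) (i : ℕ) :
    C ((γ j).coeff i) * X ∈
      (MvPolynomial.aeval (degGen (M := M) c γ) : MvPolynomial _ K →ₐ[K] E[X]).range := by
  by_cases hi : i < M
  · exact ⟨MvPolynomial.X (some (j, ⟨i, hi⟩)), MvPolynomial.aeval_X _ _⟩
  · rw [hγ j i (not_lt.1 hi)]
    simp

open Polynomial in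
lemma mem_range_of_taylor {K E : Type} [Field K] [Field E] [Algebra K E] {m M : ℕ} (c : E)
    (γ : Fin m → E[X]) (hγ : ∀ j i, M ≤ i → (γ j).coeff i = 0) (j : Fin m) (i : ℕ) :
    C ((taylor c (γ j)).coeff i) * X ∈
      (MvPolynomial.aeval (degGen (M := M) c γ) : MvPolynomial _ K →ₐ[K] E[X]).range := by
  have hcm : (C c : E[X]) ∈
      (MvPolynomial.aeval (degGen (M := M) c γ) : MvPolynomial _ K →ₐ[K] E[X]).range :=
    ⟨MvPolynomial.X none, MvPolynomial.aeval_X _ _⟩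
  rw [taylor_coeff, hasseDeriv_apply, Polynomial.sum_def, eval_finsetSum, map_sum, Finset.sum_mul]
  refine Subalgebra.sum_mem _ fun l _ => ?_
  rw [eval_monomial]
  have : (C ((l.choose i : E) * (γ j).coeff l * c ^ (l - i)) * X : E[X]) =
      (l.choose i : E[X]) * (C ((γ j).coeff l) * X) * (C c) ^ (l - i) := by
    simp only [C_mul, C_pow, map_natCast]; ring
  rw [this]
  exact mul_mem (mul_mem (natCast_mem _ _) (mem_range_of_coeff c γ hγ j l)) (pow_mem hcm _)

open Polynomial in
theorem JetArc.collide {K : Type} [Field K] {m M1 M2 e1 e2 : ℕ} (a1 : JetArc K m M1 e1)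
    (a2 : JetArc K m M2 e2) : ∃ a : JetArc K m (M1 + M2) (e1 + e2),
      ∀ (h : MvPolynomial (Fin m) K) (D s1 s2 : ℕ), h.IsHomogeneous D → s1 ≤ M1 → s2 ≤ M2 →
        a1.Van h s1 → a2.Van h s2 → a.Van h (s1 + s2) := by
  classical
  obtain ⟨E, _, _, f1, f2, c, hind⟩ := exists_amalgam_param _ _ a1.indep a2.indep
  have hc0 : c ≠ 0 := hind.ne_zero (Sum.inl ())
  let G1 : Fin m → E[X] := fun j => (a1.g j).map (f1 : a1.L →+* E)
  let G2 : Fin m → E[X] := fun j => (a2.g j).map (f2 : a2.L →+* E)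
  choose γ hγ hγ1 hγ2 using fun j => crt_two c hc0 M1 M2 ((G1 j).comp (X - C c)) (G2 j)
  have hmem1 : ∀ p : a1.S, C (f1 ((a1.g p.1.1).coeff p.1.2)) * X ∈
      (MvPolynomial.aeval (degGen (M := M1 + M2) c γ) : MvPolynomial _ K →ₐ[K] E[X]).range := by
    intro p
    have : f1 ((a1.g p.1.1).coeff p.1.2) = (taylor c (γ p.1.1)).coeff p.1.2 := by
      have h1 : X ^ M1 ∣ taylor c (γ p.1.1) - G1 p.1.1 := by
        obtain ⟨q, hq⟩ := hγ1 p.1.1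
        refine ⟨q.comp (X + C c), ?_⟩
        have := congrArg (fun r => r.comp (X + C c)) hq
        simp only [sub_comp, mul_comp, pow_comp, X_comp, C_comp, comp_assoc] at this
        simpa [taylor_apply] using this
      have h2 := X_pow_dvd_iff.1 h1 p.1.2 p.1.2.2
      rw [coeff_sub, sub_eq_zero] at h2
      rw [h2]
      simp [G1]
    rw [this]
    exact mem_range_of_taylor c γ hγ _ _
  have hmem2 : ∀ p : a2.S, C (f2 ((a2.g p.1.1).coeff p.1.2)) * X ∈
      (MvPolynomial.aeval (degGen (M := M1 + M2) c γ) : MvPolynomial _ K →ₐ[K] E[X]).range := by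
    intro p
    have : f2 ((a2.g p.1.1).coeff p.1.2) = (γ p.1.1).coeff p.1.2 := by
      have h2 := X_pow_dvd_iff.1 (hγ2 p.1.1) p.1.2 p.1.2.2
      rw [coeff_sub, sub_eq_zero] at h2
      rw [h2]
      simp [G2]
    rw [this]
    exact mem_range_of_coeff c γ hγ _ _
  obtain ⟨a, ha⟩ := collide_core (M := M1 + M2) (e := e1 + e2) c γ hγ _ hind
    (by rintro (p | p); exacts [hmem1 p, hmem2 p])
    (by
      have h1 := a1.card_le
      have h2 := a2.card_le
      simp only [Fintype.card_sum, Fintype.card_coe]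
      rw [add_mul]
      omega)
  refine ⟨a, fun h D s1 s2 hh hs1 hs2 hv1 hv2 => ha h D s1 s2 hh ?_⟩
  have hcop : IsCoprime ((X - C c) ^ s1) ((X : E[X]) ^ s2) := by
    apply IsCoprime.pow
    have := Polynomial.isCoprime_X_sub_C_of_isUnit_sub (a := c) (b := (0:E)) (by simpa using hc0)
    simpa using this
  refine hcop.mul_dvd ?_ ?_
  · have h1 := dvd_aeval_sub h ((X - C c) ^ M1) γ (fun j => (G1 j).comp (X - C c)) hγ1
    have h2 : (X - C c) ^ s1 ∣ MvPolynomial.aeval (fun j => (G1 j).comp (X - C c)) h := by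
      have e1 : MvPolynomial.aeval (fun j => (G1 j).comp (X - C c)) h =
          (MvPolynomial.aeval G1 h).comp (X - C c) :=
        (MvPolynomial.comp_aeval_apply (f := G1)
          ((Polynomial.aeval (X - C c) : E[X] →ₐ[E] E[X]).restrictScalars K) h).symm
      rw [e1, ← map_aeval_poly]
      obtain ⟨q, hq⟩ := hv1
      rw [hq]
      simp
    have := dvd_add ((pow_dvd_pow _ hs1).trans h1) h2
    simpa using this
  · have h1 := dvd_aeval_sub h (X ^ M2) γ G2 hγ2
    have h2 : X ^ s2 ∣ MvPolynomial.aeval G2 h := by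
      rw [← map_aeval_poly]
      obtain ⟨q, hq⟩ := hv2
      rw [hq]
      simp
    have := dvd_add ((pow_dvd_pow _ hs2).trans h1) h2
    simpa using this


lemma JetArc.Van.mono {K : Type} [Field K] {m M e : ℕ} {a : JetArc K m M e}
    {h : MvPolynomial (Fin m) K} {s t : ℕ} (hs : a.Van h s) (hts : t ≤ s) : a.Van h t :=
  (pow_dvd_pow _ hts).trans hs

lemma JetArc.van_zero {K : Type} [Field K] {m M e : ℕ} (a : JetArc K m M e)
    (h : MvPolynomial (Fin m) K) : a.Van h 0 := by
  simp [JetArc.Van]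

theorem JetArc.replicate {K : Type} [Field K] {m M e : ℕ} (a : JetArc K m M e) (r : ℕ) :
    ∃ a' : JetArc K m (r * M) (r * e), ∀ (h : MvPolynomial (Fin m) K) (D s : ℕ),
      h.IsHomogeneous D → s ≤ M → a.Van h s → a'.Van h (r * s) := by
  induction r with
  | zero =>
    refine ⟨{ L := K, fieldL := inferInstance, algL := inferInstance, g := fun _ => 0, S := ∅
              card_le := by simp
              indep := ?_ }, ?_⟩
    · have : IsEmpty ((∅ : Finset (Fin m × Fin (0 * M)))) := ⟨fun x => absurd x.2 (Finset.notMem_empty _)⟩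
      exact (algebraicIndependent_empty_type_iff).2 (FaithfulSMul.algebraMap_injective _ _)
    · intro h D s _ _ _
      exact (JetArc.van_zero _ _).mono (Nat.zero_mul s).le
  | succ r ih =>
    obtain ⟨b, hb⟩ := ih
    obtain ⟨a', ha'⟩ := b.collide a
    rw [Nat.succ_mul, Nat.succ_mul]
    refine ⟨a', fun h D s hh hs hv => ?_⟩
    rw [Nat.succ_mul]
    exact ha' h D _ _ hh (Nat.mul_le_mul_left _ hs) hs (hb h D s hh hs hv) hv

/-- Good sets of polynomials. -/
def GoodSet {K : Type} [Field K] {m : ℕ} (F : MvPolynomial (Fin m) K) (c : ℝ)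
    (H : Set (MvPolynomial (Fin m) K)) : Prop :=
  ∃ δ : ℝ, 0 < δ ∧ ∀ η : ℝ, 0 < η → ∃ M e : ℕ, 1 ≤ M ∧ ∃ a : JetArc K m M e,
    (e : ℝ) ≤ (c + η) * M ∧ a.Van F M ∧ ∀ h ∈ H, ∃ s : ℕ, s ≤ M ∧ δ * M ≤ s ∧ a.Van h s

lemma GoodSet.union {K : Type} [Field K] {m d : ℕ} {F : MvPolynomial (Fin m) K}
    (hF : F.IsHomogeneous d) {c : ℝ} {H1 H2 : Set (MvPolynomial (Fin m) K)}
    (hH1 : ∀ h ∈ H1, ∃ D : ℕ, h.IsHomogeneous D) (hH2 : ∀ h ∈ H2, ∃ D : ℕ, h.IsHomogeneous D)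
    (h1 : GoodSet F c H1) (h2 : GoodSet F c H2) : GoodSet F c (H1 ∪ H2) := by
  obtain ⟨δ1, hδ1, h1⟩ := h1
  obtain ⟨δ2, hδ2, h2⟩ := h2
  refine ⟨min δ1 δ2 / 2, by positivity, fun η hη => ?_⟩
  obtain ⟨M1, e1, hM1, a1, he1, hF1, hs1⟩ := h1 η hη
  obtain ⟨M2, e2, hM2, a2, he2, hF2, hs2⟩ := h2 η hη
  obtain ⟨b1, hb1⟩ := a1.replicate M2
  obtain ⟨b2, hb2⟩ := a2.replicate M1
  obtain ⟨a, ha⟩ := b1.collide b2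
  have hM1' : (1 : ℝ) ≤ M1 := by exact_mod_cast hM1
  have hM2' : (1 : ℝ) ≤ M2 := by exact_mod_cast hM2
  refine ⟨M2 * M1 + M1 * M2, M2 * e1 + M1 * e2, by nlinarith, a, ?_, ?_, ?_⟩
  · push_cast
    have := mul_le_mul_of_nonneg_left he1 (by positivity : (0:ℝ) ≤ M2)
    have := mul_le_mul_of_nonneg_left he2 (by positivity : (0:ℝ) ≤ M1)
    nlinarith
  · exact ha F d _ _ hF le_rfl le_rfl (hb1 F d _ hF le_rfl hF1) (hb2 F d _ hF le_rfl hF2)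
  · intro h hh
    rcases hh with hh | hh
    · obtain ⟨s, hsM, hδ, hv⟩ := hs1 h hh
      obtain ⟨D, hD⟩ := hH1 h hh
      refine ⟨M2 * s, ?_, ?_, ?_⟩
      · have := Nat.mul_le_mul_left M2 hsM
        omega
      · push_cast
        have h3 := mul_le_mul_of_nonneg_left hδ (by positivity : (0:ℝ) ≤ M2)
        have h4 : min δ1 δ2 * ((M1 : ℝ) * M2) ≤ δ1 * (M1 * M2) :=
          mul_le_mul_of_nonneg_right (min_le_left _ _) (by positivity)
        nlinarith
      · exact ha h D _ 0 hD (Nat.mul_le_mul_left _ hsM) (Nat.zero_le _)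
          (hb1 h D s hD hsM hv) (JetArc.van_zero _ _)
    · obtain ⟨s, hsM, hδ, hv⟩ := hs2 h hh
      obtain ⟨D, hD⟩ := hH2 h hh
      refine ⟨M1 * s, ?_, ?_, ?_⟩
      · have := Nat.mul_le_mul_left M1 hsM
        omega
      · push_cast
        have h3 := mul_le_mul_of_nonneg_left hδ (by positivity : (0:ℝ) ≤ M1)
        have h4 : min δ1 δ2 * ((M1 : ℝ) * M2) ≤ δ2 * (M1 * M2) :=
          mul_le_mul_of_nonneg_right (min_le_right _ _) (by positivity)
        nlinarith
      · have := ha h D 0 _ hD (Nat.zero_le _) (Nat.mul_le_mul_left _ hsM)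
          (JetArc.van_zero _ _) (hb2 h D s hD hsM hv)
        rwa [zero_add] at this

lemma GoodSet.finset {K : Type} [Field K] {m d : ℕ} {F : MvPolynomial (Fin m) K}
    (hF : F.IsHomogeneous d) {c : ℝ} (h0 : GoodSet F c ∅) (T : Finset (MvPolynomial (Fin m) K))
    (hT : ∀ h ∈ T, (∃ D : ℕ, h.IsHomogeneous D) ∧ GoodSet F c {h}) :
    GoodSet F c (T : Set (MvPolynomial (Fin m) K)) := by
  classical
  induction T using Finset.induction_on with
  | empty => simpa using h0
  | insert x T hx ih =>
    rw [Finset.coe_insert, Set.insert_eq]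
    refine GoodSet.union hF ?_ ?_ (hT x (Finset.mem_insert_self _ _)).2
      (ih fun h hh => hT h (Finset.mem_insert_of_mem hh))
    · rintro h rfl; exact (hT _ (Finset.mem_insert_self _ _)).1
    · intro h hh; exact (hT h (Finset.mem_insert_of_mem hh)).1

/-- The ideal generated by good homogeneous polynomials. -/
noncomputable def goodIdeal {K : Type} [Field K] {m : ℕ} (F : MvPolynomial (Fin m) K) (c : ℝ) :
    Ideal (MvPolynomial (Fin m) K) :=
  Ideal.span {h | (∃ D : ℕ, h.IsHomogeneous D) ∧ GoodSet F c {h}}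

lemma GoodSet.of_span {K : Type} [Field K] {m : ℕ} {F : MvPolynomial (Fin m) K} {c : ℝ}
    (T H : Set (MvPolynomial (Fin m) K)) (hT : GoodSet F c T) (hH : ∀ x ∈ H, x ∈ Ideal.span T) :
    GoodSet F c H := by
  obtain ⟨δ, hδ, h⟩ := hT
  refine ⟨min δ 1, by positivity, fun η hη => ?_⟩
  obtain ⟨M, e, hM, a, he, hF, hs⟩ := h η hη
  refine ⟨M, e, hM, a, he, hF, fun x hx => ⟨⌈min δ 1 * (M : ℝ)⌉₊, ?_, Nat.le_ceil _, ?_⟩⟩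
  · apply Nat.ceil_le.2
    have : min δ 1 * (M : ℝ) ≤ 1 * M := mul_le_mul_of_nonneg_right (min_le_right _ _) (by positivity)
    simpa using this
  · set s := ⌈min δ 1 * (M : ℝ)⌉₊ with hsdef
    have hle : Ideal.span T ≤ (Ideal.span {(Polynomial.X : Polynomial a.L) ^ s}).comap
        (MvPolynomial.aeval a.g : MvPolynomial (Fin m) K →ₐ[K] Polynomial a.L) := by
      rw [Ideal.span_le]
      intro t ht
      obtain ⟨s', hs'M, hδs', hv⟩ := hs t ht
      have hss : s ≤ s' := by
        apply Nat.ceil_le.2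
        exact (mul_le_mul_of_nonneg_right (min_le_left _ _) (by positivity)).trans hδs'
      have := hv.mono hss
      exact Ideal.mem_span_singleton.2 this
    exact Ideal.mem_span_singleton.1 (hle (hH x hx))

lemma goodSet_of_mem_goodIdeal {K : Type} [Field K] {m d : ℕ} {F : MvPolynomial (Fin m) K}
    (hF : F.IsHomogeneous d) {c : ℝ} (h0 : GoodSet F c ∅) (T : Finset (MvPolynomial (Fin m) K))
    (hT : ∀ x ∈ T, x ∈ goodIdeal F c) : GoodSet F c (T : Set (MvPolynomial (Fin m) K)) := by
  classical
  have h1 : ∀ x ∈ T, ∃ U : Finset (MvPolynomial (Fin m) K),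
      (U : Set (MvPolynomial (Fin m) K)) ⊆ {h | (∃ D : ℕ, h.IsHomogeneous D) ∧ GoodSet F c {h}} ∧
      x ∈ Ideal.span (U : Set (MvPolynomial (Fin m) K)) := fun x hx =>
    Submodule.mem_span_finite_of_mem_span (hT x hx)
  choose! U hU1 hU2 using h1
  refine GoodSet.of_span ((T.biUnion U : Finset _) : Set (MvPolynomial (Fin m) K)) _
    (GoodSet.finset hF h0 _ ?_) ?_
  · intro h hh
    obtain ⟨x, hx, hxh⟩ := Finset.mem_biUnion.1 hh
    exact hU1 x hx hxh
  · intro x hx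
    exact Ideal.span_mono (by
      intro u hu
      exact Finset.mem_biUnion.2 ⟨x, hx, hu⟩) (hU2 x hx)

lemma X_pow_half_dvd {L : Type} [Field L] (A B : Polynomial L) (s : ℕ)
    (h : Polynomial.X ^ s ∣ A * B) :
    Polynomial.X ^ ((s + 1) / 2) ∣ A ∨ Polynomial.X ^ ((s + 1) / 2) ∣ B := by
  rw [pow_dvd_iff_le_emultiplicity, emultiplicity_mul Polynomial.prime_X] at h
  rw [pow_dvd_iff_le_emultiplicity, pow_dvd_iff_le_emultiplicity]
  by_contra! hc
  obtain ⟨h1, h2⟩ := hc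
  generalize emultiplicity Polynomial.X A = u at *
  generalize emultiplicity Polynomial.X B = v at *
  lift u to ℕ using ne_top_of_lt h1
  lift v to ℕ using ne_top_of_lt h2
  norm_cast at *
  omega

lemma goodSet_mul {K : Type} [Field K] {m : ℕ} {F : MvPolynomial (Fin m) K} {c : ℝ}
    (x y : MvPolynomial (Fin m) K) (h : GoodSet F c {x * y}) :
    GoodSet F c {x} ∨ GoodSet F c {y} := by
  obtain ⟨δ, hδ, h⟩ := h
  by_contra! hc
  obtain ⟨hx, hy⟩ := hc
  have hx' : ∃ η : ℝ, 0 < η ∧ ¬ ∃ M e : ℕ, 1 ≤ M ∧ ∃ a : JetArc K m M e,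
    (e : ℝ) ≤ (c + η) * M ∧ a.Van F M ∧ ∀ h ∈ ({x} : Set _), ∃ s : ℕ, s ≤ M ∧ (δ/2) * M ≤ s ∧ a.Van h s := by
    by_contra! hcon
    exact hx ⟨δ / 2, by positivity, hcon⟩
  have hy' : ∃ η : ℝ, 0 < η ∧ ¬ ∃ M e : ℕ, 1 ≤ M ∧ ∃ a : JetArc K m M e,
    (e : ℝ) ≤ (c + η) * M ∧ a.Van F M ∧ ∀ h ∈ ({y} : Set _), ∃ s : ℕ, s ≤ M ∧ (δ/2) * M ≤ s ∧ a.Van h s := by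
    by_contra! hcon
    exact hy ⟨δ / 2, by positivity, hcon⟩
  obtain ⟨η1, hη1, hx'⟩ := hx'
  obtain ⟨η2, hη2, hy'⟩ := hy'
  obtain ⟨M, e, hM, a, he, hF, hs⟩ := h (min η1 η2) (by positivity)
  obtain ⟨s, hsM, hδs, hv⟩ := hs _ rfl
  have hv' : Polynomial.X ^ s ∣ MvPolynomial.aeval a.g x * MvPolynomial.aeval a.g y := by
    rw [← map_mul]; exact hv
  have hs2 : (s + 1) / 2 ≤ M := by omega
  have hs3 : δ / 2 * M ≤ (((s + 1) / 2 : ℕ) : ℝ) := by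
    have h1 : s ≤ 2 * ((s + 1) / 2) := by omega
    have h2 : (s : ℝ) ≤ 2 * (((s + 1) / 2 : ℕ) : ℝ) := by exact_mod_cast h1
    linarith
  rcases X_pow_half_dvd _ _ _ hv' with h1 | h1
  · refine hx' ⟨M, e, hM, a, he.trans ?_, hF, ?_⟩
    · apply mul_le_mul_of_nonneg_right _ (by positivity)
      linarith [min_le_left η1 η2]
    · rintro _ rfl
      exact ⟨_, hs2, hs3, h1⟩
  · refine hy' ⟨M, e, hM, a, he.trans ?_, hF, ?_⟩
    · apply mul_le_mul_of_nonneg_right _ (by positivity)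
      linarith [min_le_right η1 η2]
    · rintro _ rfl
      exact ⟨_, hs2, hs3, h1⟩


lemma not_isUnit_of_homog {K : Type} [Field K] {m d : ℕ} {F : MvPolynomial (Fin m) K}
    (hF : F.IsHomogeneous d) (hd : 1 ≤ d) : ¬ IsUnit F := by
  intro hu
  have h1 : IsUnit (MvPolynomial.aeval (fun _ => (0 : K)) F) := hu.map _
  have h2 := aeval_homog_smul F hF (0 : K) (fun _ => (0 : K))
  simp only [mul_zero] at h2
  rw [zero_pow (by omega), zero_mul] at h2
  rw [h2] at h1
  exact not_isUnit_zero h1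

lemma exists_first_arc {K : Type} [Field K] {m d : ℕ} {F : MvPolynomial (Fin m) K}
    (hF : F.IsHomogeneous d) (hd : 1 ≤ d) (hF0 : F ≠ 0) :
    ∃ a : JetArc K m 1 1, a.Van F 1 := by
  classical
  obtain ⟨L, _, _, φ, hφ, S, hS, hcard⟩ := dimension_drop (K := K)
    (MvPolynomial.X : Fin m → MvPolynomial (Fin m) K) 
    (by rw [MvPolynomial.aeval_X_left]; exact Function.surjective_id)
    MvPolynomial.X (MvPolynomial.algebraicIndependent_X _ _) F hF0 (not_isUnit_of_homog hF hd)
  refine ⟨{ L := L, fieldL := inferInstance, algL := inferInstance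
            g := fun j => Polynomial.C (φ (MvPolynomial.X j))
            S := S ×ˢ Finset.univ
            card_le := by simpa using hcard
            indep := ?_ }, ?_⟩
  · have := hS.comp (fun p : (S ×ˢ (Finset.univ : Finset (Fin 1)) : Finset (Fin m × Fin 1)) =>
      (⟨p.1.1, (Finset.mem_product.1 p.2).1⟩ : S)) (by
        intro p q hpq
        have h1 : p.1.1 = q.1.1 := congrArg Subtype.val hpq
        exact Subtype.ext (Prod.ext h1 (Subsingleton.elim _ _)))
    convert this using 1
    funext p
    have : ((p.1.2 : Fin 1) : ℕ) = 0 := by omega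
    rw [this]
    simp
  · unfold JetArc.Van
    have e1 := MvPolynomial.comp_aeval_apply (f := (MvPolynomial.X : Fin m → MvPolynomial (Fin m) K))
      ((IsScalarTower.toAlgHom K L (Polynomial L)).comp φ) F
    have e2 : MvPolynomial.aeval (fun j => Polynomial.C (φ (MvPolynomial.X j))) F
        = Polynomial.C (φ F) := by
      rw [MvPolynomial.aeval_X_left_apply] at e1
      exact e1.symm
    simp only
    rw [e2, hφ]
    simp

lemma exists_threshold {K : Type} [Field K] {m d : ℕ} {F : MvPolynomial (Fin m) K}
    (hF : F.IsHomogeneous d) (hd : 1 ≤ d) (hF0 : F ≠ 0) :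
    ∃ c : ℝ, c ≤ 1 ∧ (∀ M e : ℕ, 1 ≤ M → ∀ a : JetArc K m M e, a.Van F M → c * M ≤ e) ∧
      ∀ η : ℝ, 0 < η → ∃ M e : ℕ, 1 ≤ M ∧ ∃ a : JetArc K m M e,
        (e : ℝ) ≤ (c + η) * M ∧ a.Van F M := by
  let Z : Set ℝ := {x | ∃ M e : ℕ, 1 ≤ M ∧ ∃ a : JetArc K m M e, a.Van F M ∧ x = e / M}
  have hbdd : BddBelow Z := ⟨0, by rintro x ⟨M, e, hM, a, ha, rfl⟩; positivity⟩
  obtain ⟨a0, ha0⟩ := exists_first_arc hF hd hF0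
  have h1 : (1 : ℝ) ∈ Z := ⟨1, 1, le_rfl, a0, ha0, by simp⟩
  refine ⟨sInf Z, csInf_le hbdd h1, ?_, ?_⟩
  · intro M e hM a ha
    have hM' : (0 : ℝ) < M := by exact_mod_cast hM
    have : sInf Z ≤ (e : ℝ) / M := csInf_le hbdd ⟨M, e, hM, a, ha, rfl⟩
    exact (le_div_iff₀ hM').1 this
  · intro η hη
    obtain ⟨x, ⟨M, e, hM, a, ha, rfl⟩, hx⟩ := exists_lt_of_csInf_lt ⟨1, h1⟩
      (show sInf Z < sInf Z + η by linarith)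
    have hM' : (0 : ℝ) < M := by exact_mod_cast hM
    refine ⟨M, e, hM, a, ?_, ha⟩
    exact ((div_le_iff₀ hM').1 hx.le)

/-- If all coordinates vanish to order `s`, count the coefficients. -/
lemma JetArc.codim_of_van {K : Type} [Field K] {m M e : ℕ} (a : JetArc K m M e) (s : ℕ)
    (hsM : s ≤ M) (hv : ∀ j, a.Van (MvPolynomial.X j) s) : s * m ≤ e := by
  classical
  have hsub : a.S ⊆ Finset.univ ×ˢ (Finset.univ.filter fun i : Fin M => s ≤ (i : ℕ)) := by
    intro p hp
    simp only [Finset.mem_product, Finset.mem_univ, Finset.mem_filter, true_and]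
    by_contra hlt
    have h1 := hv p.1
    rw [JetArc.Van, MvPolynomial.aeval_X, Polynomial.X_pow_dvd_iff] at h1
    exact a.indep.ne_zero ⟨p, hp⟩ (h1 _ (not_le.1 hlt))
  have h1 := Finset.card_le_card hsub
  have h2 : (Finset.univ.filter fun i : Fin M => s ≤ (i : ℕ)).card ≤ M - s := by
    have : (Finset.univ.filter fun i : Fin M => s ≤ (i : ℕ)).card ≤ (Finset.Ico s M).card := by
      refine Finset.card_le_card_of_injOn (fun i => (i : ℕ)) ?_ ?_
      · intro i hi
        simp at hi ⊢
        exact hi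
      · intro i _ i' _ h
        exact Fin.ext h
    simpa using this
  rw [Finset.card_product, Finset.card_univ, Fintype.card_fin] at h1
  have h3 := a.card_le
  have h4 := Nat.mul_le_mul_left m h2
  have h5 : m * (M - s) = m * M - m * s := Nat.mul_sub m M s
  have h6 : m * s ≤ m * M := Nat.mul_le_mul_left m hsM
  rw [mul_comm M m] at h3
  rw [mul_comm s m]
  omega

lemma JetArc.shift {K : Type} [Field K] {m M e d M' e' : ℕ} (a : JetArc K m M e) (s : ℕ)
    (hv : ∀ j, a.Van (MvPolynomial.X j) s)
    {F : MvPolynomial (Fin m) K} (hF : F.IsHomogeneous d) (hFv : a.Van F M)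
    (hd : 1 ≤ d) (hM : M = M' + d * s) (he : e = e' + s * m) :
    ∃ a' : JetArc K m M' e', a'.Van F M' := by
  classical
  choose g hg using fun j => (by
    have := hv j
    rwa [JetArc.Van, MvPolynomial.aeval_X] at this : Polynomial.X ^ s ∣ a.g j)
  have hds : s ≤ d * s := Nat.le_mul_of_pos_left s hd
  let emb : Fin m × Fin M' → Fin m × Fin M := fun p => (p.1, ⟨p.2 + s, by have := p.2.2; omega⟩)
  have hemb : Function.Injective emb := by
    rintro ⟨j, i⟩ ⟨j', i'⟩ h
    simp only [emb, Prod.mk.injEq, Fin.mk.injEq] at h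
    exact Prod.ext h.1 (Fin.ext (by simpa using h.2))
  let S' : Finset (Fin m × Fin M') := Finset.univ.filter fun p => emb p ∈ a.S
  refine ⟨{ L := a.L, fieldL := inferInstance, algL := inferInstance
            g := g
            S := S'
            card_le := ?_
            indep := ?_ }, ?_⟩
  · have hsub : a.S ⊆ S'.image emb ∪
        Finset.univ ×ˢ (Finset.univ.filter fun i : Fin M => M' + s ≤ (i : ℕ)) := by
      intro p hp
      rw [Finset.mem_union]
      by_cases h1 : M' + s ≤ (p.2 : ℕ)
      · right; simp [h1]
      · left
        have h2 : s ≤ (p.2 : ℕ) := by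
          by_contra hlt
          have h1 := hv p.1
          rw [JetArc.Van, MvPolynomial.aeval_X, Polynomial.X_pow_dvd_iff] at h1
          exact a.indep.ne_zero ⟨p, hp⟩ (h1 _ (not_le.1 hlt))
        have h3 : emb (p.1, ⟨p.2 - s, by omega⟩) = p := by
          refine Prod.ext rfl (Fin.ext ?_)
          simp only [emb]
          omega
        refine Finset.mem_image.2 ⟨(p.1, ⟨p.2 - s, by omega⟩), ?_, h3⟩
        simp only [S', Finset.mem_filter, Finset.mem_univ, true_and]
        rw [h3]; exact hp
    have h1 := (Finset.card_le_card hsub).trans (Finset.card_union_le _ _)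
    have h2 : (Finset.univ.filter fun i : Fin M => M' + s ≤ (i : ℕ)).card ≤ d * s - s := by
      have : (Finset.univ.filter fun i : Fin M => M' + s ≤ (i : ℕ)).card ≤
          (Finset.Ico (M' + s) M).card := by
        refine Finset.card_le_card_of_injOn (fun i => (i : ℕ)) ?_ ?_
        · intro i hi
          simp at hi ⊢
          exact hi
        · intro i _ i' _ h
          exact Fin.ext h
      rw [Nat.card_Ico] at this
      omega
    rw [Finset.card_product, Finset.card_univ, Fintype.card_fin,
      Finset.card_image_of_injective _ hemb] at h1
    have h3 := a.card_le
    have h4 := Nat.mul_le_mul_left m h2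
    rw [Nat.mul_sub] at h4
    have hMm : M * m = M' * m + m * (d * s) := by rw [hM]; ring
    have he2 : e = e' + m * s := by rw [he, mul_comm s m]
    have h5 := Nat.mul_le_mul_left m hds
    omega
  · have := a.indep.comp (fun p : S' => (⟨emb p.1, (Finset.mem_filter.1 p.2).2⟩ : a.S)) (by
      intro p q hpq
      exact Subtype.ext (hemb (congrArg Subtype.val hpq)))
    convert this using 1
    funext p
    simp only [Function.comp_apply, emb]
    rw [hg, Polynomial.coeff_X_pow_mul]
  · have h1 : MvPolynomial.aeval a.g F = Polynomial.X ^ (s * d) * MvPolynomial.aeval g F := by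
      have : a.g = fun j => Polynomial.X ^ s * g j := funext hg
      rw [this, aeval_homog_smul F hF, pow_mul]
    have h2 : (Polynomial.X : Polynomial a.L) ^ M ∣ MvPolynomial.aeval a.g F := hFv
    have hXM : (Polynomial.X : Polynomial a.L) ^ M
        = Polynomial.X ^ (s * d) * Polynomial.X ^ M' := by
      rw [← pow_add]
      exact congrArg _ (by rw [hM]; ring)
    rw [h1, hXM] at h2
    exact (mul_dvd_mul_iff_left (pow_ne_zero _ Polynomial.X_ne_zero)).1 h2

lemma exists_X_notMem {K : Type} [Field K] {n d : ℕ} {F : MvPolynomial (Fin (n + 1)) K}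
    (hF : F.IsHomogeneous d) (hd : 1 ≤ d) (hdn : d ≤ n) {c : ℝ} (hc1 : c ≤ 1)
    (hc : ∀ M e : ℕ, 1 ≤ M → ∀ a : JetArc K (n + 1) M e, a.Van F M → c * M ≤ e)
    (h0 : GoodSet F c ∅) : ∃ j, MvPolynomial.X j ∉ goodIdeal F c := by
  classical
  by_contra! hall
  have hg := goodSet_of_mem_goodIdeal hF h0 (Finset.univ.image MvPolynomial.X) (by
    intro x hx
    obtain ⟨j, -, rfl⟩ := Finset.mem_image.1 hx
    exact hall j)
  obtain ⟨δ, hδ, hg⟩ := hg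
  have hd' : (1 : ℝ) ≤ d := by exact_mod_cast hd
  have hdn' : (d : ℝ) ≤ n := by exact_mod_cast hdn
  set η : ℝ := min δ (1 / d) / 2 with hη
  have hη0 : 0 < η := by positivity
  have hηδ : η < δ := by
    have := min_le_left δ (1 / (d:ℝ))
    have : 0 < min δ (1 / (d:ℝ)) := by positivity
    linarith
  have hηd : η * d < 1 := by
    have h1 := min_le_right δ (1 / (d:ℝ))
    have h2 : η < 1 / d := by
      have : (0:ℝ) < 1 / d := by positivity
      linarith
    exact (lt_div_iff₀ (by linarith)).1 h2
  obtain ⟨M, e, hM, a, he, hFv, hs⟩ := hg η hη0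
  have hM' : (1 : ℝ) ≤ M := by exact_mod_cast hM
  set s := ⌈δ * (M : ℝ)⌉₊ with hsdef
  have hsδ : δ * M ≤ s := Nat.le_ceil _
  have hv : ∀ j, s ≤ M ∧ a.Van (MvPolynomial.X j) s := by
    intro j
    obtain ⟨s', hs'M, hs'δ, hv'⟩ := hs (MvPolynomial.X j) (by simp)
    have : s ≤ s' := Nat.ceil_le.2 hs'δ
    exact ⟨this.trans hs'M, hv'.mono this⟩
  have hsM := (hv 0).1
  have hcod := a.codim_of_van s hsM (fun j => (hv j).2)
  have hcod' : (s : ℝ) * (n + 1) ≤ e := by exact_mod_cast hcod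
  by_cases hds : M ≤ d * s
  · have hds' : (M : ℝ) ≤ d * s := by exact_mod_cast hds
    -- e*d ≥ s*d*(n+1) ≥ M*(d+1)
    have h1 : (M : ℝ) * (d + 1) ≤ e * d := by
      calc (M : ℝ) * (d + 1) ≤ (d * s) * (n + 1) := by
            apply mul_le_mul hds' (by linarith) (by linarith) (by positivity)
        _ = (s * (n + 1)) * d := by ring
        _ ≤ e * d := mul_le_mul_of_nonneg_right hcod' (by linarith)
    have h2 : (e : ℝ) * d ≤ (c + η) * M * d := mul_le_mul_of_nonneg_right he (by linarith)
    have h3 : (c + η) * M * d ≤ M * (d + η * d) := by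
      have : c * (M * d) ≤ 1 * (M * d) := mul_le_mul_of_nonneg_right hc1 (by positivity)
      nlinarith
    have h4 : (M : ℝ) * (d + η * d) < M * (d + 1) :=
      mul_lt_mul_of_pos_left (by linarith) (by linarith)
    linarith
  · obtain ⟨a', ha'⟩ := a.shift (M' := M - d * s) (e' := e - s * (n + 1)) s
      (fun j => (hv j).2) hF hFv hd (by omega) (by omega)
    have h1 := hc _ _ (by omega) a' ha'
    rw [Nat.cast_sub (by omega), Nat.cast_sub hcod] at h1
    push_cast at h1
    have hs0 : (0 : ℝ) ≤ s := by positivity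
    have h2 : c * (d * s) ≤ n * s := by
      have h3 : c * (d * s) ≤ 1 * (d * s) := mul_le_mul_of_nonneg_right hc1 (by positivity)
      have h4 : (d : ℝ) * s ≤ n * s := mul_le_mul_of_nonneg_right hdn' hs0
      linarith
    have h5 : η * M < δ * M := mul_lt_mul_of_pos_right hηδ (by linarith)
    nlinarith


lemma JetArc.twist_aux {K : Type} [Field K] (σ : K ≃+* K) {m M e : ℕ} (a : JetArc K m M e)
    (L' : Type) [Field L'] [Algebra K L'] (r : a.L →+* L')
    (hr : ∀ x : K, r (algebraMap K a.L x) = algebraMap K L' (σ x)) :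
    ∃ a' : JetArc K m M e, ∀ (h : MvPolynomial (Fin m) K) (s : ℕ), a.Van h s →
      a'.Van (MvPolynomial.map (σ : K →+* K) h) s := by
  have hcomp : (algebraMap K L').comp (σ : K →+* K) = r.comp (algebraMap K a.L) :=
    RingHom.ext fun x => (hr x).symm
  have h3 : ∀ h : MvPolynomial (Fin m) K, Polynomial.mapRingHom r (MvPolynomial.aeval a.g h) =
        MvPolynomial.aeval (fun j => (a.g j).map r) (MvPolynomial.map (σ : K →+* K) h) := by
    intro h
    induction h using MvPolynomial.induction_on with
    | C x =>
      simp only [MvPolynomial.map_C, MvPolynomial.algHom_C, Polynomial.algebraMap_apply]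
      simp [hr]
    | add p q hp hq =>
      simp only [map_add]
      rw [hp, hq]
    | mul_X p i hp =>
      simp only [map_mul, MvPolynomial.map_X, MvPolynomial.aeval_X]
      rw [hp]
      simp
  refine ⟨{ L := L', fieldL := inferInstance, algL := inferInstance
            g := fun j => (a.g j).map r
            S := a.S
            card_le := a.card_le
            indep := ?_ }, ?_⟩
  · have := a.indep.ringHom_of_comp_eq (σ : K →+* K) r σ.surjective r.injective hcomp
    convert this using 1
    funext p
    simp
  · intro h s hv
    have h1 : (Polynomial.X : Polynomial a.L) ^ s ∣ MvPolynomial.aeval a.g h := hv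
    have h2 := map_dvd (Polynomial.mapRingHom r) h1
    rw [h3, map_pow, Polynomial.coe_mapRingHom, Polynomial.map_X] at h2
    exact h2

lemma JetArc.twist {K : Type} [Field K] (σ : K ≃+* K) {m M e : ℕ} (a : JetArc K m M e) :
    ∃ a' : JetArc K m M e, ∀ (h : MvPolynomial (Fin m) K) (s : ℕ), a.Van h s →
      a'.Van (MvPolynomial.map (σ : K →+* K) h) s := by
  letI alg : Algebra K a.L := ((algebraMap K a.L).comp (σ.symm : K →+* K)).toAlgebra
  refine @JetArc.twist_aux K _ σ m M e a a.L _ alg (RingHom.id _) fun x => ?_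
  have : @algebraMap K a.L _ _ alg (σ x) = @algebraMap K a.L _ _ a.algL (σ.symm (σ x)) := rfl
  rw [this, σ.symm_apply_apply]
  rfl

lemma GoodSet.twist {K : Type} [Field K] (σ : K ≃+* K) {m : ℕ} {F : MvPolynomial (Fin m) K}
    (hF : MvPolynomial.map (σ : K →+* K) F = F) {c : ℝ} {h : MvPolynomial (Fin m) K}
    (hh : GoodSet F c {h}) : GoodSet F c {MvPolynomial.map (σ : K →+* K) h} := by
  obtain ⟨δ, hδ, H⟩ := hh
  refine ⟨δ, hδ, fun η hη => ?_⟩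
  obtain ⟨M, e, hM, a, he, hv, hs⟩ := H η hη
  obtain ⟨a', ha'⟩ := a.twist σ
  refine ⟨M, e, hM, a', he, ?_, ?_⟩
  · have := ha' F M hv
    rwa [hF] at this
  · intro x hx
    rw [Set.mem_singleton_iff] at hx
    obtain ⟨s, h1, h2, h3⟩ := hs h rfl
    exact ⟨s, h1, h2, by rw [hx]; exact ha' h s h3⟩

lemma goodIdeal_twist {K : Type} [Field K] (σ : K ≃+* K) {m : ℕ} {F : MvPolynomial (Fin m) K}
    (hF : MvPolynomial.map (σ : K →+* K) F = F) {c : ℝ} (h : MvPolynomial (Fin m) K)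
    (hh : h ∈ goodIdeal F c) : MvPolynomial.map (σ : K →+* K) h ∈ goodIdeal F c := by
  have : goodIdeal F c ≤ (goodIdeal F c).comap (MvPolynomial.map (σ : K →+* K)) := by
    conv_lhs => rw [goodIdeal]
    rw [Ideal.span_le]
    rintro x ⟨⟨D, hD⟩, hx⟩
    exact Ideal.subset_span ⟨⟨D, hD.map _⟩, hx.twist σ hF⟩
  exact this hh

theorem exists_prime {K : Type} [Field K] {n d : ℕ} (F : MvPolynomial (Fin (n + 1)) K)
    (hF : F.IsHomogeneous d) (hF0 : F ≠ 0) (hd : 1 ≤ d) (hdn : d ≤ n) :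
    ∃ I : Ideal (MvPolynomial (Fin (n + 1)) K), I.IsPrime ∧ F ∈ I ∧
      (∃ j, MvPolynomial.X j ∉ I) ∧
      ∀ σ : K ≃+* K, MvPolynomial.map (σ : K →+* K) F = F →
        ∀ h ∈ I, MvPolynomial.map (σ : K →+* K) h ∈ I := by
  obtain ⟨c, hc1, hc, hex⟩ := exists_threshold hF hd hF0
  have h0 : GoodSet F c ∅ := by
    refine ⟨1, one_pos, fun η hη => ?_⟩
    obtain ⟨M, e, hM, a, he, hv⟩ := hex η hη
    exact ⟨M, e, hM, a, he, hv, fun h hh => absurd hh (Set.notMem_empty _)⟩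
  have hFg : GoodSet F c {F} := by
    refine ⟨1, one_pos, fun η hη => ?_⟩
    obtain ⟨M, e, hM, a, he, hv⟩ := hex η hη
    refine ⟨M, e, hM, a, he, hv, fun h hh => ⟨M, le_rfl, by simp, ?_⟩⟩
    rw [Set.mem_singleton_iff] at hh
    rwa [hh]
  have hX := exists_X_notMem hF hd hdn hc1 hc h0
  refine ⟨goodIdeal F c, ?_, Ideal.subset_span ⟨⟨d, hF⟩, hFg⟩, hX,
    fun σ hσ h hh => goodIdeal_twist σ hσ h hh⟩
  letI := MvPolynomial.gradedAlgebra (σ := Fin (n + 1)) (R := K)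
  have hhom : (goodIdeal F c).IsHomogeneous
      (MvPolynomial.homogeneousSubmodule (Fin (n + 1)) K) := by
    refine Ideal.homogeneous_span _ _ ?_
    rintro x ⟨⟨D, hD⟩, -⟩
    exact ⟨D, hD⟩
  refine hhom.isPrime_of_homogeneous_mem_or_mem ?_ ?_
  · intro htop
    obtain ⟨j, hj⟩ := hX
    exact hj (htop ▸ Submodule.mem_top)
  · rintro x y ⟨D1, hx⟩ ⟨D2, hy⟩ hxy
    have h1 := goodSet_of_mem_goodIdeal hF h0 {x * y} (by
      intro z hz
      rw [Finset.mem_singleton] at hz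
      rwa [hz])
    rw [Finset.coe_singleton] at h1
    rcases goodSet_mul x y h1 with h | h
    · exact Or.inl (Ideal.subset_span ⟨⟨D1, hx⟩, h⟩)
    · exact Or.inr (Ideal.subset_span ⟨⟨D2, hy⟩, h⟩)


lemma galois_linearIndependent {k K Q ι : Type} [Field k] [Field K] [Field Q] [Algebra k K]
    [IsGalois k K] [Algebra k Q] [Algebra K Q] [IsScalarTower k K Q] (v : ι → Q)
    (hv : LinearIndependent k v)
    (τ : (K ≃ₐ[k] K) → Q →+* Q) (h1 : ∀ σ x, τ σ (algebraMap K Q x) = algebraMap K Q (σ x))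
    (h2 : ∀ σ i, τ σ (v i) = v i) : LinearIndependent K v := by
  classical
  rw [linearIndependent_iff']
  intro s
  induction s using Finset.induction_on with
  | empty => intro g _ i hi; exact absurd hi (Finset.notMem_empty _)
  | insert i0 s hi0 ih =>
    intro g hg
    have h0 : g i0 = 0 := by
      by_contra hne
      let c : ι → K := fun i => (g i0)⁻¹ * g i
      have hc0 : c i0 = 1 := inv_mul_cancel₀ hne
      have hc : v i0 + ∑ i ∈ s, algebraMap K Q (c i) * v i = 0 := by
        have : ∑ i ∈ insert i0 s, c i • v i = 0 := by
          simp only [c, mul_smul, ← Finset.smul_sum]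
          rw [hg, smul_zero]
        rw [Finset.sum_insert hi0, hc0, one_smul] at this
        simpa [Algebra.smul_def] using this
      have hfix : ∀ i ∈ s, ∀ σ : K ≃ₐ[k] K, σ (c i) = c i := by
        intro i hi σ
        have h3 := congrArg (τ σ) hc
        simp only [map_add, map_sum, map_mul, h1, h2, map_zero] at h3
        have h4 : ∑ i ∈ s, (σ (c i) - c i) • v i = 0 := by
          simp only [Algebra.smul_def, map_sub, sub_mul, Finset.sum_sub_distrib]
          linear_combination h3 - hc
        exact sub_eq_zero.1 (ih _ h4 i hi)
      have hex : ∀ i ∈ s, ∃ r : k, algebraMap k K r = c i := fun i hi =>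
        (InfiniteGalois.mem_range_algebraMap_iff_fixed (c i)).2 (hfix i hi)
      choose! r hr using hex
      let r' : ι → k := fun i => if i = i0 then 1 else r i
      have h5 : ∑ i ∈ insert i0 s, r' i • v i = 0 := by
        rw [Finset.sum_insert hi0, ← hc]
        congr 1
        · simp [r']
        · refine Finset.sum_congr rfl fun i hi => ?_
          have : i ≠ i0 := fun h => hi0 (h ▸ hi)
          simp only [r', this, if_false]
          rw [← hr i hi, ← IsScalarTower.algebraMap_apply, Algebra.smul_def]
      have h6 := linearIndependent_iff'.1 hv _ _ h5 i0 (Finset.mem_insert_self _ _)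
      simp [r'] at h6
    intro i hi
    rw [Finset.sum_insert hi0, h0, zero_smul, zero_add] at hg
    rcases Finset.mem_insert.1 hi with rfl | hi
    · exact h0
    · exact ih g hg i hi

lemma galois_isDomain {k K Q : Type} [Field k] [Field K] [Field Q] [Algebra k K]
    [IsGalois k K] [Algebra k Q] [Algebra K Q] [IsScalarTower k K Q] (A : Subalgebra k Q)
    (τ : (K ≃ₐ[k] K) → Q →+* Q) (h1 : ∀ σ x, τ σ (algebraMap K Q x) = algebraMap K Q (σ x))
    (h2 : ∀ σ, ∀ a ∈ A, τ σ a = a) : IsDomain (TensorProduct k K A) := by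
  let b := Module.Free.chooseBasis k A
  let φ : TensorProduct k K A →ₐ[K] Q :=
    Algebra.TensorProduct.lift (Algebra.ofId K Q) A.val (fun _ _ => Commute.all _ _)
  let B := Algebra.TensorProduct.basis K b
  have hv : LinearIndependent k (fun i => (b i : Q)) :=
    b.linearIndependent.map' A.val.toLinearMap (LinearMap.ker_eq_bot.2 Subtype.val_injective)
  have hv2 := galois_linearIndependent _ hv τ h1 (fun σ i => h2 σ _ (b i).2)
  have hinj : Function.Injective φ := by
    rw [injective_iff_map_eq_zero]
    intro x hx
    have h3 := B.linearCombination_repr x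
    have h4 : Finsupp.linearCombination K (fun i => (b i : Q)) (B.repr x) = 0 := by
      have h5 : φ.toLinearMap (Finsupp.linearCombination K B (B.repr x)) = 0 := by
        rw [h3]
        exact hx
      rw [Finsupp.apply_linearCombination] at h5
      have h6 : (φ.toLinearMap ∘ B) = fun i => (b i : Q) := by
        funext i
        simp [B, φ]
      rw [h6] at h5
      exact h5
    rw [← h3, linearIndependent_iff.1 hv2 _ h4, map_zero]
  exact hinj.isDomain φ.toRingHom

theorem galois_point {k K : Type} [Field k] [Field K] [Algebra k K] [IsGalois k K]
    (hPAC : ∀ (A : Type) [CommRing A] [Algebra k A], Algebra.FiniteType k A →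
      IsDomain (TensorProduct k K A) → Nonempty (A →ₐ[k] k))
    {m : ℕ} (f : MvPolynomial (Fin m) k) (I : Ideal (MvPolynomial (Fin m) K)) [I.IsPrime]
    (hfI : MvPolynomial.map (algebraMap k K) f ∈ I) (j : Fin m) (hj : MvPolynomial.X j ∉ I)
    (hσ : ∀ σ : K ≃ₐ[k] K, ∀ h ∈ I, MvPolynomial.map ((σ : K ≃+* K) : K →+* K) h ∈ I) :
    ∃ a : Fin m → k, a ≠ 0 ∧ MvPolynomial.eval a f = 0 := by
  classical
  let R := MvPolynomial (Fin m) K ⧸ I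
  let Q := FractionRing R
  let π : MvPolynomial (Fin m) K →ₐ[K] R := Ideal.Quotient.mkₐ K I
  let ι : R →ₐ[K] Q := IsScalarTower.toAlgHom K R Q
  have hι : Function.Injective ι := IsFractionRing.injective R Q
  let x : Fin m → Q := fun i => ι (π (MvPolynomial.X i))
  let s : Finset Q := insert (x j)⁻¹ (Finset.univ.image x)
  let A : Subalgebra k Q := Algebra.adjoin k (s : Set Q)
  have hxj : x j ≠ 0 := by
    intro h
    have h1 : π (MvPolynomial.X j) = 0 := hι (by rw [map_zero]; exact h)
    exact hj (Ideal.Quotient.eq_zero_iff_mem.1 h1)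
  have hτ : ∀ σ : K ≃ₐ[k] K, ∃ τ : Q →+* Q,
      (∀ y, τ (algebraMap K Q y) = algebraMap K Q (σ y)) ∧ ∀ i, τ (x i) = x i := by
    intro σ
    have hle : I ≤ I.comap (MvPolynomial.map ((σ : K ≃+* K) : K →+* K)) := hσ σ
    let t : R →+* R := Ideal.quotientMap I (MvPolynomial.map ((σ : K ≃+* K) : K →+* K)) hle
    have ht : Function.Injective t := by
      refine Ideal.quotientMap_injective' ?_
      intro h hh
      have h1 := hσ σ.symm _ (Ideal.mem_comap.1 hh)
      rw [MvPolynomial.map_map] at h1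
      convert h1
      rw [show (((σ.symm : K ≃+* K) : K →+* K).comp ((σ : K ≃+* K) : K →+* K)) = RingHom.id K from
        RingHom.ext fun y => σ.symm_apply_apply y, MvPolynomial.map_id]
    have htm : ∀ h, t (π h) = π (MvPolynomial.map ((σ : K ≃+* K) : K →+* K) h) := fun h =>
      Ideal.quotientMap_mk
    have hτi : ∀ y : R, IsFractionRing.map (K := Q) (L := Q) ht (ι y) = ι (t y) := fun y =>
      IsLocalization.map_eq _ y
    refine ⟨IsFractionRing.map (K := Q) (L := Q) ht, fun y => ?_, fun i => ?_⟩
    · have h1 : ∀ y : K, algebraMap K Q y = ι (π (MvPolynomial.C y)) := fun y => by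
        rw [← MvPolynomial.algebraMap_eq, AlgHom.commutes, AlgHom.commutes]
      rw [h1, hτi, htm, MvPolynomial.map_C, h1]
      rfl
    · change IsFractionRing.map (K := Q) (L := Q) ht (ι (π _)) = ι (π _)
      rw [hτi, htm, MvPolynomial.map_X]
  choose τ hτ1 hτ2 using hτ
  have hfix : ∀ σ, ∀ a ∈ A, τ σ a = a := by
    intro σ a ha
    induction ha using Algebra.adjoin_induction with
    | mem y hy =>
      rcases Finset.mem_insert.1 (Finset.mem_coe.1 hy) with rfl | hy
      · rw [map_inv₀, hτ2]
      · obtain ⟨i, -, rfl⟩ := Finset.mem_image.1 hy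
        exact hτ2 σ i
    | algebraMap r =>
      rw [IsScalarTower.algebraMap_apply k K Q, hτ1, AlgEquiv.commutes]
    | add y z _ _ hy hz => rw [map_add, hy, hz]
    | mul y z _ _ hy hz => rw [map_mul, hy, hz]
  have hdom := galois_isDomain A τ hτ1 hfix
  have hft : Algebra.FiniteType k A :=
    A.fg_iff_finiteType.1 (Subalgebra.fg_adjoin_finset s)
  obtain ⟨φ⟩ := hPAC A hft hdom
  have hxA : ∀ i, x i ∈ A := fun i => Algebra.subset_adjoin
    (Finset.mem_coe.2 (Finset.mem_insert_of_mem (Finset.mem_image_of_mem _ (Finset.mem_univ i))))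
  have hxiA : (x j)⁻¹ ∈ A := Algebra.subset_adjoin (Finset.mem_coe.2 (Finset.mem_insert_self _ _))
  let xA : Fin m → A := fun i => ⟨x i, hxA i⟩
  refine ⟨fun i => φ (xA i), ?_, ?_⟩
  · intro h
    have h1 : φ (xA j) = 0 := congrFun h j
    have h2 : xA j * ⟨(x j)⁻¹, hxiA⟩ = 1 := Subtype.ext (mul_inv_cancel₀ hxj)
    have h3 := congrArg φ h2
    rw [map_mul, h1, zero_mul, map_one] at h3
    exact zero_ne_one h3
  · have h1 : MvPolynomial.aeval x f = 0 := by
      have h2 : ι (π (MvPolynomial.map (algebraMap k K) f)) = 0 := by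
        rw [show π (MvPolynomial.map (algebraMap k K) f) = 0 from
          Ideal.Quotient.eq_zero_iff_mem.2 hfI, map_zero]
      rw [← h2, ← AlgHom.comp_apply, MvPolynomial.aeval_unique (ι.comp π)]
      rw [MvPolynomial.aeval_map_algebraMap]
      rfl
    have h2 : MvPolynomial.aeval xA f = 0 := by
      apply Subtype.val_injective
      have := MvPolynomial.aeval_algebraMap_apply Q xA f
      exact this.symm.trans h1
    have h3 := congrArg φ h2
    rw [map_zero, ← AlgHom.comp_apply, MvPolynomial.comp_aeval] at h3
    rw [← MvPolynomial.coe_aeval_eq_eval]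
    exact h3

/-- **A conjecture of Ax (Kollár's theorem).** Every PAC field of characteristic 0 is `C₁`:
if `k` is a field of characteristic zero such that every geometrically integral `k`-variety
has a `k`-point (formulated algebraically: every finitely generated `k`-algebra `A` with
`AlgebraicClosure k ⊗[k] A` an integral domain admits a `k`-algebra homomorphism `A → k`),
then every homogeneous polynomial `f ∈ k[x₀, …, xₙ]` of degree `d` with `1 ≤ d ≤ n`
has a nontrivial zero in `k^{n+1}`. -/
theorem pac_field_char_zero_is_C1
    (k : Type) [Field k] [CharZero k]
    (hPAC : ∀ (A : Type) [CommRing A] [Algebra k A], Algebra.FiniteType k A →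
      IsDomain (TensorProduct k (AlgebraicClosure k) A) → Nonempty (A →ₐ[k] k))
    (n d : ℕ) (f : MvPolynomial (Fin (n + 1)) k)
    (hf : f.IsHomogeneous d) (hd1 : 1 ≤ d) (hdn : d ≤ n) :
    ∃ a : Fin (n + 1) → k, a ≠ 0 ∧ MvPolynomial.eval a f = 0 := by

  by_cases hf0 : f = 0
  · exact ⟨fun _ => 1, fun h => one_ne_zero (congrFun h 0), by rw [hf0, map_zero]⟩
  have hinj : Function.Injective
      (MvPolynomial.map (σ := Fin (n + 1)) (algebraMap k (AlgebraicClosure k))) :=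
    MvPolynomial.map_injective _ (algebraMap k (AlgebraicClosure k)).injective
  obtain ⟨I, hI, hFI, ⟨j, hj⟩, hσ⟩ := exists_prime
    (MvPolynomial.map (algebraMap k (AlgebraicClosure k)) f) (hf.map _)
    (fun h => hf0 (hinj (by rw [h, map_zero]))) hd1 hdn
  have hgal : IsGalois k (AlgebraicClosure k) := inferInstance
  refine galois_point (K := AlgebraicClosure k) hPAC f I hFI j hj fun σ h hh => ?_
  refine hσ (σ : AlgebraicClosure k ≃+* AlgebraicClosure k) ?_ h hh
  rw [MvPolynomial.map_map]
  congr 1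
  congr 1
  exact RingHom.ext fun y => σ.commutes y
end

section
/- Let k be a PAC field of characteristic 0 and let f_1, …, f_s ∈ k[x_0, …, x_n] be homogeneous polynomials of degrees d_1, …, d_s ≥ 1 with d_1 + ⋯ + d_s ≤ n. Then the system f_1 = ⋯ = f_s = 0 has a common nontrivial zero: there exists (a_0, …, a_n) ∈ k^{n+1}, (a_0, …, a_n) ≠ (0, …, 0), such that f_i(a_0, …, a_n) = 0 for every i = 1, …, s. (In other words, every PAC field of characteristic 0 has property C'_1.) -/
namespace PACC1
open MvPolynomial

set_option linter.unusedSectionVars false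

section General
variable {K : Type} [Field K] {σ : Type} [Fintype σ]

/-- dimension of `S/I` at least `D` -/
def Ind (I : Ideal (MvPolynomial σ K)) (D : ℕ) : Prop :=
  ∃ y : Fin D → MvPolynomial σ K, ∀ p : MvPolynomial (Fin D) K, aeval y p ∈ I → p = 0

/-- quotient map as a linear map -/
noncomputable def qm (I : Ideal (MvPolynomial σ K)) :
    MvPolynomial σ K →ₗ[K] (MvPolynomial σ K ⧸ I) := (Ideal.Quotient.mkₐ K I).toLinearMap

/-- affine Hilbert function -/
noncomputable def HF (I : Ideal (MvPolynomial σ K)) (e : ℕ) : ℕ :=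
  Module.finrank K ((restrictTotalDegree σ K e).map (qm I))

lemma qm_eq_zero {I : Ideal (MvPolynomial σ K)} {p : MvPolynomial σ K} : qm I p = 0 ↔ p ∈ I := by
  simp [qm, Ideal.Quotient.eq_zero_iff_mem]

lemma Vmono {e e' : ℕ} (h : e ≤ e') : restrictTotalDegree σ K e ≤ restrictTotalDegree σ K e' := by
  intro p hp
  rw [mem_restrictTotalDegree] at *
  omega

/-- comparison of Hilbert functions along an algebra map -/
lemma HF_le_of_hom {τ : Type} [Fintype τ] (I : Ideal (MvPolynomial σ K))
    (I' : Ideal (MvPolynomial τ K))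
    (φ : MvPolynomial σ K →ₐ[K] MvPolynomial τ K) (e e' : ℕ)
    (hI : ∀ p ∈ I, φ p ∈ I')
    (hV : ∀ p ∈ restrictTotalDegree τ K e', ∃ q ∈ restrictTotalDegree σ K e, p - φ q ∈ I') :
    HF I' e' ≤ HF I e := by
  have h1 : I ≤ I'.comap φ := fun p hp => hI p hp
  let ψ : (MvPolynomial σ K ⧸ I) →ₐ[K] (MvPolynomial τ K ⧸ I') := Ideal.quotientMapₐ I' φ h1
  have h2 : (restrictTotalDegree τ K e').map (qm I') ≤
      ((restrictTotalDegree σ K e).map (qm I)).map ψ.toLinearMap := by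
    rintro _ ⟨p, hp, rfl⟩
    obtain ⟨q, hq, hpq⟩ := hV p hp
    refine ⟨qm I q, ⟨q, hq, rfl⟩, ?_⟩
    have : qm I' p = qm I' (φ q) := by
      rw [← sub_eq_zero, ← map_sub, qm_eq_zero]; exact hpq
    rw [this]
    simp [ψ, qm]
  exact (Submodule.finrank_mono h2).trans (Submodule.finrank_map_le _ _)

lemma HF_anti {I I' : Ideal (MvPolynomial σ K)} (h : I ≤ I') (e : ℕ) : HF I' e ≤ HF I e :=
  HF_le_of_hom I I' (AlgHom.id K _) e e (fun p hp => h hp) (fun p hp => ⟨p, hp, by simp⟩)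

lemma HF_mono (I : Ideal (MvPolynomial σ K)) {e e' : ℕ} (h : e ≤ e') : HF I e ≤ HF I e' :=
  HF_le_of_hom I I (AlgHom.id K _) e' e (fun p hp => hp) (fun p hp => ⟨p, Vmono h hp, by simp⟩)

/-- rank-nullity -/
lemma HF_add (I : Ideal (MvPolynomial σ K)) (e : ℕ) :
    HF I e + Module.finrank K
      ↥((restrictTotalDegree σ K e) ⊓ (I.restrictScalars K)) =
      Module.finrank K (restrictTotalDegree σ K e) := by
  have h := LinearMap.finrank_range_add_finrank_ker
    ((qm I).domRestrict (restrictTotalDegree σ K e))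
  rw [← h]
  congr 1
  · rw [LinearMap.range_domRestrict]; rfl
  · refine LinearEquiv.finrank_eq ?_
    refine (LinearEquiv.ofEq _ _ ?_).trans (Submodule.comapSubtypeEquivOfLe (inf_le_left)) |>.symm
    ext x
    simp [LinearMap.mem_ker, qm_eq_zero]

lemma Ind.anti {I I' : Ideal (MvPolynomial σ K)} (h : I ≤ I') {D : ℕ} (hI : Ind I' D) :
    Ind I D := by
  obtain ⟨y, hy⟩ := hI
  exact ⟨y, fun p hp => hy p (h hp)⟩

lemma Ind.of_fintype {I : Ideal (MvPolynomial σ K)} {ι : Type} [Fintype ι] {D : ℕ}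
    (hD : D ≤ Fintype.card ι) (y : ι → MvPolynomial σ K)
    (hy : ∀ p : MvPolynomial ι K, aeval y p ∈ I → p = 0) : Ind I D := by
  let g : Fin D → ι := fun i => (Fintype.equivFin ι).symm (Fin.castLE hD i)
  have hg : Function.Injective g := by
    intro a b h
    simpa [g] using h
  refine ⟨y ∘ g, fun p hp => ?_⟩
  have := hy (rename g p) (by rwa [aeval_rename])
  exact rename_injective g hg (by simpa using this)

lemma Ind.le {I : Ideal (MvPolynomial σ K)} {D D' : ℕ} (h : Ind I D) (hD : D' ≤ D) : Ind I D' := by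
  obtain ⟨y, hy⟩ := h
  exact Ind.of_fintype (by simpa using hD) y hy

/-- union of two closed sets -/
lemma Ind.union {J I1 I2 : Ideal (MvPolynomial σ K)} {D : ℕ} (h : Ind J D)
    (hJ : ∀ p : Ideal (MvPolynomial σ K), p.IsPrime → J ≤ p → I1 ≤ p ∨ I2 ≤ p) :
    Ind I1 D ∨ Ind I2 D := by
  by_contra hcon
  push Not at hcon
  obtain ⟨y, hy⟩ := h
  have h1 : ∃ p : MvPolynomial (Fin D) K, aeval y p ∈ I1 ∧ p ≠ 0 := by
    by_contra h
    push Not at h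
    exact hcon.1 ⟨y, h⟩
  have h2 : ∃ p : MvPolynomial (Fin D) K, aeval y p ∈ I2 ∧ p ≠ 0 := by
    by_contra h
    push Not at h
    exact hcon.2 ⟨y, h⟩
  obtain ⟨p1, hp1, hn1⟩ := h1
  obtain ⟨p2, hp2, hn2⟩ := h2
  have : aeval y (p1 * p2) ∈ J.radical := by
    rw [Ideal.radical_eq_sInf, Ideal.mem_sInf]
    rintro p ⟨hle, hp⟩
    rw [map_mul]
    rcases hJ p hp hle with h | h
    · exact Ideal.mul_mem_right _ _ (h hp1)
    · exact Ideal.mul_mem_left _ _ (h hp2)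
  obtain ⟨m, hm⟩ := this
  rw [← map_pow] at hm
  have := hy _ hm
  exact pow_ne_zero m (mul_ne_zero hn1 hn2) this

end General
end PACC1

namespace PACC1
open MvPolynomial
set_option linter.unusedSectionVars false

section General
variable {K : Type} [Field K] {σ : Type} [Fintype σ]

lemma totalDegree_aeval_le {ι : Type} (y : ι → MvPolynomial σ K) (c : ℕ)
    (hy : ∀ i, (y i).totalDegree ≤ c) (p : MvPolynomial ι K) (t : ℕ) (hp : p.totalDegree ≤ t) :
    (aeval y p).totalDegree ≤ c * t := by
  rw [aeval_def, eval₂_eq]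
  refine (totalDegree_finsetSum _ _).trans (Finset.sup_le fun d hd => ?_)
  refine (totalDegree_mul _ _).trans ?_
  have h1 : ((algebraMap K (MvPolynomial σ K)) (coeff d p)).totalDegree = 0 := by
    rw [algebraMap_eq]; exact totalDegree_C _
  rw [h1, zero_add]
  refine (totalDegree_finsetProd _ _).trans ?_
  calc ∑ i ∈ d.support, ((y i) ^ d i).totalDegree ≤ ∑ i ∈ d.support, c * d i := by
        refine Finset.sum_le_sum fun i _ => ?_
        refine (totalDegree_pow _ _).trans ?_
        rw [mul_comm]
        exact Nat.mul_le_mul_right _ (hy i)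
    _ = c * ∑ i ∈ d.support, d i := by rw [Finset.mul_sum]
    _ ≤ c * t := by
        refine Nat.mul_le_mul_left _ ((le_totalDegree hd).trans hp)

/-- lower bound of the Hilbert function -/
lemma Ind.growth {I : Ideal (MvPolynomial σ K)} {D : ℕ} (h : Ind I D) :
    ∃ C : ℕ, ∀ e : ℕ, e ^ D ≤ C * HF I e := by
  obtain ⟨y, hy⟩ := h
  let c := Finset.univ.sup fun i => (y i).totalDegree
  have hc : ∀ i, (y i).totalDegree ≤ c := fun i =>
    Finset.le_sup (f := fun i => (y i).totalDegree) (Finset.mem_univ i)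
  let b := c * D + 1
  refine ⟨b ^ D, fun e => ?_⟩
  let m := e / b
  have hb : 0 < b := Nat.succ_pos _
  have he : e ≤ b * (m + 1) := (Nat.lt_mul_div_succ e hb).le
  have hme : b * m ≤ e := Nat.mul_div_le e b
  -- the monomials
  let v : (Fin D → Fin (m + 1)) → MvPolynomial (Fin D) K := fun α =>
    monomial (Finsupp.equivFunOnFinite.symm fun i => (α i : ℕ)) 1
  have hvli : LinearIndependent K v := by
    have := (basisMonomials (Fin D) K).linearIndependent
    have h2 := this.comp (fun α : Fin D → Fin (m + 1) =>
      (Finsupp.equivFunOnFinite.symm fun i => (α i : ℕ))) (by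
        intro α β h
        have h' := Finsupp.equivFunOnFinite.symm.injective h
        funext i
        exact Fin.ext (congrFun h' i))
    simpa [v, Function.comp_def] using h2
  have hvdeg : ∀ α, (v α).totalDegree ≤ D * m := by
    intro α
    refine (totalDegree_monomial_le _ _).trans ?_
    rw [Finsupp.sum_fintype _ _ (by simp)]
    calc _ ≤ ∑ i : Fin D, m := Finset.sum_le_sum fun i _ => by
            simpa using Nat.lt_succ_iff.mp (α i).2
      _ = D * m := by simp
  let w : (Fin D → Fin (m + 1)) → (restrictTotalDegree σ K e).map (qm I) := fun α =>
    ⟨qm I (aeval y (v α)), ⟨_, by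
      rw [SetLike.mem_coe, mem_restrictTotalDegree]
      refine (totalDegree_aeval_le y c hc _ _ (hvdeg α)).trans (le_trans ?_ hme)
      rw [← mul_assoc]
      exact Nat.mul_le_mul_right _ (Nat.le_succ _), rfl⟩⟩
  have hwli : LinearIndependent K w := by
    apply LinearIndependent.of_comp (Submodule.subtype _)
    have : (Submodule.subtype _) ∘ w = ((qm I).comp (aeval y).toLinearMap) ∘ v := rfl
    rw [this]
    refine hvli.map' _ ?_
    rw [LinearMap.ker_eq_bot']
    intro p hp
    exact hy p (qm_eq_zero.1 hp)
  have hcard := hwli.fintype_card_le_finrank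
  rw [Fintype.card_fun, Fintype.card_fin, Fintype.card_fin] at hcard
  calc e ^ D ≤ (b * (m + 1)) ^ D := Nat.pow_le_pow_left he _
    _ = b ^ D * (m + 1) ^ D := mul_pow _ _ _
    _ ≤ _ := Nat.mul_le_mul_left _ hcard

lemma finrank_V_le (D t : ℕ) :
    Module.finrank K (restrictTotalDegree (Fin D) K t) ≤ (t + 1) ^ D := by
  have h1 : restrictTotalDegree (Fin D) K t ≤ Submodule.span K
      (Set.range fun α : Fin D → Fin (t + 1) =>
        (monomial (Finsupp.equivFunOnFinite.symm fun i => (α i : ℕ)) (1 : K))) := by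
    intro p hp
    rw [mem_restrictTotalDegree] at hp
    rw [p.as_sum]
    refine Submodule.sum_mem _ fun d hd => ?_
    have : monomial d (coeff d p) = coeff d p • (monomial d (1 : K)) := by
      rw [smul_monomial]; simp
    rw [this]
    refine Submodule.smul_mem _ _ (Submodule.subset_span ⟨fun i => ⟨d i, ?_⟩, ?_⟩)
    · have := (le_totalDegree hd).trans hp
      have h2 : d i ≤ d.sum fun _ e => e := by
        by_cases hi : i ∈ d.support
        · exact Finset.single_le_sum (f := fun i => d i) (fun _ _ => Nat.zero_le _) hi
        · simp only [Finsupp.mem_support_iff, not_not] at hi; omega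
      omega
    · ext i; simp
  have : FiniteDimensional K (Submodule.span K
      (Set.range fun α : Fin D → Fin (t + 1) =>
        (monomial (Finsupp.equivFunOnFinite.symm fun i => (α i : ℕ)) (1 : K)))) :=
    FiniteDimensional.span_of_finite K (Set.finite_range _)
  refine (Submodule.finrank_mono h1).trans ((finrank_range_le_card _).trans ?_)
  simp

lemma exists_rep {P R : Type} [CommRing P] [CommRing R] (g : P →+* R) (hg : g.Finite) :
    ∃ (k : ℕ) (r : Fin k → R), ∀ z : R, ∃ q : Fin k → P, z = ∑ l, g (q l) * r l := by
  let _ := g.toAlgebra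
  have : Module.Finite P R := hg
  obtain ⟨k, r, hr⟩ := Module.Finite.exists_fin (R := P) (M := R)
  refine ⟨k, r, fun z => ?_⟩
  have hz : z ∈ Submodule.span P (Set.range r) := by rw [hr]; trivial
  obtain ⟨q, hq⟩ := (Submodule.mem_span_range_iff_exists_fun _).1 hz
  exact ⟨q, hq.symm⟩

/-- upper bound of the Hilbert function by Noether normalization -/
lemma exists_Ind_upper (I : Ideal (MvPolynomial σ K)) (hI : I ≠ ⊤) :
    ∃ D, Ind I D ∧ ∃ C : ℕ, ∀ e, HF I e ≤ C * (e + 1) ^ D := by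
  have : Nontrivial (MvPolynomial σ K ⧸ I) := Ideal.Quotient.nontrivial_iff.2 hI
  obtain ⟨D, g, hinj, hfin⟩ := exists_finite_inj_algHom_of_fg K (MvPolynomial σ K ⧸ I)
  refine ⟨D, ?_, ?_⟩
  · choose y hy using fun i => Ideal.Quotient.mk_surjective (I := I) (g (X i))
    refine ⟨y, fun p hp => hinj ?_⟩
    rw [map_zero]
    have h1 : g = (Ideal.Quotient.mkₐ K I).comp (aeval y) := by
      ext i; simp [hy]
    rw [h1]
    exact Ideal.Quotient.eq_zero_iff_mem.2 hp
  · obtain ⟨k, r, hrep⟩ := exists_rep g.toRingHom hfin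
    replace hrep : ∀ z : MvPolynomial σ K ⧸ I, ∃ q : Fin k → MvPolynomial (Fin D) K,
        z = ∑ l, g (q l) * r l := hrep
    choose q hq using hrep
    -- degree bound
    let c0 := Finset.univ.sup fun l => (q 1 l).totalDegree
    let c1 := Finset.univ.sup fun a : σ × Fin k × Fin k =>
      (q (Ideal.Quotient.mk I (X a.1) * r a.2.1) a.2.2).totalDegree
    let c := c0 + c1
    have hc0 : ∀ l, (q 1 l).totalDegree ≤ c := fun l =>
      (Finset.le_sup (f := fun l => (q 1 l).totalDegree) (Finset.mem_univ l)).trans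
        (Nat.le_add_right _ _)
    have hc1 : ∀ i j l, (q (Ideal.Quotient.mk I (X i) * r j) l).totalDegree ≤ c := fun i j l =>
      (Finset.le_sup (f := fun a : σ × Fin k × Fin k =>
        (q (Ideal.Quotient.mk I (X a.1) * r a.2.1) a.2.2).totalDegree)
        (Finset.mem_univ (i, j, l))).trans (Nat.le_add_left _ _)
    let Φ : (Fin k → MvPolynomial (Fin D) K) →ₗ[K] (MvPolynomial σ K ⧸ I) :=
      ∑ l, (LinearMap.mulRight K (r l)).comp (g.toLinearMap.comp (LinearMap.proj l))
    have hΦ : ∀ p, Φ p = ∑ l, g (p l) * r l := by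
      intro p; simp [Φ, LinearMap.sum_apply]
    let W : ℕ → Submodule K (MvPolynomial σ K ⧸ I) := fun t =>
      (Submodule.pi Set.univ fun _ : Fin k => restrictTotalDegree (Fin D) K t).map Φ
    have hW : ∀ t, Module.finrank K (W t) ≤ k * (t + 1) ^ D := by
      intro t
      let Ψ : (Fin k → restrictTotalDegree (Fin D) K t) →ₗ[K] (MvPolynomial σ K ⧸ I) :=
        Φ.comp (LinearMap.pi fun l => (Submodule.subtype _).comp (LinearMap.proj l))
      have : W t ≤ LinearMap.range Ψ := by
        rintro _ ⟨p, hp, rfl⟩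
        refine ⟨fun l => ⟨p l, hp l (Set.mem_univ _)⟩, rfl⟩
      refine (Submodule.finrank_mono this).trans ((LinearMap.finrank_range_le _).trans ?_)
      rw [Module.finrank_pi_fintype]
      refine (Finset.sum_le_sum fun i _ => finrank_V_le D t).trans ?_
      simp
    have hWone : (1 : MvPolynomial σ K ⧸ I) ∈ W c := by
      refine ⟨q 1, fun l _ => ?_, ?_⟩
      · exact (mem_restrictTotalDegree _ _ _).2 (hc0 l)
      · rw [hΦ]; exact (hq 1).symm
    have hWmul : ∀ t i, ∀ z ∈ W t, Ideal.Quotient.mk I (X i) * z ∈ W (t + c) := by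
      rintro t i _ ⟨p, hp, rfl⟩
      rw [hΦ, Finset.mul_sum]
      refine Submodule.sum_mem _ fun j _ => ?_
      refine ⟨fun l => p j * q (Ideal.Quotient.mk I (X i) * r j) l, fun l _ => ?_, ?_⟩
      · refine (mem_restrictTotalDegree _ _ _).2 ?_
        refine (totalDegree_mul _ _).trans (Nat.add_le_add ?_ (hc1 i j l))
        exact (mem_restrictTotalDegree _ _ _).1 (hp j (Set.mem_univ _))
      · rw [hΦ]
        calc ∑ l, g (p j * q (Ideal.Quotient.mk I (X i) * r j) l) * r l
            = g (p j) * ∑ l, g (q (Ideal.Quotient.mk I (X i) * r j) l) * r l := by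
              rw [Finset.mul_sum]
              refine Finset.sum_congr rfl fun l _ => ?_
              rw [map_mul, mul_assoc]
          _ = _ := by rw [← hq]; ring
    have hWmono : ∀ {t t'}, t ≤ t' → W t ≤ W t' := by
      intro t t' h
      exact Submodule.map_mono (Submodule.pi_mono fun _ _ => Vmono h)
    have hmon : ∀ n : ℕ, ∀ d : σ →₀ ℕ, (d.sum fun _ e => e) = n →
        Ideal.Quotient.mk I (monomial d (1 : K)) ∈ W (c + n * c) := by
      intro n
      induction n with
      | zero =>
        intro d hd
        have : d = 0 := by
          ext i
          by_contra hi
          have := Finset.sum_eq_zero_iff.1 hd i (by simpa using hi)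
          exact hi this
        subst this
        simpa using hWone
      | succ n ih =>
        intro d hd
        have : ∃ i, d i ≠ 0 := by
          by_contra h
          push Not at h
          have : d = 0 := by ext i; simp [h]
          subst this
          simp at hd
        obtain ⟨i, hi⟩ := this
        have hdi : d = Finsupp.single i 1 + (d - Finsupp.single i 1) := by
          rw [add_tsub_cancel_of_le]
          rw [Finsupp.single_le_iff]; omega
        set d' := d - Finsupp.single i 1
        have hd' : (d'.sum fun _ e => e) = n := by
          rw [hdi, Finsupp.sum_add_index' (by simp) (by simp)] at hd
          simp at hd
          omega
        have := hWmul _ i _ (ih d' hd')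
        have h2 : monomial d (1 : K) = X i * monomial d' 1 := by
          rw [X, monomial_mul, ← hdi, one_mul]
        rw [h2, map_mul]
        convert this using 2
        ring
    refine ⟨k * (c + 1) ^ D, fun e => ?_⟩
    have hle : (restrictTotalDegree σ K e).map (qm I) ≤ W (c + e * c) := by
      rintro _ ⟨p, hp, rfl⟩
      rw [SetLike.mem_coe, mem_restrictTotalDegree] at hp
      rw [p.as_sum, map_sum]
      refine Submodule.sum_mem _ fun d hd => ?_
      have : monomial d (coeff d p) = coeff d p • (monomial d (1 : K)) := by
        rw [smul_monomial]; simp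
      rw [this, map_smul]
      refine Submodule.smul_mem _ _ ?_
      have h3 := (le_totalDegree hd).trans hp
      exact hWmono (Nat.add_le_add_left (Nat.mul_le_mul_right _ h3) _) (hmon _ d rfl)
    have : FiniteDimensional K (W (c + e * c)) := by
      have : FiniteDimensional K
        ((Submodule.pi Set.univ fun _ : Fin k => restrictTotalDegree (Fin D) K (c + e * c))) := by
          let Ψ : (Fin k → restrictTotalDegree (Fin D) K (c + e * c)) →ₗ[K]
              (Fin k → MvPolynomial (Fin D) K) :=
            (LinearMap.pi fun l => (Submodule.subtype _).comp (LinearMap.proj l))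
          refine Submodule.finiteDimensional_of_le (S₂ := LinearMap.range Ψ) ?_
          intro p hp
          exact ⟨fun l => ⟨p l, hp l (Set.mem_univ _)⟩, rfl⟩
      infer_instance
    refine (Submodule.finrank_mono hle).trans ((hW _).trans ?_)
    rw [mul_assoc, ← mul_pow]
    refine Nat.mul_le_mul_left _ (Nat.pow_le_pow_left ?_ _)
    nlinarith

/-- from growth back to independence -/
lemma Ind.of_growth (I : Ideal (MvPolynomial σ K)) (D p C : ℕ)
    (h : ∀ e, e ^ (D + p) ≤ C * (2 * e + 1) ^ p * HF I (2 * e)) : Ind I D := by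
  by_cases hI : I = ⊤
  · exfalso
    have := h 1
    have h0 : HF I (2 * 1) = 0 := by
      subst hI
      unfold HF
      have : (restrictTotalDegree σ K (2 * 1)).map (qm (⊤ : Ideal (MvPolynomial σ K))) = ⊥ := by
        rw [eq_bot_iff]
        rintro _ ⟨p, _, rfl⟩
        simp [qm_eq_zero]
      rw [this]
      simp
    rw [h0] at this
    simp at this
  · obtain ⟨D0, hD0, C', hC'⟩ := exists_Ind_upper I hI
    refine hD0.le ?_
    by_contra hlt
    push Not at hlt
    -- e^(D+p) ≤ C C' (2e+1)^(p+D0) ≤ C C' 3^.. e^(p + D0)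
    set B := C * C' * 3 ^ (p + D0)
    have key : ∀ e, 1 ≤ e → e ^ (D + p) ≤ B * e ^ (p + D0) := by
      intro e he
      calc e ^ (D + p) ≤ C * (2 * e + 1) ^ p * HF I (2 * e) := h e
        _ ≤ C * (2 * e + 1) ^ p * (C' * (2 * e + 1) ^ D0) := Nat.mul_le_mul_left _ (hC' _)
        _ = C * C' * (2 * e + 1) ^ (p + D0) := by ring
        _ ≤ C * C' * (3 * e) ^ (p + D0) :=
          Nat.mul_le_mul_left _ (Nat.pow_le_pow_left (by omega) _)
        _ = B * e ^ (p + D0) := by rw [mul_pow]; ring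
    have h1 := key (B + 1) (by omega)
    have h2 : (B + 1) ^ (p + D0 + 1) ≤ (B + 1) ^ (D + p) :=
      Nat.pow_le_pow_right (by omega) (by omega)
    have h3 : (B + 1) ^ (p + D0 + 1) = (B + 1) * (B + 1) ^ (p + D0) := by ring
    have h4 : 0 < (B + 1) ^ (p + D0) := by positivity
    nlinarith

end General
end PACC1

namespace PACC1
open MvPolynomial
set_option linter.unusedSectionVars false

section General
variable {K : Type} [Field K] {σ : Type} [Fintype σ]

/-- homogeneous ideals -/
def Hom (I : Ideal (MvPolynomial σ K)) : Prop :=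
  ∀ p ∈ I, ∀ n, homogeneousComponent n p ∈ I

lemma homogeneousComponent_mul_mem (g w : MvPolynomial σ K) (q : ℕ) (hg : g.IsHomogeneous q)
    (n : ℕ) : ∃ w', homogeneousComponent n (w * g) = w' * g ∧ w'.totalDegree ≤ n - q ∧
      (n < q → w' = 0) := by
  refine ⟨if q ≤ n then homogeneousComponent (n - q) w else 0, ?_, ?_, ?_⟩
  · conv_lhs => rw [← sum_homogeneousComponent w, Finset.sum_mul, map_sum]
    have h1 : ∀ i, homogeneousComponent n (homogeneousComponent i w * g) =
        if n = i + q then homogeneousComponent i w * g else 0 := fun i =>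
      homogeneousComponent_of_mem ((homogeneousComponent_isHomogeneous i w).mul hg)
    simp_rw [h1]
    split_ifs with h
    · by_cases h2 : n - q ≤ w.totalDegree
      · rw [Finset.sum_eq_single (n - q)]
        · rw [if_pos (by omega)]
        · intro b _ hb
          rw [if_neg (by omega)]
        · intro h3
          simp at h3
          omega
      · rw [homogeneousComponent_eq_zero _ _ (by omega), zero_mul]
        refine Finset.sum_eq_zero fun i hi => ?_
        simp at hi
        rw [if_neg (by omega)]
    · rw [zero_mul]
      refine Finset.sum_eq_zero fun i hi => ?_
      rw [if_neg (by omega)]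
  · split_ifs
    · exact (homogeneousComponent_isHomogeneous _ _).totalDegree_le
    · simp
  · intro h
    rw [if_neg (by omega)]

lemma Hom.span (s : Set (MvPolynomial σ K)) (hs : ∀ g ∈ s, ∃ q, g.IsHomogeneous q) :
    Hom (Ideal.span s) := by
  have key : ∀ p ∈ Ideal.span s, ∀ a n, homogeneousComponent n (a * p) ∈ Ideal.span s := by
    intro p hp
    induction hp using Submodule.span_induction with
    | mem g hg =>
      intro a n
      obtain ⟨q, hq⟩ := hs g hg
      obtain ⟨w', h1, _⟩ := homogeneousComponent_mul_mem g a q hq n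
      rw [h1]
      exact Ideal.mul_mem_left _ _ (Ideal.subset_span hg)
    | zero => simp
    | add x y _ _ hx hy => intro a n; rw [mul_add, map_add]; exact add_mem (hx a n) (hy a n)
    | smul b x hx hx' => intro a n; rw [smul_eq_mul, ← mul_assoc]; exact hx' _ _
  intro p hp n
  simpa using key p hp 1 n

lemma Hom.sup {I J : Ideal (MvPolynomial σ K)} (hI : Hom I) (hJ : Hom J) : Hom (I ⊔ J) := by
  intro p hp n
  obtain ⟨a, ha, b, hb, rfl⟩ := Submodule.mem_sup.1 hp
  rw [map_add]
  exact Submodule.add_mem_sup (hI a ha n) (hJ b hb n)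

/-- truncation -/
noncomputable def trunc (e : ℕ) : MvPolynomial σ K →ₗ[K] MvPolynomial σ K :=
  ∑ n ∈ Finset.range (e + 1), homogeneousComponent n

lemma trunc_apply (e : ℕ) (p : MvPolynomial σ K) :
    trunc e p = ∑ n ∈ Finset.range (e + 1), homogeneousComponent n p := by
  simp [trunc, LinearMap.sum_apply]

lemma trunc_eq_self {e : ℕ} {p : MvPolynomial σ K} (hp : p.totalDegree ≤ e) : trunc e p = p := by
  rw [trunc_apply]
  conv_rhs => rw [← sum_homogeneousComponent p]
  symm
  refine Finset.sum_subset (by intro i; simp; omega) fun i _ hi => ?_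
  refine homogeneousComponent_eq_zero _ _ ?_
  simp at hi; omega

lemma trunc_mem {I : Ideal (MvPolynomial σ K)} (hI : Hom I) (e : ℕ) {p : MvPolynomial σ K}
    (hp : p ∈ I) : trunc e p ∈ I := by
  rw [trunc_apply]
  exact Ideal.sum_mem _ fun n _ => hI p hp n

lemma trunc_mul (g w : MvPolynomial σ K) (q : ℕ) (hg : g.IsHomogeneous q)
    (e : ℕ) : ∃ w', trunc e (w * g) = w' * g ∧ w'.totalDegree ≤ e - q ∧
      (e < q → w' = 0) := by
  choose w' h1 h2 h3 using homogeneousComponent_mul_mem g w q hg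
  refine ⟨∑ n ∈ Finset.range (e + 1), w' n, ?_, ?_, ?_⟩
  · rw [trunc_apply, Finset.sum_mul]
    exact Finset.sum_congr rfl fun n _ => h1 n
  · refine (totalDegree_finsetSum _ _).trans (Finset.sup_le fun n hn => (h2 n).trans ?_)
    simp at hn; omega
  · intro h
    refine Finset.sum_eq_zero fun n hn => h3 n ?_
    simp at hn; omega

lemma cut_step {I : Ideal (MvPolynomial σ K)} (hI : Hom I) (g : MvPolynomial σ K) (q : ℕ)
    (hg : g.IsHomogeneous q) (e : ℕ) :
    HF I e ≤ (if e < q then 0 else HF I (e - q)) + HF (I ⊔ Ideal.span {g}) e := by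
  set I' := I ⊔ Ideal.span {g}
  have hII : I ≤ I' := le_sup_left
  let ψ : (MvPolynomial σ K ⧸ I) →ₐ[K] (MvPolynomial σ K ⧸ I') := Ideal.Quotient.factorₐ K hII
  have hψ : ∀ p, ψ (qm I p) = qm I' p := fun p => rfl
  set A := (restrictTotalDegree σ K e).map (qm I)
  have hr := LinearMap.finrank_range_add_finrank_ker (ψ.toLinearMap.domRestrict A)
  have h1 : Module.finrank K (LinearMap.range (ψ.toLinearMap.domRestrict A)) = HF I' e := by
    rw [LinearMap.range_domRestrict]
    have : A.map ψ.toLinearMap = (restrictTotalDegree σ K e).map (qm I') := by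
      rw [← Submodule.map_comp]
      rfl
    rw [this]; rfl
  have h2 : Module.finrank K (LinearMap.ker (ψ.toLinearMap.domRestrict A)) ≤
      (if e < q then 0 else HF I (e - q)) := by
    rw [← Submodule.finrank_map_subtype_eq]
    have hker : ∀ z ∈ (LinearMap.ker (ψ.toLinearMap.domRestrict A)).map A.subtype,
        ∃ w', z = qm I (w' * g) ∧ w'.totalDegree ≤ e - q ∧ (e < q → w' = 0) := by
      rintro _ ⟨⟨_, ⟨p, hp, rfl⟩⟩, hk, rfl⟩
      have hk' : p ∈ I' := by
        rw [← qm_eq_zero, ← hψ]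
        exact hk
      obtain ⟨a, ha, b, hb, hab⟩ := Submodule.mem_sup.1 hk'
      obtain ⟨w, rfl⟩ := Ideal.mem_span_singleton'.1 hb
      obtain ⟨w', hw1, hw2, hw3⟩ := trunc_mul g w q hg e
      refine ⟨w', ?_, hw2, hw3⟩
      have hp' : trunc e p = p := trunc_eq_self ((mem_restrictTotalDegree _ _ _).1 hp)
      change qm I p = _
      rw [← hp', ← hab, map_add, map_add, hw1, qm_eq_zero.2 (trunc_mem hI e ha), zero_add]
    split_ifs with h
    · have : (LinearMap.ker (ψ.toLinearMap.domRestrict A)).map A.subtype = ⊥ := by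
        rw [eq_bot_iff]
        intro z hz
        obtain ⟨w', h1, h2, h3⟩ := hker z hz
        rw [h1, h3 h]
        simp
      rw [this]; simp
    · have : (LinearMap.ker (ψ.toLinearMap.domRestrict A)).map A.subtype ≤
          ((restrictTotalDegree σ K (e - q)).map (qm I)).map
            (LinearMap.mulRight K (qm I g)) := by
        intro z hz
        obtain ⟨w', h1, h2, h3⟩ := hker z hz
        refine ⟨qm I w', ⟨w', (mem_restrictTotalDegree _ _ _).2 h2, rfl⟩, ?_⟩
        rw [h1]
        simp [qm]
      exact (Submodule.finrank_mono this).trans (Submodule.finrank_map_le _ _)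
  have : HF I e = Module.finrank K A := rfl
  omega

lemma cut {I : Ideal (MvPolynomial σ K)} (hI : Hom I) (g : MvPolynomial σ K) (q : ℕ)
    (hg : g.IsHomogeneous q) (hq : 1 ≤ q) (e : ℕ) :
    HF I e ≤ (e + 1) * HF (I ⊔ Ideal.span {g}) e := by
  induction e using Nat.strong_induction_on with
  | _ e ih =>
    have h := cut_step hI g q hg e
    split_ifs at h with h1
    · nlinarith [Nat.zero_le (e * HF (I ⊔ Ideal.span {g}) e)]
    · have h2 := ih (e - q) (by omega)
      have h3 := HF_mono (I ⊔ Ideal.span {g}) (Nat.sub_le e q)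
      have h4 : (e - q + 1) * HF (I ⊔ Ideal.span {g}) (e - q) ≤
        e * HF (I ⊔ Ideal.span {g}) e := Nat.mul_le_mul (by omega) h3
      linarith

lemma cut_many {ι : Type} (s : Finset ι) (g : ι → MvPolynomial σ K) (q : ι → ℕ)
    (hg : ∀ i, (g i).IsHomogeneous (q i)) (hq : ∀ i, 1 ≤ q i)
    {I : Ideal (MvPolynomial σ K)} (hI : Hom I) (e : ℕ) :
    HF I e ≤ (e + 1) ^ s.card * HF (I ⊔ Ideal.span (g '' s)) e := by
  classical
  induction s using Finset.induction_on with
  | empty => simp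
  | insert a s ha ih =>
    have hI' : Hom (I ⊔ Ideal.span (g '' s)) := hI.sup (Hom.span _ (by
      rintro _ ⟨i, _, rfl⟩; exact ⟨_, hg i⟩))
    have h2 := cut hI' (g a) (q a) (hg a) (hq a) e
    have h3 : I ⊔ Ideal.span (g '' s) ⊔ Ideal.span {g a} =
        I ⊔ Ideal.span (g '' (insert a s : Finset ι)) := by
      rw [sup_assoc, ← Ideal.span_union, Finset.coe_insert, Set.image_insert_eq,
        Set.union_singleton]
    rw [h3] at h2
    rw [Finset.card_insert_of_notMem ha]
    calc _ ≤ _ := ih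
      _ ≤ (e + 1) ^ s.card * ((e + 1) * HF (I ⊔ Ideal.span (g '' (insert a s : Finset ι))) e) :=
        Nat.mul_le_mul_left _ h2
      _ = _ := by ring

lemma Hom_bot : Hom (⊥ : Ideal (MvPolynomial σ K)) := by
  intro p hp n
  rw [Ideal.mem_bot] at hp
  simp [hp]

/-- an ideal with `m` homogeneous generators of positive degree has codimension at most `m` -/
lemma Ind_of_card {ι : Type} [Fintype ι] (g : ι → MvPolynomial σ K) (q : ι → ℕ)
    (hg : ∀ i, (g i).IsHomogeneous (q i)) (hq : ∀ i, 1 ≤ q i) (D : ℕ)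
    (hD : D + Fintype.card ι = Fintype.card σ) : Ind (Ideal.span (Set.range g)) D := by
  have h0 : Ind (⊥ : Ideal (MvPolynomial σ K)) (Fintype.card σ) :=
    Ind.of_fintype le_rfl X (fun p hp => by simpa using hp)
  obtain ⟨C, hC⟩ := h0.growth
  refine Ind.of_growth _ D (Fintype.card ι) C fun e => ?_
  rw [hD, mul_assoc]
  refine (hC e).trans (Nat.mul_le_mul_left _ ?_)
  have := cut_many Finset.univ g q hg hq Hom_bot (2 * e)
  rw [bot_sup_eq, Finset.coe_univ, Set.image_univ] at this
  exact (HF_mono _ (by omega)).trans this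

end General
end PACC1

namespace PACC1
open MvPolynomial
open scoped TensorProduct
set_option linter.unusedSectionVars false

section General
variable {K : Type} [Field K] {σ : Type} [Fintype σ]

lemma Hom.map_rename {τ : Type} [Fintype τ] {I : Ideal (MvPolynomial σ K)} (hI : Hom I)
    (f : σ → τ) : Hom (I.map (rename f : MvPolynomial σ K →ₐ[K] MvPolynomial τ K)) := by
  have : I.map (rename f : MvPolynomial σ K →ₐ[K] MvPolynomial τ K) =
      Ideal.span {g | ∃ p ∈ I, (∃ q, p.IsHomogeneous q) ∧ rename f p = g} := by
    apply le_antisymm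
    · rw [Ideal.map_le_iff_le_comap]
      intro p hp
      rw [Ideal.mem_comap, ← sum_homogeneousComponent p, map_sum]
      refine Ideal.sum_mem _ fun n _ => Ideal.subset_span ?_
      exact ⟨_, hI p hp n, ⟨n, homogeneousComponent_isHomogeneous _ _⟩, rfl⟩
    · rw [Ideal.span_le]
      rintro _ ⟨p, hp, _, rfl⟩
      exact Ideal.mem_map_of_mem _ hp
  rw [this]
  refine Hom.span _ ?_
  rintro _ ⟨p, hp, ⟨q, hq⟩, rfl⟩
  exact ⟨q, hq.rename_isHomogeneous⟩

/-- product -/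
lemma HF_product (I1 I2 : Ideal (MvPolynomial σ K)) (e : ℕ) :
    HF I1 e * HF I2 e ≤ HF (I1.map (rename Sum.inl : MvPolynomial σ K →ₐ[K] MvPolynomial (σ ⊕ σ) K)
      ⊔ I2.map (rename Sum.inr : MvPolynomial σ K →ₐ[K] MvPolynomial (σ ⊕ σ) K)) (2 * e) := by
  set J := I1.map (rename Sum.inl : MvPolynomial σ K →ₐ[K] MvPolynomial (σ ⊕ σ) K)
      ⊔ I2.map (rename Sum.inr : MvPolynomial σ K →ₐ[K] MvPolynomial (σ ⊕ σ) K) with hJ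
  let Φ : MvPolynomial (σ ⊕ σ) K →ₐ[K]
      (MvPolynomial σ K ⧸ I1) ⊗[K] (MvPolynomial σ K ⧸ I2) :=
    aeval (R := K) (S₁ := (MvPolynomial σ K ⧸ I1) ⊗[K] (MvPolynomial σ K ⧸ I2))
      (Sum.elim (fun i => Ideal.Quotient.mk I1 (X i) ⊗ₜ[K] 1)
      (fun i => 1 ⊗ₜ[K] Ideal.Quotient.mk I2 (X i)))
  have hl : ∀ p, Φ (rename Sum.inl p) = qm I1 p ⊗ₜ 1 := by
    have : Φ.comp (rename Sum.inl) =
        Algebra.TensorProduct.includeLeft.comp (Ideal.Quotient.mkₐ K I1) := by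
      ext i; simp [Φ]
    intro p
    exact congrArg (fun h => h p) this
  have hr : ∀ p, Φ (rename Sum.inr p) = 1 ⊗ₜ qm I2 p := by
    have : Φ.comp (rename Sum.inr) =
        Algebra.TensorProduct.includeRight.comp (Ideal.Quotient.mkₐ K I2) := by
      ext i; simp [Φ]
    intro p
    exact congrArg (fun h => h p) this
  have hker : ∀ p ∈ J, Φ p = 0 := by
    have : J ≤ RingHom.ker Φ := by
      rw [hJ, sup_le_iff, Ideal.map_le_iff_le_comap, Ideal.map_le_iff_le_comap]
      constructor
      · intro p hp
        rw [Ideal.mem_comap, RingHom.mem_ker, hl, qm_eq_zero.2 hp, TensorProduct.zero_tmul]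
      · intro p hp
        rw [Ideal.mem_comap, RingHom.mem_ker, hr, qm_eq_zero.2 hp, TensorProduct.tmul_zero]
    exact fun p hp => this hp
  let Ψ := Ideal.Quotient.liftₐ J Φ hker
  set W1 := (restrictTotalDegree σ K e).map (qm I1) with hW1
  set W2 := (restrictTotalDegree σ K e).map (qm I2) with hW2
  have h1 : LinearMap.range (TensorProduct.map W1.subtype W2.subtype) ≤
      ((restrictTotalDegree (σ ⊕ σ) K (2 * e)).map (qm J)).map Ψ.toLinearMap := by
    rintro _ ⟨z, rfl⟩
    induction z using TensorProduct.induction_on with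
    | zero => rw [map_zero]; exact zero_mem _
    | add x y hx hy => rw [map_add]; exact add_mem hx hy
    | tmul x y =>
      obtain ⟨_, p, hp, rfl⟩ := x
      obtain ⟨_, q, hq, rfl⟩ := y
      refine ⟨_, ⟨rename Sum.inl p * rename Sum.inr q, ?_, rfl⟩, ?_⟩
      · rw [SetLike.mem_coe, mem_restrictTotalDegree] at *
        refine (totalDegree_mul _ _).trans ?_
        have a1 := totalDegree_rename_le (Sum.inl : σ → σ ⊕ σ) p
        have a2 := totalDegree_rename_le (Sum.inr : σ → σ ⊕ σ) q
        omega
      · change Φ (rename Sum.inl p * rename Sum.inr q) = _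
        rw [map_mul, hl, hr]
        simp
  have h2 : Function.Injective (TensorProduct.map W1.subtype W2.subtype) :=
    TensorProduct.map_injective_of_flat_flat _ _ W1.injective_subtype W2.injective_subtype
  have h3 := LinearMap.finrank_range_of_inj h2
  rw [Module.finrank_tensorProduct] at h3
  calc HF I1 e * HF I2 e = _ := h3.symm
    _ ≤ _ := Submodule.finrank_mono h1
    _ ≤ _ := Submodule.finrank_map_le _ _

lemma HF_inter {I1 I2 : Ideal (MvPolynomial σ K)} (h1 : Hom I1) (h2 : Hom I2) (e : ℕ) :
    HF I1 e * HF I2 e ≤ (2 * e + 1) ^ (Fintype.card σ) * HF (I1 ⊔ I2) (2 * e) := by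
  refine (HF_product I1 I2 e).trans ?_
  set J := I1.map (rename Sum.inl : MvPolynomial σ K →ₐ[K] MvPolynomial (σ ⊕ σ) K)
      ⊔ I2.map (rename Sum.inr : MvPolynomial σ K →ₐ[K] MvPolynomial (σ ⊕ σ) K) with hJ
  have hJh : Hom J := (h1.map_rename _).sup (h2.map_rename _)
  let g : σ → MvPolynomial (σ ⊕ σ) K := fun i => X (Sum.inl i) - X (Sum.inr i)
  have h := cut_many Finset.univ g (fun _ => 1)
    (fun i => (isHomogeneous_X _ _).sub (isHomogeneous_X _ _)) (fun _ => le_rfl) hJh (2 * e)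
  refine h.trans (Nat.mul_le_mul_left _ ?_)
  set J' := J ⊔ Ideal.span (g '' (Finset.univ : Finset σ)) with hJ'
  -- collapse
  let π : MvPolynomial (σ ⊕ σ) K →ₐ[K] MvPolynomial σ K := aeval (Sum.elim X X)
  have hπ : ∀ p, p - rename Sum.inl (π p) ∈ J' := by
    intro p
    rw [← Ideal.Quotient.eq_zero_iff_mem, map_sub, sub_eq_zero]
    have : Ideal.Quotient.mkₐ K J' =
        ((Ideal.Quotient.mkₐ K J').comp (rename Sum.inl)).comp π := by
      ext i
      rcases i with i | i
      · simp [π]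
      · simp only [Ideal.Quotient.mkₐ_eq_mk, AlgHom.coe_comp, Function.comp_apply, π, aeval_X,
          Sum.elim_inr, rename_X]
        rw [eq_comm, Ideal.Quotient.eq]
        refine Ideal.mem_sup_right (Ideal.subset_span ⟨i, by simp, rfl⟩)
    exact congrArg (fun h => h p) this
  refine HF_le_of_hom _ _ (rename Sum.inl) _ _ ?_ ?_
  · have : I1 ⊔ I2 ≤ J'.comap (rename Sum.inl : MvPolynomial σ K →ₐ[K] MvPolynomial (σ ⊕ σ) K) := by
      refine sup_le ?_ ?_
      · intro p hp
        exact Ideal.mem_sup_left (Ideal.mem_sup_left (Ideal.mem_map_of_mem _ hp))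
      · intro p hp
        rw [Ideal.mem_comap]
        have a1 := hπ (rename Sum.inr p)
        have a2 : π (rename Sum.inr p) = p := by
          change aeval _ (rename _ p) = p
          rw [aeval_rename, Sum.elim_comp_inr]
          exact aeval_X_left_apply p
        rw [a2] at a1
        have a3 : rename Sum.inr p ∈ J' :=
          Ideal.mem_sup_left (Ideal.mem_sup_right (Ideal.mem_map_of_mem _ hp))
        have := sub_mem a3 a1
        simpa using this
    exact fun p hp => this hp
  · intro p hp
    refine ⟨π p, ?_, hπ p⟩
    rw [mem_restrictTotalDegree] at *
    have := totalDegree_aeval_le (Sum.elim X X : σ ⊕ σ → MvPolynomial σ K) 1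
      (by rintro (i | i) <;> simp) p _ hp
    rw [one_mul] at this
    exact this

/-- semicontinuity -/
lemma HF_semicont [Infinite K] {ι : Type} (H : ι → Polynomial (MvPolynomial σ K)) (d : ι → ℕ)
    (hH : ∀ i m, ((H i).coeff m).IsHomogeneous (d i)) (e : ℕ) :
    ∃ τ : K, τ ≠ 0 ∧
      HF (Ideal.span (Set.range fun i => (H i).eval (C τ))) e ≤
      HF (Ideal.span (Set.range fun i => (H i).eval 0)) e := by
  set I0 := Ideal.span (Set.range fun i => (H i).eval 0) with hI0
  let Iτ : K → Ideal (MvPolynomial σ K) := fun τ =>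
    Ideal.span (Set.range fun i => (H i).eval (C τ))
  have hhom : ∀ τ : K, ∀ i, ((H i).eval (C τ)).IsHomogeneous (d i) := by
    intro τ i
    rw [Polynomial.eval_eq_sum_range]
    refine IsHomogeneous.sum _ _ _ fun m _ => ?_
    rw [← C_pow, mul_comm]
    exact (hH i m).C_mul _
  have hlift : ∀ u ∈ (restrictTotalDegree σ K e) ⊓ (I0.restrictScalars K),
      ∃ U : Polynomial (MvPolynomial σ K), U.eval 0 = u ∧
        ∀ τ : K, U.eval (C τ) ∈ (restrictTotalDegree σ K e) ⊓ ((Iτ τ).restrictScalars K) := by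
    rintro u ⟨hu1, hu2⟩
    have hu3 : u ∈ I0 := hu2
    rw [hI0, Ideal.span, Finsupp.mem_span_range_iff_exists_finsupp] at hu3
    obtain ⟨w, hw⟩ := hu3
    choose w' h1 h2 h3 using fun i => trunc_mul ((H i).eval 0) (w i) (d i)
      (by simpa using hhom 0 i) e
    refine ⟨∑ i ∈ w.support, Polynomial.C (w' i) * H i, ?_, fun τ => ⟨?_, ?_⟩⟩
    · rw [Polynomial.eval_finsetSum]
      have : trunc e u = u := trunc_eq_self ((mem_restrictTotalDegree _ _ _).1 hu1)
      rw [← this, ← hw, Finsupp.sum, map_sum]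
      refine Finset.sum_congr rfl fun i _ => ?_
      rw [smul_eq_mul, h1]
      simp
    · rw [Polynomial.eval_finsetSum]
      refine Submodule.sum_mem _ fun i _ => ?_
      rw [mem_restrictTotalDegree]
      simp only [Polynomial.eval_mul, Polynomial.eval_C]
      by_cases hlt : e < d i
      · rw [h3 i hlt]; simp
      · refine (totalDegree_mul _ _).trans ?_
        have := (hhom τ i).totalDegree_le
        have := h2 i
        omega
    · rw [Polynomial.eval_finsetSum]
      refine Submodule.sum_mem _ fun i _ => ?_
      simp only [Polynomial.eval_mul, Polynomial.eval_C]
      exact Ideal.mul_mem_left _ _ (Ideal.subset_span ⟨i, rfl⟩)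
  set V0 := (restrictTotalDegree σ K e) ⊓ (I0.restrictScalars K) with hV0
  let b := Module.finBasis K V0
  set r := Module.finrank K V0
  choose U hU0 hUτ using fun j : Fin r => hlift (b j) (b j).2
  -- dual functionals
  have hli : LinearIndependent K (fun j => (b j : MvPolynomial σ K)) :=
    b.linearIndependent.map' V0.subtype (by simp)
  obtain ⟨ℓ, hℓ⟩ : ∃ ℓ : MvPolynomial σ K →ₗ[K] (Fin r → K), ∀ j, ℓ (b j) = Pi.single j 1 := by
    obtain ⟨q, hq⟩ := LinearMap.exists_leftInverse_of_injective V0.subtype (by simp)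
    refine ⟨b.equivFun.toLinearMap.comp q, fun j => ?_⟩
    have : q (b j) = b j := congrArg (fun h => h (b j)) hq
    rw [LinearMap.comp_apply, this]
    funext i
    refine (b.equivFun_self j i).trans ?_
    rw [Pi.single_apply]
    simp [eq_comm]
  let Mat : Matrix (Fin r) (Fin r) (Polynomial K) := Matrix.of fun i j =>
    ∑ m ∈ (U j).support, Polynomial.monomial m (ℓ ((U j).coeff m) i)
  have hMat : ∀ τ i j, (Mat i j).eval τ = ℓ ((U j).eval (C τ)) i := by
    intro τ i j
    have hM : Mat i j = ∑ m ∈ (U j).support, Polynomial.monomial m (ℓ ((U j).coeff m) i) := rfl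
    rw [hM, Polynomial.eval_eq_sum (p := U j), Polynomial.sum, map_sum,
      Polynomial.eval_finsetSum, Finset.sum_apply]
    refine Finset.sum_congr rfl fun m _ => ?_
    rw [← C_pow, mul_comm, C_mul', map_smul, Polynomial.eval_monomial]
    simp [mul_comm]
  have hdet0 : Mat.det.eval 0 = 1 := by
    rw [← Polynomial.coe_evalRingHom, RingHom.map_det]
    have : (Polynomial.evalRingHom 0).mapMatrix Mat = 1 := by
      ext i j
      simp only [RingHom.mapMatrix_apply, Matrix.map_apply, Polynomial.coe_evalRingHom, hMat]
      rw [C_0, hU0, hℓ, Matrix.one_apply, Pi.single_apply]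
    rw [this, Matrix.det_one]
  have hne : Mat.det * Polynomial.X ≠ 0 := by
    refine mul_ne_zero ?_ Polynomial.X_ne_zero
    intro h
    rw [h] at hdet0
    simp at hdet0
  obtain ⟨τ, hτ⟩ : ∃ τ, (Mat.det * Polynomial.X).eval τ ≠ 0 := by
    by_contra hcon
    push Not at hcon
    exact hne (Polynomial.funext (by simpa using hcon))
  rw [Polynomial.eval_mul, Polynomial.eval_X] at hτ
  refine ⟨τ, right_ne_zero_of_mul hτ, ?_⟩
  have hdet := left_ne_zero_of_mul hτ
  have hli2 : LinearIndependent K (fun j =>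
      (⟨(U j).eval (C τ), hUτ j τ⟩ : ↥((restrictTotalDegree σ K e) ⊓
        ((Iτ τ).restrictScalars K)))) := by
    apply LinearIndependent.of_comp (ℓ.comp (Submodule.subtype _))
    rw [← Polynomial.coe_evalRingHom, RingHom.map_det] at hdet
    have := Matrix.linearIndependent_cols_of_det_ne_zero hdet
    have h5 : (ℓ.comp (Submodule.subtype _)) ∘ (fun j =>
      (⟨(U j).eval (C τ), hUτ j τ⟩ : ↥((restrictTotalDegree σ K e) ⊓
        ((Iτ τ).restrictScalars K)))) = ((Polynomial.evalRingHom τ).mapMatrix Mat).col := by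
      funext j i
      simp [Matrix.col, hMat]
    rw [h5]; exact this
  have hcard := hli2.fintype_card_le_finrank
  rw [Fintype.card_fin] at hcard
  have e1 := HF_add I0 e
  rw [← hV0] at e1
  have e2 := HF_add (Iτ τ) e
  have e3 : HF (Iτ τ) e ≤ HF I0 e := by omega
  exact e3

end General
end PACC1

namespace PACC1
open MvPolynomial
set_option linter.unusedSectionVars false

section Arcs
variable {K : Type} [Field K] {N : ℕ}

/-- generic truncated arc -/
noncomputable def gx (K : Type) [Field K] (N M : ℕ) (i : Fin N) :
    Polynomial (MvPolynomial (Fin N × Fin M) K) :=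
  ∑ j : Fin M, Polynomial.monomial (j : ℕ) (X (i, j))

/-- contact ideals -/
noncomputable def IM (M : ℕ) (a : MvPolynomial (Fin N) K → ℕ) :
    Ideal (MvPolynomial (Fin N × Fin M) K) :=
  Ideal.span {g | ∃ s j, (∃ q, s.IsHomogeneous q) ∧ j < a s ∧ g = (aeval (gx K N M) s).coeff j}

lemma gx_coeff (M : ℕ) (i : Fin N) (j : ℕ) :
    (gx K N M i).coeff j = if h : j < M then X (i, ⟨j, h⟩) else 0 := by
  rw [gx, Polynomial.finsetSum_coeff]
  simp_rw [Polynomial.coeff_monomial]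
  split_ifs with h
  · rw [Finset.sum_eq_single ⟨j, h⟩]
    · simp
    · intro b _ hb
      rw [if_neg]
      intro h'
      exact hb (Fin.ext h')
    · simp
  · refine Finset.sum_eq_zero fun b _ => ?_
    rw [if_neg]
    have := b.2
    omega

/-- all coefficients homogeneous -/
def HP {σ : Type} (q : ℕ) (p : Polynomial (MvPolynomial σ K)) : Prop :=
  ∀ j, (p.coeff j).IsHomogeneous q

lemma HP.mul {σ : Type} {q r : ℕ} {p p' : Polynomial (MvPolynomial σ K)} (h : HP q p)
    (h' : HP r p') : HP (q + r) (p * p') := by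
  intro j
  rw [Polynomial.coeff_mul]
  exact IsHomogeneous.sum _ _ _ fun x _ => (h _).mul (h' _)

lemma HP.one {σ : Type} : HP 0 (1 : Polynomial (MvPolynomial σ K)) := by
  intro j
  rw [Polynomial.coeff_one]
  split_ifs
  · exact isHomogeneous_one _ _
  · exact isHomogeneous_zero _ _ _

lemma HP.pow {σ : Type} {p : Polynomial (MvPolynomial σ K)} (h : HP 1 p) (n : ℕ) :
    HP n (p ^ n) := by
  induction n with
  | zero => rw [pow_zero]; exact HP.one
  | succ n ih => rw [pow_succ]; exact ih.mul h

lemma HP.prod {σ ι : Type} {s : Finset ι} {q : ι → ℕ} {p : ι → Polynomial (MvPolynomial σ K)}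
    (h : ∀ i, HP (q i) (p i)) : HP (∑ i ∈ s, q i) (∏ i ∈ s, p i) := by
  classical
  induction s using Finset.induction_on with
  | empty => simpa using HP.one
  | insert a s ha ih => rw [Finset.sum_insert ha, Finset.prod_insert ha]; exact (h a).mul ih

lemma HP.aeval {σ : Type} {x : Fin N → Polynomial (MvPolynomial σ K)} (hx : ∀ i, HP 1 (x i))
    {s : MvPolynomial (Fin N) K} {q : ℕ} (hs : s.IsHomogeneous q) :
    HP q (aeval x s) := by
  intro j
  rw [MvPolynomial.aeval_def, eval₂_eq, Polynomial.finsetSum_coeff]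
  refine IsHomogeneous.sum _ _ _ fun d hd => ?_
  have h0 : (algebraMap K (Polynomial (MvPolynomial σ K))) (coeff d s) =
      Polynomial.C (C (coeff d s)) := rfl
  rw [h0, Polynomial.coeff_C_mul]
  refine IsHomogeneous.C_mul ?_ _
  have h1 : d.degree = q := by
    by_contra hne
    exact (mem_support_iff.1 hd) (hs.coeff_eq_zero hne)
  have := (HP.prod (s := d.support) (fun i => (hx i).pow (d i))) j
  rw [← h1]
  exact this

lemma HP_gx (M : ℕ) (i : Fin N) : HP 1 (gx K N M i) := by
  intro j
  rw [gx_coeff]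
  split_ifs
  · exact isHomogeneous_X _ _
  · exact isHomogeneous_zero _ _ _

lemma Hom_IM (M : ℕ) (a : MvPolynomial (Fin N) K → ℕ) : Hom (IM M a) := by
  refine Hom.span _ ?_
  rintro _ ⟨s, j, ⟨q, hq⟩, _, rfl⟩
  exact ⟨q, HP.aeval (HP_gx M) hq j⟩

lemma aeval_map {R R' : Type} [CommRing R] [CommRing R'] [Algebra K R] [Algebra K R']
    (φ : R →ₐ[K] R') (x : Fin N → Polynomial R) (s : MvPolynomial (Fin N) K) :
    (aeval x s).map (φ : R →+* R') = aeval (fun i => (x i).map (φ : R →+* R')) s := by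
  have := comp_aeval_apply (Polynomial.mapAlgHom φ) (f := x) s
  exact this

lemma aeval_congr_mod {R : Type} [CommRing R] [Algebra K R] (Q : Ideal R) (x y : Fin N → R)
    (h : ∀ i, x i - y i ∈ Q) (s : MvPolynomial (Fin N) K) : aeval x s - aeval y s ∈ Q := by
  rw [← Ideal.Quotient.eq]
  have h1 := comp_aeval_apply (Ideal.Quotient.mkₐ K Q) (f := x) s
  have h2 := comp_aeval_apply (Ideal.Quotient.mkₐ K Q) (f := y) s
  have h3 : (fun i => Ideal.Quotient.mkₐ K Q (x i)) = fun i => Ideal.Quotient.mkₐ K Q (y i) := by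
    funext i
    exact Ideal.Quotient.eq.2 (h i)
  rw [h3] at h1
  exact h1.trans h2.symm

lemma IM_mono (M : ℕ) {a b : MvPolynomial (Fin N) K → ℕ} (h : ∀ s, a s ≤ b s) :
    IM M a ≤ IM M b := by
  refine Ideal.span_mono ?_
  rintro _ ⟨s, j, hs, hj, rfl⟩
  exact ⟨s, j, hs, hj.trans_le (h s), rfl⟩

lemma coeff_divX_iter {R : Type} [CommRing R] (a : ℕ) (p : Polynomial R) (i : ℕ) :
    (Polynomial.divX^[a] p).coeff i = p.coeff (i + a) := by
  induction a generalizing i with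
  | zero => simp
  | succ a ih =>
    rw [Function.iterate_succ_apply', Polynomial.coeff_divX, ih]
    congr 1; ring

lemma taylor_key {R : Type} [CommRing R] (τ : R) (hτ : IsUnit τ) (a b : ℕ) (p : Polynomial R)
    (h1 : ∀ j < a, p.coeff j = 0) (h2 : ∀ j < b, (Polynomial.taylor τ p).coeff j = 0) :
    ∀ i < b, (Polynomial.taylor τ (Polynomial.divX^[a] p)).coeff i = 0 := by
  have hp : p = Polynomial.X ^ a * Polynomial.divX^[a] p := by
    ext j
    rw [Polynomial.coeff_X_pow_mul']
    split_ifs with h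
    · rw [coeff_divX_iter]; congr 1; omega
    · exact h1 j (by omega)
  set q := Polynomial.divX^[a] p
  have h3 : Polynomial.X ^ b ∣ Polynomial.taylor τ p := Polynomial.X_pow_dvd_iff.2 h2
  rw [hp, Polynomial.taylor_mul, Polynomial.taylor_pow, Polynomial.taylor_X] at h3
  have h4 : IsCoprime (Polynomial.X ^ b : Polynomial R) ((Polynomial.X + Polynomial.C τ) ^ a) := by
    refine IsCoprime.pow ?_
    obtain ⟨u, rfl⟩ := hτ
    refine ⟨- Polynomial.C (↑u⁻¹ : R), Polynomial.C (↑u⁻¹ : R), ?_⟩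
    rw [mul_add, ← Polynomial.C_mul]
    simp
  exact Polynomial.X_pow_dvd_iff.1 (h4.dvd_of_dvd_mul_left h3)

/-- the translate of a contact ideal -/
noncomputable def IT (M : ℕ) (τ : K) (a : MvPolynomial (Fin N) K → ℕ) :
    Ideal (MvPolynomial (Fin N × Fin M) K) :=
  Ideal.span {g | ∃ s j, (∃ q, s.IsHomogeneous q) ∧ j < a s ∧
    g = (Polynomial.taylor (C τ) (aeval (gx K N M) s)).coeff j}

lemma HP.taylor {σ : Type} {p : Polynomial (MvPolynomial σ K)} {q : ℕ} (hp : HP q p) (τ : K) :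
    HP q (Polynomial.taylor (C τ) p) := by
  intro j
  rw [Polynomial.taylor_coeff, Polynomial.eval_eq_sum, Polynomial.sum]
  refine IsHomogeneous.sum _ _ _ fun m _ => ?_
  rw [Polynomial.hasseDeriv_coeff, ← C_pow, mul_comm]
  refine IsHomogeneous.C_mul ?_ _
  have : ((m + j).choose j : MvPolynomial σ K) = C ((m + j).choose j : K) := by simp
  rw [this]
  exact (hp _).C_mul _

lemma Hom_IT (M : ℕ) (τ : K) (a : MvPolynomial (Fin N) K → ℕ) : Hom (IT M τ a) := by
  refine Hom.span _ ?_
  rintro _ ⟨s, j, ⟨q, hq⟩, _, rfl⟩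
  exact ⟨q, (HP.aeval (HP_gx M) hq).taylor τ j⟩

/-- translation -/
noncomputable def theta (N M : ℕ) (τ : K) :
    MvPolynomial (Fin N × Fin M) K →ₐ[K] MvPolynomial (Fin N × Fin M) K :=
  aeval fun ij => (Polynomial.taylor (C τ) (gx K N M ij.1)).coeff ij.2

lemma degree_gx (M : ℕ) (i : Fin N) (j : ℕ) (hj : M ≤ j) : (gx K N M i).coeff j = 0 := by
  rw [gx_coeff, dif_neg (by omega)]

lemma coeff_taylor_gx (M : ℕ) (τ : K) (i : Fin N) (j : ℕ) (hj : M ≤ j) :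
    (Polynomial.taylor (C τ) (gx K N M i)).coeff j = 0 := by
  rw [Polynomial.taylor_coeff]
  have : Polynomial.hasseDeriv j (gx K N M i) = 0 := by
    ext1 m
    rw [Polynomial.hasseDeriv_coeff, degree_gx _ _ _ (by omega)]
    simp
  rw [this]; simp

lemma map_gx {R : Type} [CommRing R] [Algebra K R] (M : ℕ) (z : Fin N → Polynomial R)
    (hz : ∀ i j, M ≤ j → (z i).coeff j = 0)
    (φ : MvPolynomial (Fin N × Fin M) K →ₐ[K] R)
    (hφ : ∀ i (j : Fin M), φ (X (i, j)) = (z i).coeff j) (i : Fin N) :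
    (gx K N M i).map (φ : MvPolynomial (Fin N × Fin M) K →+* R) = z i := by
  ext j
  rw [Polynomial.coeff_map, gx_coeff]
  split_ifs with h
  · exact hφ i ⟨j, h⟩
  · rw [map_zero, hz i j (by omega)]

lemma map_theta_gx (M : ℕ) (τ : K) (i : Fin N) :
    (gx K N M i).map (theta N M τ : MvPolynomial (Fin N × Fin M) K →+* _) =
      Polynomial.taylor (C τ) (gx K N M i) :=
  map_gx M (fun i => Polynomial.taylor (C τ) (gx K N M i))
    (fun i j hj => coeff_taylor_gx M τ i j hj) (theta N M τ) (fun i j => by simp [theta]) i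

lemma taylor_aeval {R : Type} [CommRing R] [Algebra K R] (τ : R) (x : Fin N → Polynomial R)
    (s : MvPolynomial (Fin N) K) : Polynomial.taylor τ (aeval x s) =
      aeval (fun i => Polynomial.taylor τ (x i)) s :=
  comp_aeval_apply ((Polynomial.taylorAlgHom τ).restrictScalars K) (f := x) s

lemma theta_coeff_taylor (M : ℕ) (τ : K) (s : MvPolynomial (Fin N) K) (j : ℕ) :
    theta N M (-τ) ((Polynomial.taylor (C τ) (aeval (gx K N M) s)).coeff j) =
      (aeval (gx K N M) s).coeff j := by
  have h1 : theta N M (-τ) ((Polynomial.taylor (C τ) (aeval (gx K N M) s)).coeff j) =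
      ((Polynomial.taylor (C τ) (aeval (gx K N M) s)).map
        (theta N M (-τ) : MvPolynomial (Fin N × Fin M) K →+* _)).coeff j := by
    rw [Polynomial.coeff_map]; rfl
  rw [h1, Polynomial.map_taylor, aeval_map]
  simp_rw [map_theta_gx]
  rw [← taylor_aeval]
  have h2 : (theta N M (-τ) : MvPolynomial (Fin N × Fin M) K →+* MvPolynomial (Fin N × Fin M) K) (C τ) = C τ := by
    have := (theta N M (-τ)).commutes τ
    exact this
  rw [h2, Polynomial.taylor_taylor]
  simp

lemma theta_theta (M : ℕ) (τ : K) (p : MvPolynomial (Fin N × Fin M) K) :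
    theta N M (-τ) (theta N M τ p) = p := by
  have : (theta N M (-τ)).comp (theta N M τ) = AlgHom.id K _ := by
    ext ij : 1
    obtain ⟨i, j⟩ := ij
    have := theta_coeff_taylor M τ (X i) j
    rw [aeval_X] at this
    simp only [AlgHom.comp_apply, AlgHom.id_apply]
    have h2 : theta N M τ (X (i, j)) = (Polynomial.taylor (C τ) (gx K N M i)).coeff j := by
      simp [theta]
    rw [h2, this, gx_coeff, dif_pos j.2]
  exact congrArg (fun h => h p) this

lemma HF_IT (M : ℕ) (τ : K) (a : MvPolynomial (Fin N) K → ℕ) (e : ℕ) :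
    HF (IM M a) e ≤ HF (IT M τ a) e := by
  refine HF_le_of_hom _ _ (theta N M (-τ)) e e ?_ ?_
  · have : IT M τ a ≤ (IM M a).comap (theta N M (-τ)) := by
      rw [IT, Ideal.span_le]
      rintro _ ⟨s, j, hs, hj, rfl⟩
      rw [SetLike.mem_coe, Ideal.mem_comap, theta_coeff_taylor]
      exact Ideal.subset_span ⟨s, j, hs, hj, rfl⟩
    exact fun p hp => this hp
  · intro p hp
    refine ⟨theta N M τ p, ?_, ?_⟩
    · rw [mem_restrictTotalDegree] at *
      have := totalDegree_aeval_le
        (fun ij : Fin N × Fin M => (Polynomial.taylor (C τ) (gx K N M ij.1)).coeff ij.2) 1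
        (fun ij => ((HP_gx M ij.1).taylor τ ij.2).totalDegree_le) p e hp
      rw [one_mul] at this
      exact this
    · rw [theta_theta, sub_self]; exact zero_mem _

/-- fusion of contact conditions, Hilbert function version -/
lemma HF_fusion [Infinite K] (M : ℕ) (a b : MvPolynomial (Fin N) K → ℕ) (e : ℕ) :
    HF (IM M a) e * HF (IM M b) e ≤ (2 * e + 1) ^ (N * M) * HF (IM M (a + b)) (2 * e) := by
  classical
  let ι := {t : MvPolynomial (Fin N) K × ℕ //
    (∃ q, t.1.IsHomogeneous q) ∧ t.2 < a t.1 + b t.1}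
  let H : ι → Polynomial (MvPolynomial (Fin N × Fin M) K) := fun t =>
    if t.1.2 < a t.1.1 then Polynomial.C ((aeval (gx K N M) t.1.1).coeff t.1.2)
    else Polynomial.hasseDeriv (t.1.2 - a t.1.1)
      (Polynomial.divX^[a t.1.1] (aeval (gx K N M) t.1.1))
  let d : ι → ℕ := fun t => t.2.1.choose
  have hd : ∀ t : ι, t.1.1.IsHomogeneous (d t) := fun t => t.2.1.choose_spec
  have hH : ∀ i m, ((H i).coeff m).IsHomogeneous (d i) := by
    intro t m
    have hh := HP.aeval (HP_gx M) (hd t)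
    simp only [H]
    split_ifs
    · rw [Polynomial.coeff_C]
      split_ifs
      · exact hh _
      · exact isHomogeneous_zero _ _ _
    · rw [Polynomial.hasseDeriv_coeff, coeff_divX_iter]
      have h1 : ∀ c : ℕ, (c : MvPolynomial (Fin N × Fin M) K) = C (c : K) := by simp
      rw [h1]
      exact (hh _).C_mul _
  obtain ⟨τ, hτ, hle⟩ := HF_semicont H d hH (2 * e)
  have h0 : IM M (a + b) ≤ Ideal.span (Set.range fun i => (H i).eval 0) := by
    refine Ideal.span_mono ?_
    rintro _ ⟨s, j, hs, hj, rfl⟩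
    refine ⟨⟨(s, j), hs, hj⟩, ?_⟩
    simp only [H]
    split_ifs with h
    · simp
    · rw [← Polynomial.coeff_zero_eq_eval_zero, Polynomial.hasseDeriv_coeff, coeff_divX_iter]
      simp only [zero_add, Nat.choose_self, Nat.cast_one, one_mul]
      congr 1; omega
  have h1 : Ideal.span (Set.range fun i => (H i).eval (C τ)) ≤ IM M a ⊔ IT M τ b := by
    rw [Ideal.span_le]
    rintro _ ⟨⟨⟨s, j⟩, hs, hj⟩, rfl⟩
    simp only [H]
    split_ifs with h
    · rw [Polynomial.eval_C]
      exact Ideal.mem_sup_left (Ideal.subset_span ⟨s, j, hs, h, rfl⟩)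
    · simp only at hj h
      rw [← Polynomial.taylor_coeff, SetLike.mem_coe, ← Ideal.Quotient.eq_zero_iff_mem,
        ← Polynomial.coeff_map, Polynomial.map_taylor]
      have h3 : (Polynomial.divX^[a s] (aeval (gx K N M) s)).map
          (Ideal.Quotient.mk (IM M a ⊔ IT M τ b)) =
          Polynomial.divX^[a s] ((aeval (gx K N M) s).map
          (Ideal.Quotient.mk (IM M a ⊔ IT M τ b))) := by
        ext i
        rw [Polynomial.coeff_map, coeff_divX_iter, coeff_divX_iter, Polynomial.coeff_map]
      rw [h3]
      refine taylor_key _ ?_ (a s) (b s) _ ?_ ?_ _ (by omega)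
      · exact ((isUnit_iff_ne_zero.2 hτ).map C).map _
      · intro i hi
        rw [Polynomial.coeff_map, Ideal.Quotient.eq_zero_iff_mem]
        exact Ideal.mem_sup_left (Ideal.subset_span ⟨s, i, hs, hi, rfl⟩)
      · intro i hi
        rw [← Polynomial.map_taylor, Polynomial.coeff_map, Ideal.Quotient.eq_zero_iff_mem]
        exact Ideal.mem_sup_right (Ideal.subset_span ⟨s, i, hs, hi, rfl⟩)
  have h2 := HF_inter (Hom_IM M a) (Hom_IT M τ b) e
  rw [Fintype.card_prod, Fintype.card_fin, Fintype.card_fin] at h2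
  calc _ ≤ _ := Nat.mul_le_mul_left _ (HF_IT M τ b e)
    _ ≤ _ := h2
    _ ≤ _ := Nat.mul_le_mul_left _ ((HF_anti h1 _).trans (hle.trans (HF_anti h0 _)))

lemma Ind_fusion [Infinite K] (M : ℕ) (a b : MvPolynomial (Fin N) K → ℕ) (D1 D2 D : ℕ)
    (h1 : Ind (IM M a) D1) (h2 : Ind (IM M b) D2) (hD : D + N * M = D1 + D2) :
    Ind (IM M (a + b)) D := by
  obtain ⟨C1, hC1⟩ := h1.growth
  obtain ⟨C2, hC2⟩ := h2.growth
  refine Ind.of_growth _ D (N * M) (C1 * C2) fun e => ?_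
  rw [hD, pow_add]
  calc e ^ D1 * e ^ D2 ≤ (C1 * HF (IM M a) e) * (C2 * HF (IM M b) e) :=
        Nat.mul_le_mul (hC1 e) (hC2 e)
    _ = (C1 * C2) * (HF (IM M a) e * HF (IM M b) e) := by ring
    _ ≤ (C1 * C2) * ((2 * e + 1) ^ (N * M) * HF (IM M (a + b)) (2 * e)) :=
        Nat.mul_le_mul_left _ (HF_fusion M a b e)
    _ = _ := by ring

end Arcs
end PACC1

namespace PACC1
open MvPolynomial
set_option linter.unusedSectionVars false

section Raise
variable {K : Type} [Field K] {N : ℕ}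

lemma inj_sum {R' : Type} [CommRing R'] [Algebra K R'] {D : ℕ} {ρ : Type} (y : Fin D → R')
    (hy : ∀ p : MvPolynomial (Fin D) K, aeval y p = 0 → p = 0)
    (p : MvPolynomial (ρ ⊕ Fin D) K)
    (hp : aeval (Sum.elim (X : ρ → MvPolynomial ρ R') (fun t => C (y t))) p = 0) : p = 0 := by
  have h1 : aeval (Sum.elim (X : ρ → MvPolynomial ρ R') (fun t => C (y t))) p =
      MvPolynomial.map (aeval y : MvPolynomial (Fin D) K →ₐ[K] R').toRingHom
        (sumAlgEquiv K ρ (Fin D) p) := by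
    have : (aeval (Sum.elim (X : ρ → MvPolynomial ρ R') (fun t => C (y t)))
        : MvPolynomial (ρ ⊕ Fin D) K →ₐ[K] _) =
      (MvPolynomial.mapAlgHom (aeval y : MvPolynomial (Fin D) K →ₐ[K] R')).comp
        (sumAlgEquiv K ρ (Fin D)).toAlgHom := by
      ext t : 1
      rcases t with t | t <;> simp
    exact congrArg (fun h => h p) this
  rw [h1] at hp
  have hinj : Function.Injective (aeval y : MvPolynomial (Fin D) K →ₐ[K] R').toRingHom :=
    (injective_iff_map_eq_zero _).2 hy
  have := map_injective (σ := ρ) _ hinj (hp.trans (map_zero _).symm)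
  exact (map_eq_zero_iff _ (sumAlgEquiv K ρ (Fin D)).injective).1 this

lemma coeff_aeval_congr {R : Type} [CommRing R] [Algebra K R] (M : ℕ) (x y : Fin N → Polynomial R)
    (h : ∀ i j, j < M → (x i).coeff j = (y i).coeff j) (s : MvPolynomial (Fin N) K)
    (j : ℕ) (hj : j < M) : (aeval x s).coeff j = (aeval y s).coeff j := by
  have := aeval_congr_mod (Ideal.span {(Polynomial.X ^ M : Polynomial R)}) x y ?_ s
  · rw [Ideal.mem_span_singleton, Polynomial.X_pow_dvd_iff] at this
    have := this j hj
    rwa [Polynomial.coeff_sub, sub_eq_zero] at this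
  · intro i
    rw [Ideal.mem_span_singleton, Polynomial.X_pow_dvd_iff]
    intro d hd
    rw [Polynomial.coeff_sub, h i d hd, sub_self]

lemma coeff_map_congr {T : Type} [CommRing T] [Algebra K T] (M M1 : ℕ) (hM : M ≤ M1)
    (Ψ : MvPolynomial (Fin N × Fin M1) K →ₐ[K] T) (φ : MvPolynomial (Fin N × Fin M) K →ₐ[K] T)
    (h : ∀ i (j : Fin M), Ψ (X (i, Fin.castLE hM j)) = φ (X (i, j)))
    (s : MvPolynomial (Fin N) K) (j : ℕ) (hj : j < M) :
    Ψ ((aeval (gx K N M1) s).coeff j) = φ ((aeval (gx K N M) s).coeff j) := by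
  have h1 : Ψ ((aeval (gx K N M1) s).coeff j) =
      ((aeval (gx K N M1) s).map (Ψ : _ →+* T)).coeff j := by
    rw [Polynomial.coeff_map]; rfl
  have h2 : φ ((aeval (gx K N M) s).coeff j) =
      ((aeval (gx K N M) s).map (φ : _ →+* T)).coeff j := by
    rw [Polynomial.coeff_map]; rfl
  rw [h1, h2, aeval_map, aeval_map]
  refine coeff_aeval_congr M _ _ (fun i d hd => ?_) s j hj
  rw [Polynomial.coeff_map, Polynomial.coeff_map, gx_coeff, gx_coeff, dif_pos hd,
    dif_pos (by omega)]
  exact h i ⟨d, hd⟩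

lemma Ind_raise (M R : ℕ) (a : MvPolynomial (Fin N) K → ℕ) (ha : ∀ s, a s ≤ M) (D : ℕ)
    (h : Ind (IM M a) D) : Ind (IM (M + R) a) (D + N * R) := by
  obtain ⟨y, hy⟩ := h
  obtain ⟨R', _, _, mk, hmk⟩ : ∃ (R' : Type) (_ : CommRing R') (_ : Algebra K R')
      (mk : MvPolynomial (Fin N × Fin M) K →ₐ[K] R'), ∀ p, mk p = 0 ↔ p ∈ IM M a :=
    ⟨_, _, _, Ideal.Quotient.mkₐ K (IM M a), fun p => Ideal.Quotient.eq_zero_iff_mem⟩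
  let φ : MvPolynomial (Fin N × Fin M) K →ₐ[K] MvPolynomial (Fin N × Fin R) R' :=
    (IsScalarTower.toAlgHom K R' (MvPolynomial (Fin N × Fin R) R')).comp mk
  have hφ : ∀ p, φ p = C (mk p) := fun p => rfl
  let Ψ : MvPolynomial (Fin N × Fin (M + R)) K →ₐ[K] MvPolynomial (Fin N × Fin R) R' :=
    aeval fun ij => Fin.addCases (fun j => φ (X (ij.1, j))) (fun j => X (ij.1, j)) ij.2
  have hΨ1 : ∀ i (j : Fin M), Ψ (X (i, Fin.castAdd R j)) = φ (X (i, j)) := by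
    intro i j; simp [Ψ]
  have hΨ2 : ∀ i (j : Fin R), Ψ (X (i, Fin.natAdd M j)) = X (i, j) := by
    intro i j; simp [Ψ]
  have hker : IM (M + R) a ≤ RingHom.ker Ψ := by
    rw [IM, Ideal.span_le]
    rintro _ ⟨s, j, hs, hj, rfl⟩
    rw [SetLike.mem_coe, RingHom.mem_ker]
    refine (coeff_map_congr M (M + R) (by omega) Ψ φ hΨ1 s j (hj.trans_le (ha s))).trans ?_
    have : mk ((aeval (gx K N M) s).coeff j) = 0 :=
      (hmk _).2 (Ideal.subset_span ⟨s, j, hs, hj, rfl⟩)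
    rw [hφ, this, map_zero]
  let ι : MvPolynomial (Fin N × Fin M) K →ₐ[K] MvPolynomial (Fin N × Fin (M + R)) K :=
    rename fun ij => (ij.1, Fin.castAdd R ij.2)
  have hι : ∀ p, Ψ (ι p) = φ p := by
    intro p
    have : Ψ.comp ι = φ := by
      ext ij : 1
      simp only [AlgHom.comp_apply, ι, rename_X]
      exact hΨ1 _ _
    exact congrArg (fun h => h p) this
  let Y : (Fin N × Fin R) ⊕ Fin D → MvPolynomial (Fin N × Fin (M + R)) K :=
    Sum.elim (fun ij => X (ij.1, Fin.natAdd M ij.2)) (fun t => ι (y t))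
  refine Ind.of_fintype (by simp [add_comm]) Y fun p hp => ?_
  have h1 : Ψ (aeval Y p) = 0 := hker hp
  rw [comp_aeval_apply] at h1
  refine inj_sum (fun t => mk (y t)) ?_ p ?_
  · intro q hq
    refine hy q ?_
    rw [← comp_aeval_apply (f := y) mk] at hq
    exact (hmk _).1 hq
  · rw [← h1]
    congr 2
    funext t
    rcases t with t | t
    · exact (hΨ2 _ _).symm
    · exact ((hι (y t)).trans (hφ _)).symm

lemma X_mem_IM (M : ℕ) (a : MvPolynomial (Fin N) K → ℕ) (i : Fin N) (j : Fin M)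
    (h : (j : ℕ) < a (X i)) : X (i, j) ∈ IM M a := by
  refine Ideal.subset_span ⟨X i, j, ⟨1, isHomogeneous_X _ _⟩, h, ?_⟩
  rw [aeval_X, gx_coeff, dif_pos j.2]

lemma aeval_smul_hom {R : Type} [CommRing R] [Algebra K R] (t : R) (x : Fin N → R)
    (s : MvPolynomial (Fin N) K) (q : ℕ) (hs : s.IsHomogeneous q) :
    aeval (fun i => t * x i) s = t ^ q * aeval x s := by
  rw [MvPolynomial.aeval_def, MvPolynomial.aeval_def, eval₂_eq, eval₂_eq, Finset.mul_sum]
  refine Finset.sum_congr rfl fun d hd => ?_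
  have h1 : d.degree = q := by
    by_contra hne
    exact (mem_support_iff.1 hd) (hs.coeff_eq_zero hne)
  simp_rw [mul_pow]
  rw [Finset.prod_mul_distrib, Finset.prod_pow_eq_pow_sum]
  have : ∑ i ∈ d.support, d i = q := h1
  rw [this]; ring

lemma Ind_strip (R M : ℕ) (a b : MvPolynomial (Fin N) K → ℕ) (D : ℕ)
    (hX : ∀ i, R ≤ a (X i))
    (hb : ∀ s, 0 < b s → ∃ q, s.IsHomogeneous q ∧ b s + R * q ≤ a s)
    (h : Ind (IM (R + M) a) D) : Ind (IM M b) D := by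
  obtain ⟨y, hy⟩ := h
  let ι : MvPolynomial (Fin N × Fin M) K →ₐ[K] MvPolynomial (Fin N × Fin (R + M)) K :=
    rename fun ij => (ij.1, Fin.natAdd R ij.2)
  let π : MvPolynomial (Fin N × Fin (R + M)) K →ₐ[K] MvPolynomial (Fin N × Fin M) K :=
    aeval fun ij => Fin.addCases (fun _ => 0) (fun j => X (ij.1, j)) ij.2
  have hιπ : ∀ z, ι (π z) - z ∈ IM (R + M) a := by
    intro z
    have h1 := comp_aeval_apply (Ideal.Quotient.mkₐ K (IM (R + M) a))
      (f := fun ij => ι (π (X ij))) z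
    have h2 := comp_aeval_apply (Ideal.Quotient.mkₐ K (IM (R + M) a))
      (f := fun ij => (X ij : MvPolynomial (Fin N × Fin (R + M)) K)) z
    have h3 : ∀ ij, Ideal.Quotient.mkₐ K (IM (R + M) a) (ι (π (X ij))) =
        Ideal.Quotient.mkₐ K (IM (R + M) a) (X ij) := by
      rintro ⟨i, j⟩
      refine Ideal.Quotient.eq.2 ?_
      induction j using Fin.addCases with
      | left j =>
        have : π (X (i, Fin.castAdd M j)) = 0 := by simp [π]
        rw [this, map_zero, zero_sub]
        exact neg_mem (X_mem_IM _ _ _ _ (lt_of_lt_of_le j.2 (hX i)))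
      | right j =>
        have : π (X (i, Fin.natAdd R j)) = X (i, j) := by simp [π]
        rw [this]
        simp [ι]
    simp_rw [h3] at h1
    have h4 := h1.trans h2.symm
    have h5 : aeval (fun ij => ι (π (X ij))) z = ι (π z) := by
      have : (aeval (fun ij => ι (π (X ij))) : MvPolynomial (Fin N × Fin (R + M)) K →ₐ[K] _) =
        ι.comp π := by
        ext ij : 1
        simp
      exact congrArg (fun h => h z) this
    have h6 : aeval (fun ij => (X ij : MvPolynomial (Fin N × Fin (R + M)) K)) z = z :=
      aeval_X_left_apply z
    rw [h5, h6] at h4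
    exact Ideal.Quotient.eq.1 h4
  have hι : IM M b ≤ (IM (R + M) a).comap ι := by
    rw [IM, Ideal.span_le]
    rintro _ ⟨s, j, hs, hj, rfl⟩
    rw [SetLike.mem_coe, Ideal.mem_comap]
    obtain ⟨q, hq, hle⟩ := hb s (by omega)
    have h1 : ι ((aeval (gx K N M) s).coeff j) =
        ((aeval (gx K N M) s).map (ι : _ →+* MvPolynomial (Fin N × Fin (R + M)) K)).coeff j := by
      rw [Polynomial.coeff_map]; rfl
    rw [h1, aeval_map]
    have h2 := aeval_smul_hom (Polynomial.X ^ R)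
      (fun i => (gx K N M i).map (ι : _ →+* MvPolynomial (Fin N × Fin (R + M)) K)) s q hq
    have h3 := aeval_congr_mod (Ideal.map Polynomial.C (IM (R + M) a))
      (fun i => Polynomial.X ^ R *
        (gx K N M i).map (ι : _ →+* MvPolynomial (Fin N × Fin (R + M)) K))
      (gx K N (R + M)) ?_ s
    · rw [h2, Ideal.mem_map_C_iff] at h3
      have h4 := h3 (j + R * q)
      rw [Polynomial.coeff_sub, ← pow_mul, Polynomial.coeff_X_pow_mul] at h4
      have h5 : (aeval (gx K N (R + M)) s).coeff (j + R * q) ∈ IM (R + M) a :=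
        Ideal.subset_span ⟨s, j + R * q, hs, by omega, rfl⟩
      have := add_mem h4 h5
      rwa [sub_add_cancel] at this
    · intro i
      rw [Ideal.mem_map_C_iff]
      intro d
      rw [Polynomial.coeff_sub, Polynomial.coeff_X_pow_mul', gx_coeff]
      by_cases hd : R ≤ d
      · rw [if_pos hd, Polynomial.coeff_map, gx_coeff]
        by_cases hd2 : d - R < M
        · rw [dif_pos hd2, dif_pos (by omega)]
          have : (ι : MvPolynomial (Fin N × Fin M) K →+* MvPolynomial (Fin N × Fin (R + M)) K) (X (i, ⟨d - R, hd2⟩)) =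
              X (i, ⟨d, by omega⟩) := by
            change ι _ = _
            simp only [ι, rename_X]
            congr 2
            ext
            simp; omega
          rw [this, sub_self]; exact zero_mem _
        · rw [dif_neg hd2, dif_neg (by omega), map_zero, sub_zero]; exact zero_mem _
      · rw [if_neg hd, dif_pos (by omega), zero_sub]
        exact neg_mem (X_mem_IM _ _ _ _ (lt_of_lt_of_le (by simpa using hd) (hX i)))
  refine ⟨fun t => π (y t), fun p hp => hy p ?_⟩
  rw [← comp_aeval_apply (f := y) π] at hp
  have h1 := hι hp
  rw [Ideal.mem_comap] at h1
  have := sub_mem h1 (hιπ (aeval y p))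
  rwa [sub_sub_cancel] at this

lemma Ind_le_card {σ : Type} [Fintype σ] (I : Ideal (MvPolynomial σ K)) (D : ℕ) (h : Ind I D) :
    D ≤ Fintype.card σ := by
  obtain ⟨y, hy⟩ := h
  have h1 : AlgebraicIndependent K y := by
    rw [algebraicIndependent_iff]
    intro p hp
    exact hy p (by rw [hp]; exact zero_mem _)
  have := h1.cardinalMk_le_trdeg
  rw [MvPolynomial.trdeg_of_isDomain] at this
  simpa using this

end Raise
end PACC1

namespace PACC1
open MvPolynomial
set_option linter.unusedSectionVars false

section LeSec
variable {K : Type} [Field K] {N : ℕ}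

/-- the contact locus `a` has codimension at most `x` -/
def Le (a : MvPolynomial (Fin N) K → ℕ) (x : ℝ) : Prop :=
  ∃ M : ℕ, (∀ s, a s ≤ M) ∧ ∃ D : ℕ, ((N * M : ℕ) : ℝ) ≤ D + x ∧ Ind (IM M a) D

lemma Le.nonneg {a : MvPolynomial (Fin N) K → ℕ} {x : ℝ} (h : Le a x) : 0 ≤ x := by
  obtain ⟨M, _, D, h1, h2⟩ := h
  have := Ind_le_card _ _ h2
  simp only [Fintype.card_prod, Fintype.card_fin] at this
  have : (D : ℝ) ≤ ((N * M : ℕ) : ℝ) := by exact_mod_cast this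
  linarith

lemma Le.raise {a : MvPolynomial (Fin N) K → ℕ} {x : ℝ} (h : Le a x) (r : ℕ) :
    ∃ M : ℕ, (∀ s, a s ≤ M) ∧ r ≤ M ∧ ∃ D : ℕ, ((N * M : ℕ) : ℝ) ≤ D + x ∧ Ind (IM M a) D := by
  obtain ⟨M, h0, D, h1, h2⟩ := h
  refine ⟨M + r, fun s => (h0 s).trans (by omega), by omega, D + N * r, ?_,
    Ind_raise M r a h0 D h2⟩
  push_cast at *
  linarith

lemma Le.add [Infinite K] {a b : MvPolynomial (Fin N) K → ℕ} {x y : ℝ} (ha : Le a x)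
    (hb : Le b y) : Le (a + b) (x + y) := by
  obtain ⟨M1, h0, D1, h1, h2⟩ := ha
  obtain ⟨M2, h0', D2, h1', h2'⟩ := hb
  have r1 := Ind_raise M1 M2 a h0 D1 h2
  have r2 := Ind_raise M2 M1 b h0' D2 h2'
  rw [add_comm M2 M1] at r2
  refine ⟨M1 + M2, fun s => add_le_add (h0 s) (h0' s), D1 + D2, ?_,
    Ind_fusion (M1 + M2) a b _ _ _ r1 r2 (by ring)⟩
  push_cast at *
  linarith

lemma Le.nsmul [Infinite K] {a : MvPolynomial (Fin N) K → ℕ} {x : ℝ} (ha : Le a x) (m : ℕ)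
    (hm : 1 ≤ m) : Le (m • a) (m * x) := by
  induction m, hm using Nat.le_induction with
  | base => simpa using ha
  | succ m hm ih =>
    have := ih.add ha
    rw [succ_nsmul]
    push_cast
    rwa [add_mul, one_mul]

open Classical in
/-- add the condition `r` at `s` -/
noncomputable def upd (a : MvPolynomial (Fin N) K → ℕ) (s : MvPolynomial (Fin N) K) (r : ℕ) :
    MvPolynomial (Fin N) K → ℕ := fun t => if t = s then max (a t) r else a t

lemma le_upd (a : MvPolynomial (Fin N) K → ℕ) (s : MvPolynomial (Fin N) K) (r : ℕ) (t) :
    a t ≤ upd a s r t := by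
  unfold upd; split_ifs <;> simp

lemma upd_self (a : MvPolynomial (Fin N) K → ℕ) (s : MvPolynomial (Fin N) K) (r : ℕ) :
    r ≤ upd a s r s := by
  unfold upd; simp

lemma upd_le (a : MvPolynomial (Fin N) K → ℕ) (s : MvPolynomial (Fin N) K) (r M : ℕ)
    (ha : ∀ s, a s ≤ M) (hr : r ≤ M) (t) : upd a s r t ≤ M := by
  unfold upd; split_ifs
  · exact max_le (ha t) hr
  · exact ha t

lemma IM_upd_le (M : ℕ) (a : MvPolynomial (Fin N) K → ℕ) (s : MvPolynomial (Fin N) K) (r : ℕ)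
    (p : Ideal (MvPolynomial (Fin N × Fin M) K)) (h1 : IM M a ≤ p)
    (h2 : ∀ j < r, (aeval (gx K N M) s).coeff j ∈ p) : IM M (upd a s r) ≤ p := by
  rw [IM, Ideal.span_le]
  rintro _ ⟨t, j, ht, hj, rfl⟩
  by_cases hja : j < a t
  · exact h1 (Ideal.subset_span ⟨t, j, ht, hja, rfl⟩)
  · unfold upd at hj
    split_ifs at hj with h
    · subst h
      refine h2 j ?_
      rcases lt_max_iff.1 hj with h | h
      · exact absurd h hja
      · exact h
    · exact absurd hj hja

lemma Le.upd {a : MvPolynomial (Fin N) K → ℕ} {x : ℝ} (h : Le a x) (s : MvPolynomial (Fin N) K)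
    (r : ℕ) (hs : ∀ M, ∀ j < r, (aeval (gx K N M) s).coeff j ∈ IM M a) : Le (upd a s r) x := by
  obtain ⟨M, h0, hr, D, h1, h2⟩ := h.raise r
  exact ⟨M, upd_le a s r M h0 hr, D, h1, h2.anti (IM_upd_le M a s r _ le_rfl (hs M))⟩

lemma coeff_prime {R : Type} [CommRing R] (p : Ideal R) [p.IsPrime] (f g : Polynomial R) (r : ℕ)
    (h : ∀ j < 2 * r, (f * g).coeff j ∈ p) :
    (∀ j < r, f.coeff j ∈ p) ∨ (∀ j < r, g.coeff j ∈ p) := by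
  classical
  by_contra hcon
  push Not at hcon
  obtain ⟨h1, h2⟩ := hcon
  have s1 := Nat.find_spec h1
  have m1 : ∀ j < Nat.find h1, f.coeff j ∈ p := fun j hj => by
    have := Nat.find_min h1 hj
    push Not at this
    exact this (hj.trans s1.1)
  have s2 := Nat.find_spec h2
  have m2 : ∀ j < Nat.find h2, g.coeff j ∈ p := fun j hj => by
    have := Nat.find_min h2 hj
    push Not at this
    exact this (hj.trans s2.1)
  set u := Nat.find h1
  set v := Nat.find h2
  have h3 := h (u + v) (by omega)
  rw [Polynomial.coeff_mul, ← Finset.add_sum_erase _ _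
    (show (u, v) ∈ Finset.HasAntidiagonal.antidiagonal (u + v) by simp)] at h3
  have h4 : ∑ x ∈ (Finset.HasAntidiagonal.antidiagonal (u + v)).erase (u, v), f.coeff x.1 * g.coeff x.2 ∈ p := by
    refine sum_mem fun x hx => ?_
    rw [Finset.mem_erase, Finset.HasAntidiagonal.mem_antidiagonal] at hx
    rcases lt_trichotomy x.1 u with h | h | h
    · exact p.mul_mem_right _ (m1 _ h)
    · exact absurd (Prod.ext h (show x.2 = v by omega)) hx.1
    · exact p.mul_mem_left _ (m2 _ (by omega))
  have h5 := (p.add_mem_iff_left h4).1 h3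
  rcases Ideal.IsPrime.mem_or_mem ‹_› h5 with h | h
  · exact s1.2 h
  · exact s2.2 h

lemma Le.prime {a : MvPolynomial (Fin N) K → ℕ} {x : ℝ} (h : Le a x) (s t : MvPolynomial (Fin N) K)
    (r : ℕ) (hst : 2 * r ≤ a (s * t)) (hh : ∃ q, (s * t).IsHomogeneous q) :
    Le (PACC1.upd a s r) x ∨ Le (PACC1.upd a t r) x := by
  obtain ⟨M, h0, hr, D, h1, h2⟩ := h.raise r
  rcases h2.union (I1 := IM M (PACC1.upd a s r)) (I2 := IM M (PACC1.upd a t r)) (by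
    intro p hp hle
    have h4 : ∀ j < 2 * r, (aeval (gx K N M) s * aeval (gx K N M) t).coeff j ∈ p := by
      intro j hj
      rw [← map_mul]
      exact hle (Ideal.subset_span ⟨s * t, j, hh, by omega, rfl⟩)
    rcases coeff_prime p _ _ r h4 with h | h
    · exact Or.inl (IM_upd_le M a s r _ hle h)
    · exact Or.inr (IM_upd_le M a t r _ hle h)) with h | h
  · exact Or.inl ⟨M, upd_le a s r M h0 hr, D, h1, h⟩
  · exact Or.inr ⟨M, upd_le a t r M h0 hr, D, h1, h⟩

lemma Le.anti {a b : MvPolynomial (Fin N) K → ℕ} {x y : ℝ} (h : Le a x) (hb : ∀ s, b s ≤ a s)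
    (hxy : x ≤ y) : Le b y := by
  obtain ⟨M, h0, D, h1, h2⟩ := h
  exact ⟨M, fun s => (hb s).trans (h0 s), D, by linarith, h2.anti (IM_mono M hb)⟩

lemma Le.strip {a b : MvPolynomial (Fin N) K → ℕ} {x : ℝ} (h : Le a x) (R : ℕ)
    (hX : ∀ i, R ≤ a (X i))
    (hb : ∀ s, 0 < b s → ∃ q, 1 ≤ q ∧ s.IsHomogeneous q ∧ b s + R * q ≤ a s) :
    Le b (x - N * R) := by
  obtain ⟨M, h0, hr, D, h1, h2⟩ := h.raise R
  obtain ⟨M', rfl⟩ := Nat.exists_eq_add_of_le hr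
  refine ⟨M', fun s => ?_, D, ?_, Ind_strip R M' a b D hX (fun s hs => ?_) h2⟩
  · rcases Nat.eq_zero_or_pos (b s) with h | h
    · omega
    · obtain ⟨q, hq1, hq, hle⟩ := hb s h
      have := h0 s
      have : R * 1 ≤ R * q := Nat.mul_le_mul_left _ hq1
      omega
  · push_cast at *
    linarith
  · obtain ⟨q, _, hq, hle⟩ := hb s hs
    exact ⟨q, hq, hle⟩

lemma Le.galois {a : MvPolynomial (Fin N) K → ℕ} {x : ℝ} (h : Le a x) (g : K ≃+* K) :
    Le (fun s => a (MvPolynomial.map (g : K →+* K) s)) x := by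
  obtain ⟨M, h0, D, h1, y, hy⟩ := h
  refine ⟨M, fun s => h0 _, D, h1, ?_⟩
  have key : ∀ s : MvPolynomial (Fin N) K,
      (aeval (gx K N M) s).map (MvPolynomial.map (g : K →+* K)) =
      aeval (gx K N M) (MvPolynomial.map (g : K →+* K) s) := by
    intro s
    have hx : ∀ i, (gx K N M i).map (MvPolynomial.map (g : K →+* K)) = gx K N M i := by
      intro i
      ext1 j
      rw [Polynomial.coeff_map, gx_coeff]
      split_ifs <;> simp
    induction s using MvPolynomial.induction_on with
    | C c =>
      rw [MvPolynomial.map_C]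
      simp only [MvPolynomial.algHom_C]
      have e : ∀ c : K, algebraMap K (Polynomial (MvPolynomial (Fin N × Fin M) K)) c =
        Polynomial.C (C c) := fun c => rfl
      rw [e, e, Polynomial.map_C, MvPolynomial.map_C]
    | add p q hp hq => rw [map_add, Polynomial.map_add, hp, hq, map_add, map_add]
    | mul_X p i hp => rw [map_mul, Polynomial.map_mul, hp, aeval_X, hx, map_mul, map_mul, map_X,
        aeval_X]
  have hle : IM M (fun s => a (MvPolynomial.map (g : K →+* K) s)) ≤
      (IM M a).comap (MvPolynomial.map (g : K →+* K)) := by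
    rw [IM, Ideal.span_le]
    rintro _ ⟨s, j, ⟨q, hs⟩, hj, rfl⟩
    rw [SetLike.mem_coe, Ideal.mem_comap, ← Polynomial.coeff_map, key]
    exact Ideal.subset_span ⟨_, j, ⟨q, hs.map _⟩, hj, rfl⟩
  refine ⟨fun t => MvPolynomial.map (g.symm : K →+* K) (y t), fun p hp => ?_⟩
  have h3 := hle hp
  rw [Ideal.mem_comap] at h3
  have h4 : ∀ p : MvPolynomial (Fin D) K, MvPolynomial.map (g : K →+* K)
      (aeval (fun t => MvPolynomial.map (g.symm : K →+* K) (y t)) p) =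
      aeval y (MvPolynomial.map (g : K →+* K) p) := by
    intro p
    induction p using MvPolynomial.induction_on with
    | C c => simp [MvPolynomial.algebraMap_eq]
    | add p q hp hq => rw [map_add, map_add, hp, hq, map_add, map_add]
    | mul_X p i hp =>
      rw [map_mul, map_mul, hp, aeval_X, map_mul, map_mul, map_X, aeval_X, MvPolynomial.map_map]
      congr 1
      have : (g : K →+* K).comp (g.symm : K →+* K) = RingHom.id K := by ext; simp
      rw [this, MvPolynomial.map_id]
  rw [h4] at h3
  have h5 := hy _ h3
  exact map_injective _ g.injective (h5.trans (map_zero _).symm)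

lemma Le.base {r : ℕ} (hN : 1 ≤ N) (f : Fin r → MvPolynomial (Fin N) K) (d : Fin r → ℕ)
    (hf : ∀ i, (f i).IsHomogeneous (d i)) (hd : ∀ i, 1 ≤ d i) (F : MvPolynomial (Fin N) K → ℕ)
    (hF : ∀ s, 0 < F s → ∃ i, s = f i ∧ F s = d i) :
    Le F (∑ i, d i : ℕ) := by
  let M := ∑ i, d i
  have hM : M ≤ N * M := Nat.le_mul_of_pos_left _ hN
  refine ⟨M, fun s => ?_, N * M - M, ?_, ?_⟩
  · rcases Nat.eq_zero_or_pos (F s) with h | h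
    · omega
    · obtain ⟨i, _, h2⟩ := hF s h
      rw [h2]
      exact Finset.single_le_sum (f := d) (fun _ _ => Nat.zero_le _) (Finset.mem_univ i)
  · have : N * M ≤ (N * M - M) + M := by omega
    exact_mod_cast this
  · refine Ind.anti (I' := Ideal.span (Set.range fun t : (Σ i, Fin (d i)) =>
      (aeval (gx K N M) (f t.1)).coeff t.2)) ?_ ?_
    · rw [IM]
      refine Ideal.span_mono ?_
      rintro _ ⟨s, j, hs, hj, rfl⟩
      obtain ⟨i, rfl, h2⟩ := hF s (by omega)
      exact ⟨⟨i, ⟨j, by omega⟩⟩, rfl⟩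
    · refine Ind_of_card _ (fun t => d t.1) (fun t => HP.aeval (HP_gx M) (hf t.1) _)
        (fun t => hd t.1) _ ?_
      simp only [Fintype.card_sigma, Fintype.card_fin, Fintype.card_prod]
      change N * M - M + M = _
      omega

end LeSec
end PACC1

namespace PACC1
open MvPolynomial
set_option linter.unusedSectionVars false

section PrimeSec
variable {K : Type} [Field K] [Infinite K] {N : ℕ}

/-- admissible values -/
def Vals (F : MvPolynomial (Fin N) K → ℕ) : Set ℝ :=
  {v | ∃ (Q : ℕ) (a : MvPolynomial (Fin N) K → ℕ) (x : ℝ), 1 ≤ Q ∧ (∀ s, Q * F s ≤ a s) ∧ Le a x ∧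
    v = x / Q}

/-- the threshold -/
noncomputable def thr (F : MvPolynomial (Fin N) K → ℕ) : ℝ := sInf (Vals F)

lemma thr_le (F : MvPolynomial (Fin N) K → ℕ) (Q : ℕ) (a : MvPolynomial (Fin N) K → ℕ) (x : ℝ)
    (h : ∀ s, Q * F s ≤ a s) (hx : Le a x) : thr F * Q ≤ x := by
  rcases Nat.eq_zero_or_pos Q with h0 | h0
  · subst h0; simpa using hx.nonneg
  · have : thr F ≤ x / Q := by
      refine csInf_le ⟨0, ?_⟩ ⟨Q, a, x, h0, h, hx, rfl⟩
      rintro _ ⟨Q, a, x, _, _, h3, rfl⟩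
      exact div_nonneg h3.nonneg (Nat.cast_nonneg _)
    rwa [le_div_iff₀ (by exact_mod_cast h0)] at this

/-- sets of polynomials vanishing on the limit -/
def Good (F : MvPolynomial (Fin N) K → ℕ) (S : Set (MvPolynomial (Fin N) K)) : Prop :=
  ∃ η : ℝ, 0 < η ∧ ∀ ε : ℝ, 0 < ε → ∃ (Q : ℕ) (a : MvPolynomial (Fin N) K → ℕ) (x : ℝ),
    1 ≤ Q ∧ (∀ s, Q * F s ≤ a s) ∧ Le a x ∧ x ≤ (thr F + ε) * Q ∧ ∀ s ∈ S, η * Q ≤ a s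

variable {F : MvPolynomial (Fin N) K → ℕ}

lemma Good.union {S T : Set (MvPolynomial (Fin N) K)} (hS : Good F S) (hT : Good F T) :
    Good F (S ∪ T) := by
  obtain ⟨η1, p1, h1⟩ := hS
  obtain ⟨η2, p2, h2⟩ := hT
  refine ⟨min η1 η2 / 2, by positivity, fun ε hε => ?_⟩
  obtain ⟨Q1, a1, x1, q1, f1, l1, e1, s1⟩ := h1 ε hε
  obtain ⟨Q2, a2, x2, q2, f2, l2, e2, s2⟩ := h2 ε hε
  refine ⟨2 * (Q1 * Q2), Q2 • a1 + Q1 • a2, Q2 * x1 + Q1 * x2, by nlinarith, ?_,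
    (l1.nsmul Q2 q2).add (l2.nsmul Q1 q1), ?_, ?_⟩
  · intro s
    simp only [Pi.add_apply, Pi.smul_apply, smul_eq_mul]
    have := Nat.mul_le_mul_left Q2 (f1 s)
    have := Nat.mul_le_mul_left Q1 (f2 s)
    nlinarith
  · have := mul_le_mul_of_nonneg_left e1 (Nat.cast_nonneg (α := ℝ) Q2)
    have := mul_le_mul_of_nonneg_left e2 (Nat.cast_nonneg (α := ℝ) Q1)
    push_cast
    linarith
  · have hq : (0 : ℝ) ≤ Q1 * Q2 := by positivity
    rintro s (hs | hs)
    · have h := mul_le_mul_of_nonneg_left (s1 s hs) (Nat.cast_nonneg (α := ℝ) Q2)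
      have h' := mul_le_mul_of_nonneg_right (min_le_left η1 η2) hq
      have h3 : (0 : ℝ) ≤ Q1 * a2 s := by positivity
      simp only [Pi.add_apply, Pi.smul_apply, smul_eq_mul]
      push_cast
      linarith
    · have h := mul_le_mul_of_nonneg_left (s2 s hs) (Nat.cast_nonneg (α := ℝ) Q1)
      have h' := mul_le_mul_of_nonneg_right (min_le_right η1 η2) hq
      have h3 : (0 : ℝ) ≤ Q2 * a1 s := by positivity
      simp only [Pi.add_apply, Pi.smul_apply, smul_eq_mul]
      push_cast
      linarith

lemma Good.mono {S T : Set (MvPolynomial (Fin N) K)} (hS : Good F S) (h : T ⊆ S) : Good F T := by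
  obtain ⟨η1, p1, h1⟩ := hS
  refine ⟨η1, p1, fun ε hε => ?_⟩
  obtain ⟨Q1, a1, x1, q1, f1, l1, e1, s1⟩ := h1 ε hε
  exact ⟨Q1, a1, x1, q1, f1, l1, e1, fun s hs => s1 s (h hs)⟩

lemma Good.of_coeff {S : Set (MvPolynomial (Fin N) K)} (hS : Good F S) (t : MvPolynomial (Fin N) K)
    (h : ∀ (a : MvPolynomial (Fin N) K → ℕ) (r : ℕ), (∀ s ∈ S, r ≤ a s) →
      ∀ M, ∀ j < r, (aeval (gx K N M) t).coeff j ∈ IM M a) : Good F {t} := by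
  obtain ⟨η, p1, h1⟩ := hS
  refine ⟨η, p1, fun ε hε => ?_⟩
  obtain ⟨Q, a, x, q1, f1, l1, e1, s1⟩ := h1 ε hε
  refine ⟨Q, PACC1.upd a t ⌈η * Q⌉₊, x, q1, fun s => (f1 s).trans (le_upd _ _ _ _),
    l1.upd t _ (h a _ fun s hs => Nat.ceil_le.2 (s1 s hs)), e1, ?_⟩
  rintro _ rfl
  exact Nat.ceil_le.1 (upd_self _ _ _)

lemma Good.empty (hne : ∃ x, Le F x) : Good F ∅ := by
  refine ⟨1, one_pos, fun ε hε => ?_⟩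
  obtain ⟨x0, hx0⟩ := hne
  have hlt : sInf (Vals F) < thr F + ε := by
    change thr F < _
    linarith
  obtain ⟨_, ⟨Q, a, x, hQ, h1, h2, rfl⟩, h3⟩ := exists_lt_of_csInf_lt
    (show (Vals F).Nonempty from ⟨_, ⟨1, F, x0, le_rfl, fun s => by simp, hx0, rfl⟩⟩) hlt
  refine ⟨Q, a, x, hQ, h1, h2, ?_, by simp⟩
  rw [div_lt_iff₀ (by exact_mod_cast hQ)] at h3
  exact h3.le

lemma Good.of_F (hne : ∃ x, Le F x) (s : MvPolynomial (Fin N) K) (hs : 0 < F s) : Good F {s} := by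
  obtain ⟨η, p1, h1⟩ := Good.empty hne
  refine ⟨1, one_pos, fun ε hε => ?_⟩
  obtain ⟨Q, a, x, q1, f1, l1, e1, s1⟩ := h1 ε hε
  refine ⟨Q, a, x, q1, f1, l1, e1, ?_⟩
  rintro _ rfl
  rw [one_mul]
  have := (Nat.le_mul_of_pos_right Q hs).trans (f1 _)
  exact_mod_cast this

lemma Good.zero (hne : ∃ x, Le F x) : Good F {0} :=
  (Good.empty hne).of_coeff 0 (fun a r _ M j _ => by simp)

lemma Good.add {s t : MvPolynomial (Fin N) K} {q : ℕ} (hs : s.IsHomogeneous q)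
    (ht : t.IsHomogeneous q) (h1 : Good F {s}) (h2 : Good F {t}) : Good F {s + t} := by
  refine (h1.union h2).of_coeff _ fun a r h M j hj => ?_
  rw [map_add, Polynomial.coeff_add]
  exact add_mem (Ideal.subset_span ⟨s, j, ⟨q, hs⟩, hj.trans_le (h s (by simp)), rfl⟩)
    (Ideal.subset_span ⟨t, j, ⟨q, ht⟩, hj.trans_le (h t (by simp)), rfl⟩)

lemma Good.mul {s : MvPolynomial (Fin N) K} {q : ℕ} (hs : s.IsHomogeneous q)
    (h1 : Good F {s}) (u : MvPolynomial (Fin N) K) : Good F {u * s} := by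
  refine h1.of_coeff _ fun a r h M j hj => ?_
  rw [map_mul, Polynomial.coeff_mul]
  refine sum_mem fun x hx => Ideal.mul_mem_left _ _ ?_
  rw [Finset.HasAntidiagonal.mem_antidiagonal] at hx
  exact Ideal.subset_span ⟨s, x.2, ⟨q, hs⟩,
    lt_of_le_of_lt (by omega) (hj.trans_le (h s (by simp))), rfl⟩

lemma Good.prime {s t : MvPolynomial (Fin N) K} {q : ℕ} (hst : (s * t).IsHomogeneous q)
    (h : Good F {s * t}) : Good F {s} ∨ Good F {t} := by
  obtain ⟨η, p1, h1⟩ := h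
  by_contra hcon
  rw [not_or] at hcon
  have n1 := hcon.1
  have n2 := hcon.2
  unfold Good at n1 n2
  push Not at n1 n2
  obtain ⟨ε1, hε1, k1⟩ := n1 (η / 2) (by positivity)
  obtain ⟨ε2, hε2, k2⟩ := n2 (η / 2) (by positivity)
  obtain ⟨Q, a, x, q1, f1, l1, e1, s1⟩ := h1 (min ε1 ε2) (lt_min hε1 hε2)
  have l2 := l1.nsmul 2 (by norm_num)
  have hs := s1 _ rfl
  have hF : ∀ u, 2 * Q * F u ≤ (2 • a) u := fun u => by
    have := f1 u
    simp only [Pi.smul_apply, smul_eq_mul]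
    nlinarith
  have hQ : (0 : ℝ) ≤ Q := Nat.cast_nonneg _
  have hx : ∀ ε, min ε1 ε2 ≤ ε → ((2 : ℕ) : ℝ) * x ≤ (thr F + ε) * ((2 * Q : ℕ) : ℝ) := by
    intro ε hε
    have := mul_le_mul_of_nonneg_right hε hQ
    push_cast
    linarith
  rcases l2.prime s t (a (s * t)) (by simp) ⟨q, hst⟩ with h | h
  · obtain ⟨u, hu, hlt⟩ := k1 (2 * Q) _ _ (by omega) (fun u => (hF u).trans (le_upd _ _ _ _)) h
      (hx _ (min_le_left _ _))
    have hu : u = s := hu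
    subst hu
    have h5 : ((a (u * t) : ℕ) : ℝ) ≤ (PACC1.upd (2 • a) u (a (u * t)) u : ℕ) := by
      exact_mod_cast upd_self _ _ _
    push_cast at hlt
    linarith
  · obtain ⟨u, hu, hlt⟩ := k2 (2 * Q) _ _ (by omega) (fun u => (hF u).trans (le_upd _ _ _ _)) h
      (hx _ (min_le_right _ _))
    have hu : u = t := hu
    subst hu
    have h5 : ((a (s * u) : ℕ) : ℝ) ≤ (PACC1.upd (2 • a) u (a (s * u)) u : ℕ) := by
      exact_mod_cast upd_self _ _ _
    push_cast at hlt
    linarith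

lemma Good.biUnion (hne : ∃ x, Le F x) (s : Finset (MvPolynomial (Fin N) K))
    (h : ∀ t ∈ s, Good F {t}) : Good F (s : Set (MvPolynomial (Fin N) K)) := by
  classical
  induction s using Finset.induction_on with
  | empty => simpa using Good.empty hne
  | insert a s ha ih =>
    rw [Finset.coe_insert, Set.insert_eq]
    exact (h a (by simp)).union (ih fun t ht => h t (by simp [ht]))

lemma not_all_X (hne : ∃ x, Le F x) (hF : ∀ s, 0 < F s → s.IsHomogeneous (F s))
    (hc : thr F < N) : ∃ i : Fin N, ¬ Good F {X i} := by
  classical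
  by_contra hcon
  push Not at hcon
  obtain ⟨η, p1, h1⟩ := Good.biUnion hne (Finset.univ.image (X : Fin N → MvPolynomial (Fin N) K))
    (by intro t ht; simp at ht; obtain ⟨i, rfl⟩ := ht; exact hcon i)
  have hm : 0 < min 1 η := by positivity
  obtain ⟨Q, a, x, q1, f1, l1, e1, s1⟩ := h1 ((N - thr F) * min 1 η / 2) (by
    have := sub_pos.2 hc
    positivity)
  set R := min Q ⌈η * Q⌉₊ with hR
  have hRQ : R ≤ Q := min_le_left _ _
  have h2 : Le (fun s => (Q - R) * F s) (x - N * R) := by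
    refine l1.strip R (fun i => ?_) (fun s hs => ?_)
    · exact (min_le_right _ _).trans (Nat.ceil_le.2 (s1 _ (by simp)))
    · have h0 : 0 < F s := Nat.pos_of_mul_pos_left hs
      refine ⟨F s, h0, hF s h0, ?_⟩
      rw [← add_mul, Nat.sub_add_cancel hRQ]
      exact f1 s
  have h3 := thr_le F (Q - R) _ _ (fun s => le_rfl) h2
  rw [Nat.cast_sub hRQ] at h3
  have hQ : (1 : ℝ) ≤ Q := by exact_mod_cast q1
  have h4 : min 1 η * Q ≤ R := by
    rw [hR, Nat.cast_min]
    refine le_min ?_ ?_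
    · exact (mul_le_mul_of_nonneg_right (min_le_left _ _) (by linarith)).trans (one_mul _).le
    · exact (mul_le_mul_of_nonneg_right (min_le_right _ _) (by linarith)).trans (Nat.le_ceil _)
  have h5 : (N - thr F) * (min 1 η * Q) ≤ (N - thr F) * R :=
    mul_le_mul_of_nonneg_left h4 (by linarith)
  have h6 : 0 < (N - thr F) * (min 1 η * Q) := by
    have := sub_pos.2 hc
    positivity
  linarith

lemma Good.galois (g : K ≃+* K) (hg : ∀ s, F (MvPolynomial.map (g : K →+* K) s) = F s)
    {s : MvPolynomial (Fin N) K}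
    (h : Good F {MvPolynomial.map (g : K →+* K) s}) : Good F {s} := by
  obtain ⟨η, p1, h1⟩ := h
  refine ⟨η, p1, fun ε hε => ?_⟩
  obtain ⟨Q, a, x, q1, f1, l1, e1, s1⟩ := h1 ε hε
  refine ⟨Q, _, x, q1, fun s => ?_, l1.galois g, e1, ?_⟩
  · have := f1 (MvPolynomial.map (g : K →+* K) s)
    rwa [hg] at this
  · rintro _ rfl
    exact s1 _ rfl

/-- the limit ideal -/
noncomputable def PI (F : MvPolynomial (Fin N) K → ℕ) (hne : ∃ x, Le F x) :
    Ideal (MvPolynomial (Fin N) K) where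
  carrier := {s | ∀ n, Good F {homogeneousComponent n s}}
  zero_mem' := fun n => by
    rw [map_zero]
    exact Good.zero hne
  add_mem' := fun {s t} hs ht n => by
    rw [map_add]
    exact Good.add (homogeneousComponent_isHomogeneous n s) (homogeneousComponent_isHomogeneous n t)
      (hs n) (ht n)
  smul_mem' := fun c s hs n => by
    have hsum : ∀ (A : Finset ℕ) (w : ℕ → MvPolynomial (Fin N) K),
        (∀ i ∈ A, (w i).IsHomogeneous n ∧ Good F {w i}) →
        (∑ i ∈ A, w i).IsHomogeneous n ∧ Good F {∑ i ∈ A, w i} := by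
      classical
      intro A w
      induction A using Finset.induction_on with
      | empty => intro _; simpa using ⟨isHomogeneous_zero _ _ _, Good.zero hne⟩
      | insert b A hb ih =>
        intro h
        rw [Finset.sum_insert hb]
        have h1 := h b (by simp)
        have h2 := ih fun i hi => h i (by simp [hi])
        exact ⟨h1.1.add h2.1, Good.add h1.1 h2.1 h1.2 h2.2⟩
    have : homogeneousComponent n (c • s) = ∑ i ∈ Finset.range (s.totalDegree + 1),
        homogeneousComponent n (c * homogeneousComponent i s) := by
      conv_lhs => rw [smul_eq_mul, ← sum_homogeneousComponent s, Finset.mul_sum, map_sum]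
    rw [this]
    refine (hsum _ _ fun i _ => ⟨homogeneousComponent_isHomogeneous _ _, ?_⟩).2
    obtain ⟨w', h1, _⟩ := homogeneousComponent_mul_mem (homogeneousComponent i s) c i
      (homogeneousComponent_isHomogeneous _ _) n
    rw [h1]
    exact (hs i).mul (homogeneousComponent_isHomogeneous _ _) w'

lemma mem_PI (hne : ∃ x, Le F x) {s : MvPolynomial (Fin N) K} {q : ℕ} (hs : s.IsHomogeneous q) :
    s ∈ PI F hne ↔ Good F {s} := by
  have h : ∀ n, homogeneousComponent n s = if n = q then s else 0 := fun n =>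
    homogeneousComponent_of_mem hs
  constructor
  · intro h1
    have := h1 q
    rwa [h, if_pos rfl] at this
  · intro h1 n
    rw [h]
    split_ifs
    · exact h1
    · exact Good.zero hne

lemma PI_prime (hne : ∃ x, Le F x) (htop : PI F hne ≠ ⊤) : (PI F hne).IsPrime := by
  let _ : GradedAlgebra (homogeneousSubmodule (Fin N) K) := gradedAlgebra
  have hh : (PI F hne).IsHomogeneous (homogeneousSubmodule (Fin N) K) := by
    intro n s hs
    have e : (DirectSum.decompose (homogeneousSubmodule (Fin N) K) s n : MvPolynomial (Fin N) K) =
      homogeneousComponent n s := decomposition.decompose'_apply s n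
    rw [e, mem_PI hne (homogeneousComponent_isHomogeneous _ _)]
    exact hs n
  refine hh.isPrime_of_homogeneous_mem_or_mem htop ?_
  rintro s t ⟨q, hq⟩ ⟨r, hr⟩ hst
  rw [mem_PI hne (hq.mul hr)] at hst
  rw [mem_PI hne hq, mem_PI hne hr]
  exact hst.prime (hq.mul hr)

theorem exists_prime {r : ℕ} (f : Fin r → MvPolynomial (Fin N) K) (d : Fin r → ℕ)
    (hf : ∀ i, (f i).IsHomogeneous (d i)) (hd : ∀ i, 1 ≤ d i) (hN : ∑ i, d i < N) :
    ∃ P : Ideal (MvPolynomial (Fin N) K), P.IsPrime ∧ (∀ i, f i ∈ P) ∧ (∃ i, X i ∉ P) ∧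
      ∀ g : K ≃+* K, (∀ i, MvPolynomial.map (g : K →+* K) (f i) = f i) →
        ∀ s, MvPolynomial.map (g : K →+* K) s ∈ P → s ∈ P := by
  classical
  let F : MvPolynomial (Fin N) K → ℕ := fun s => if s ∈ Set.range f then s.totalDegree else 0
  have hF : ∀ s, 0 < F s → ∃ i, s = f i ∧ F s = d i := by
    intro s hs
    by_cases h : s ∈ Set.range f
    · have e : F s = s.totalDegree := if_pos h
      obtain ⟨i, rfl⟩ := h
      refine ⟨i, rfl, ?_⟩
      rw [e] at hs ⊢
      refine (hf i).totalDegree ?_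
      intro h0
      rw [h0] at hs
      simp at hs
    · exact absurd hs (by
        have e : F s = 0 := if_neg h
        omega)
  have hbase := Le.base (by omega) f d hf hd F hF
  have hne : ∃ x, Le F x := ⟨_, hbase⟩
  have hthr : thr F < N := by
    have h1 := thr_le F 1 F _ (fun s => by simp) hbase
    have h2 : ((∑ i, d i : ℕ) : ℝ) < N := by exact_mod_cast hN
    rw [Nat.cast_one, mul_one] at h1
    exact h1.trans_lt h2
  obtain ⟨i, hi⟩ := not_all_X hne (fun s hs => by
    obtain ⟨i, rfl, h2⟩ := hF s hs
    rw [h2]; exact hf i) hthr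
  have hX : X i ∉ PI F hne := by rwa [mem_PI hne (isHomogeneous_X _ _)]
  refine ⟨PI F hne, PI_prime hne fun h => hX (by rw [h]; trivial), fun l => ?_, ⟨i, hX⟩, ?_⟩
  · rw [mem_PI hne (hf l)]
    by_cases h0 : f l = 0
    · rw [h0]; exact Good.zero hne
    · refine Good.of_F hne _ ?_
      have : F (f l) = (f l).totalDegree := if_pos ⟨l, rfl⟩
      rw [this, (hf l).totalDegree h0]
      exact hd l
  · intro g hg s hs n
    refine Good.galois g (fun s => ?_) ?_
    · have e : MvPolynomial.map (g : K →+* K) s ∈ Set.range f ↔ s ∈ Set.range f := by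
        constructor
        · rintro ⟨l, hl⟩
          exact ⟨l, map_injective _ g.injective ((hg l).trans hl)⟩
        · rintro ⟨l, rfl⟩
          exact ⟨l, (hg l).symm⟩
      simp only [F, e]
      congr 1
      rw [totalDegree, totalDegree, support_map_of_injective _ g.injective]
    · have e : MvPolynomial.map (g : K →+* K) (homogeneousComponent n s) =
          homogeneousComponent n (MvPolynomial.map (g : K →+* K) s) := by
        ext m
        rw [coeff_map, coeff_homogeneousComponent, coeff_homogeneousComponent, coeff_map]
        split_ifs <;> simp
      rw [e]
      exact hs n

end PrimeSec
end PACC1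

namespace PACC1
open MvPolynomial
set_option linter.unusedSectionVars false

section Descent
variable {k K B : Type} [Field k] [Field K] [Algebra k K] [IsGalois k K] [Field B] [Algebra K B]
  [Algebra k B] [IsScalarTower k K B]

lemma artin {ι : Type} (b : ι → B)
    (hb : ∀ g : K ≃ₐ[k] K, ∃ G : B →+* B, (∀ c, G (algebraMap K B c) = algebraMap K B (g c)) ∧
      ∀ i, G (b i) = b i)
    (hlin : LinearIndependent k b) : LinearIndependent K b := by
  classical
  rw [linearIndependent_iff] at *
  suffices H : ∀ n, ∀ c : ι →₀ K, c.support.card = n → Finsupp.linearCombination K b c = 0 → c = 0 by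
    exact fun c hc => H _ c rfl hc
  intro n
  induction n using Nat.strong_induction_on with
  | _ n ih =>
  intro c hcn hc
  by_contra hne
  obtain ⟨i0, hi0⟩ := Finsupp.ne_iff.1 hne
  simp only [Finsupp.coe_zero, Pi.zero_apply] at hi0
  let c' : ι →₀ K := (c i0)⁻¹ • c
  have hc' : Finsupp.linearCombination K b c' = 0 := by rw [map_smul, hc, smul_zero]
  have hc'0 : c' i0 = 1 := by simp [c', hi0]
  have hsupp : c'.support ⊆ c.support := Finsupp.support_smul
  have hfix : ∀ g : K ≃ₐ[k] K, ∀ i, g (c' i) = c' i := by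
    intro g
    obtain ⟨G, hG1, hG2⟩ := hb g
    let cg : ι →₀ K := c'.mapRange g (map_zero g)
    have hcg : Finsupp.linearCombination K b cg = 0 := by
      have h1 := congrArg G hc'
      rw [map_zero, Finsupp.linearCombination_apply, Finsupp.sum, map_sum] at h1
      rw [Finsupp.linearCombination_apply, Finsupp.sum_mapRange_index (by simp), Finsupp.sum,
        ← h1]
      refine Finset.sum_congr rfl fun i _ => ?_
      rw [Algebra.smul_def, Algebra.smul_def, map_mul, hG1, hG2]
    have hdiff := ih (cg - c').support.card ?_ (cg - c') rfl (by rw [map_sub, hcg, hc', sub_zero])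
    · intro i
      have := congrArg (fun h => h i) (sub_eq_zero.1 hdiff)
      simpa [cg] using this
    · rw [← hcn]
      refine Finset.card_lt_card ((Finset.ssubset_iff_of_subset ?_).2 ⟨i0, ?_, ?_⟩)
      · refine Finsupp.support_sub.trans (Finset.union_subset ?_ hsupp)
        exact Finsupp.support_mapRange.trans hsupp
      · simpa using hi0
      · simp [cg, hc'0]
  have hk : ∀ i, ∃ u : k, algebraMap k K u = c' i := fun i =>
    (InfiniteGalois.mem_range_algebraMap_iff_fixed (k := k) (K := K) (c' i)).2 fun g => hfix g i
  choose u hu using hk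
  let v : ι →₀ k := Finsupp.onFinset c'.support u (fun i hi => by
    rw [Finsupp.mem_support_iff, ← hu]
    exact (map_ne_zero _).2 hi)
  have hv : Finsupp.linearCombination k b v = 0 := by
    rw [← hc', Finsupp.linearCombination_apply, Finsupp.linearCombination_apply,
      Finsupp.onFinset_sum _ (by simp), Finsupp.sum]
    refine Finset.sum_congr rfl fun i _ => ?_
    rw [← hu i, algebraMap_smul]
  have h0 := congrArg (fun h => h i0) (hlin v hv)
  simp only [v, Finsupp.onFinset_apply, Finsupp.coe_zero, Pi.zero_apply] at h0
  have := hu i0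
  rw [h0, map_zero, hc'0] at this
  exact zero_ne_one this

lemma domain_of_fixed (A : Subalgebra k B)
    (hA : ∀ g : K ≃ₐ[k] K, ∃ G : B →+* B, (∀ c, G (algebraMap K B c) = algebraMap K B (g c)) ∧
      ∀ z ∈ A, G z = z) : IsDomain (TensorProduct k K A) := by
  let μ : TensorProduct k K A →ₐ[K] B :=
    Algebra.TensorProduct.lift (Algebra.ofId K B) A.val (fun _ _ => Commute.all _ _)
  have hμ : Function.Injective μ := by
    let bs := Module.Basis.ofVectorSpace k A
    let bK := Algebra.TensorProduct.basis K bs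
    have hli : LinearIndependent K (fun i => (bs i : B)) := by
      refine artin (k := k) _ (fun g => ?_) ?_
      · obtain ⟨G, h1, h2⟩ := hA g
        exact ⟨G, h1, fun i => h2 _ (bs i).2⟩
      · exact bs.linearIndependent.map' A.val.toLinearMap
          (LinearMap.ker_eq_bot.2 Subtype.val_injective)
    rw [injective_iff_map_eq_zero]
    intro z hz
    have h1 : z = Finsupp.linearCombination K bK (bK.repr z) := (bK.linearCombination_repr z).symm
    have h2 : μ z = Finsupp.linearCombination K (fun i => (bs i : B)) (bK.repr z) := by
      conv_lhs => rw [h1]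
      have := Finsupp.apply_linearCombination K μ.toLinearMap bK (bK.repr z)
      rw [AlgHom.toLinearMap_apply] at this
      rw [this]
      congr 2
      funext i
      simp [bK, μ]
    rw [h2] at hz
    have h3 := (linearIndependent_iff.1 hli) _ hz
    exact (LinearEquiv.map_eq_zero_iff _).1 h3
  exact Function.Injective.isDomain μ.toRingHom hμ

end Descent

section Final

lemma final_step (k K B : Type) [Field k] [Field K] [Algebra k K] [IsGalois k K] [Field B]
    [Algebra K B] [Algebra k B] [IsScalarTower k K B]
    (hPAC : ∀ (A : Type) [CommRing A] [Algebra k A], Algebra.FiniteType k A →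
      IsDomain (TensorProduct k K A) → Nonempty (A →ₐ[k] k))
    {N s : ℕ} (f : Fin s → MvPolynomial (Fin N) k) (x : Fin N → B)
    (hfx : ∀ l, aeval x (f l) = 0) (i : Fin N) (hi : x i ≠ 0)
    (hG : ∀ g : K ≃ₐ[k] K, ∃ G : B →+* B, (∀ c, G (algebraMap K B c) = algebraMap K B (g c)) ∧
      ∀ j, G (x j) = x j) :
    ∃ a : Fin N → k, a ≠ 0 ∧ ∀ l, MvPolynomial.eval a (f l) = 0 := by
  let A : Subalgebra k B := Algebra.adjoin k (insert (x i)⁻¹ (Set.range x))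
  have hxA : ∀ j, x j ∈ A := fun j => Algebra.subset_adjoin (Or.inr ⟨j, rfl⟩)
  have hiA : (x i)⁻¹ ∈ A := Algebra.subset_adjoin (Or.inl rfl)
  have hft : Algebra.FiniteType k A := by
    rw [← Subalgebra.fg_iff_finiteType]
    exact Subalgebra.fg_def.2 ⟨_, (Set.finite_range x).insert _, rfl⟩
  have hdom : IsDomain (TensorProduct k K A) := by
    refine domain_of_fixed A fun g => ?_
    obtain ⟨G, h1, h2⟩ := hG g
    refine ⟨G, h1, fun z hz => ?_⟩
    induction hz using Algebra.adjoin_induction with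
    | mem z hz =>
      rcases hz with rfl | ⟨j, rfl⟩
      · rw [map_inv₀, h2]
      · exact h2 j
    | algebraMap r =>
      rw [IsScalarTower.algebraMap_apply k K B, h1, AlgEquiv.commutes]
    | add z w _ _ hz hw => rw [map_add, hz, hw]
    | mul z w _ _ hz hw => rw [map_mul, hz, hw]
  obtain ⟨φ⟩ := hPAC A hft hdom
  refine ⟨fun j => φ ⟨x j, hxA j⟩, ?_, fun l => ?_⟩
  · intro h0
    have h1 : φ ⟨x i, hxA i⟩ = 0 := congrFun h0 i
    have h2 : (⟨x i, hxA i⟩ : A) * ⟨(x i)⁻¹, hiA⟩ = 1 := Subtype.ext (mul_inv_cancel₀ hi)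
    have h3 := congrArg φ h2
    rw [map_mul, h1, zero_mul, map_one] at h3
    exact zero_ne_one h3
  · have h1 : aeval (fun j => (⟨x j, hxA j⟩ : A)) (f l) = 0 := by
      apply Subtype.ext
      have := comp_aeval_apply (f := fun j => (⟨x j, hxA j⟩ : A)) A.val (f l)
      exact this.trans (hfx l)
    have h2 := comp_aeval_apply (f := fun j => (⟨x j, hxA j⟩ : A)) φ (f l)
    rw [h1, map_zero] at h2
    rw [h2, MvPolynomial.aeval_eq_eval]

end Final
end PACC1

namespace PACC1
open MvPolynomial

theorem main_aux
    (k : Type) [Field k] [CharZero k]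
    (hPAC : ∀ (A : Type) [CommRing A] [Algebra k A], Algebra.FiniteType k A →
      IsDomain (TensorProduct k (AlgebraicClosure k) A) → Nonempty (A →ₐ[k] k))
    (n s : ℕ) (f : Fin s → MvPolynomial (Fin (n + 1)) k) (d : Fin s → ℕ)
    (hf : ∀ i, (f i).IsHomogeneous (d i)) (hd1 : ∀ i, 1 ≤ d i)
    (hdn : ∑ i, d i ≤ n) :
    ∃ a : Fin (n + 1) → k, a ≠ 0 ∧ ∀ i, MvPolynomial.eval a (f i) = 0 := by
  let K := AlgebraicClosure k
  have : Infinite K := inferInstance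
  obtain ⟨P, hP, hfP, ⟨i, hi⟩, hgal⟩ := PACC1.exists_prime (K := AlgebraicClosure k)
    (fun l => MvPolynomial.map (algebraMap k (AlgebraicClosure k)) (f l)) d
    (fun l => (hf l).map _) hd1 (Nat.lt_succ_of_le hdn)
  let B := FractionRing (MvPolynomial (Fin (n + 1)) (AlgebraicClosure k) ⧸ P)
  have hinj : Function.Injective
      (algebraMap (MvPolynomial (Fin (n + 1)) (AlgebraicClosure k) ⧸ P) B) :=
    IsFractionRing.injective _ _
  refine PACC1.final_step k (AlgebraicClosure k) B hPAC f
    (fun j => algebraMap (MvPolynomial (Fin (n + 1)) (AlgebraicClosure k) ⧸ P) B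
      (Ideal.Quotient.mk P (X j))) ?_ i ?_ ?_
  · intro l
    let ψ : MvPolynomial (Fin (n + 1)) (AlgebraicClosure k) →ₐ[AlgebraicClosure k] B :=
      (IsScalarTower.toAlgHom (AlgebraicClosure k) _ B).comp (Ideal.Quotient.mkₐ _ P)
    have h1 : ψ (MvPolynomial.map (algebraMap k (AlgebraicClosure k)) (f l)) = 0 := by
      have : Ideal.Quotient.mk P (MvPolynomial.map (algebraMap k (AlgebraicClosure k)) (f l)) = 0 :=
        Ideal.Quotient.eq_zero_iff_mem.2 (hfP l)
      change algebraMap _ B (Ideal.Quotient.mk P _) = 0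
      rw [this, map_zero]
    have h2 : (aeval fun j => ψ (X j)) (MvPolynomial.map (algebraMap k (AlgebraicClosure k)) (f l))
        = 0 := by
      rw [← h1]
      conv_rhs => rw [← aeval_X_left_apply (MvPolynomial.map _ (f l)), comp_aeval_apply]
    rw [aeval_map_algebraMap] at h2
    exact h2
  · intro h
    rw [← map_zero (algebraMap (MvPolynomial (Fin (n + 1)) (AlgebraicClosure k) ⧸ P) B)] at h
    exact hi (Ideal.Quotient.eq_zero_iff_mem.1 (hinj h))
  · intro g
    have hfix : ∀ (g : AlgebraicClosure k ≃ₐ[k] AlgebraicClosure k) (l : Fin s),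
        MvPolynomial.map ((g : AlgebraicClosure k ≃+* AlgebraicClosure k) :
          AlgebraicClosure k →+* AlgebraicClosure k)
          (MvPolynomial.map (algebraMap k (AlgebraicClosure k)) (f l)) =
        MvPolynomial.map (algebraMap k (AlgebraicClosure k)) (f l) := by
      intro g l
      rw [MvPolynomial.map_map]
      have e : ((g : AlgebraicClosure k ≃+* AlgebraicClosure k) :
          AlgebraicClosure k →+* AlgebraicClosure k).comp (algebraMap k (AlgebraicClosure k)) =
          algebraMap k (AlgebraicClosure k) := RingHom.ext fun c => g.commutes c
      rw [e]
    let G0 := MvPolynomial.map (σ := Fin (n + 1))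
      ((g : AlgebraicClosure k ≃+* AlgebraicClosure k) :
          AlgebraicClosure k →+* AlgebraicClosure k)
    have hle1 : P.comap G0 ≤ P := fun z hz => hgal g (hfix g) z hz
    have hle2 : P ≤ P.comap G0 := by
      intro z hz
      refine hgal g.symm (hfix g.symm) _ ?_
      have : MvPolynomial.map ((g.symm : AlgebraicClosure k ≃+* AlgebraicClosure k) :
          AlgebraicClosure k →+* AlgebraicClosure k) (G0 z) = z := by
        rw [MvPolynomial.map_map]
        have e : ((g.symm : AlgebraicClosure k ≃+* AlgebraicClosure k) :
          AlgebraicClosure k →+* AlgebraicClosure k).comp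
          ((g : AlgebraicClosure k ≃+* AlgebraicClosure k) :
          AlgebraicClosure k →+* AlgebraicClosure k) = RingHom.id _ := by
          ext c; simp
        rw [e, MvPolynomial.map_id]
      rwa [this]
    let G1 : MvPolynomial (Fin (n + 1)) (AlgebraicClosure k) ⧸ P →+* _ :=
      Ideal.quotientMap P G0 hle2
    have hG1 : Function.Injective G1 := Ideal.quotientMap_injective' hle1
    let G : B →+* B := IsFractionRing.map (K := B) (L := B) hG1
    have hG : ∀ z, G (algebraMap _ B z) = algebraMap _ B (G1 z) := fun z =>
      IsLocalization.map_eq _ z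
    refine ⟨G, fun c => ?_, fun j => ?_⟩
    · have e : ∀ c, algebraMap (AlgebraicClosure k) B c =
        algebraMap (MvPolynomial (Fin (n + 1)) (AlgebraicClosure k) ⧸ P) B
          (Ideal.Quotient.mk P (C c)) := fun c => rfl
      rw [e, e, hG]
      congr 1
      change Ideal.quotientMap P G0 hle2 _ = _
      rw [Ideal.quotientMap_mk]
      simp [G0]
    · rw [hG]
      congr 1
      change Ideal.quotientMap P G0 hle2 _ = _
      rw [Ideal.quotientMap_mk]
      simp [G0]

end PACC1

/-- Every PAC field `k` of characteristic 0 has property `C₁'`: given homogeneous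
polynomials `f₁, …, f_s ∈ k[x₀, …, xₙ]` of degrees `d₁, …, d_s ≥ 1` with
`d₁ + ⋯ + d_s ≤ n`, the system `f₁ = ⋯ = f_s = 0` has a common nontrivial zero in
`k^{n+1}`. PAC is formulated algebraically: every finitely generated `k`-algebra `A`
with `AlgebraicClosure k ⊗[k] A` an integral domain admits a `k`-algebra
homomorphism `A → k`. -/
theorem pac_field_char_zero_is_C1'
    (k : Type) [Field k] [CharZero k]
    (hPAC : ∀ (A : Type) [CommRing A] [Algebra k A], Algebra.FiniteType k A →
      IsDomain (TensorProduct k (AlgebraicClosure k) A) → Nonempty (A →ₐ[k] k))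
    (n s : ℕ) (f : Fin s → MvPolynomial (Fin (n + 1)) k) (d : Fin s → ℕ)
    (hf : ∀ i, (f i).IsHomogeneous (d i)) (hd1 : ∀ i, 1 ≤ d i)
    (hdn : ∑ i, d i ≤ n) :
    ∃ a : Fin (n + 1) → k, a ≠ 0 ∧ ∀ i, MvPolynomial.eval a (f i) = 0 := by
  exact PACC1.main_aux k hPAC n s f d hf hd1 hdn
end
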